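/- Let d ≥ 2 be even and let n = p + q > d with p, q ≥ 1, and let 0 < κ < n − d. Let {I_t}_{t>0} be a decreasing family of bounded measurable subsets of ℝ with Lebesgue measures |I_t| = c·t^{−κ} for some constant c > 0. For g ∈ SL_n(ℝ) and t > 0 set A_{g,I_t,t} = F₀⁻¹(I_t) ∩ B_t·g. Then there exists δ ∈ (0, 1) such that for Haar-almost every g ∈ SL_n(ℝ) there exists t_g > 0 such that for all t ≥ t_g: D(ℤⁿg, A_{g,I_t,t}) < vol(A_{g,I_t,t})^δ. -/

import Mathlib

open MeasureTheory Matrix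

noncomputable section

/-- `SL_n(ℝ)`. -/
abbrev SLR (n : ℕ) := Matrix.SpecialLinearGroup (Fin n) ℝ

instance (n : ℕ) : TopologicalSpace (SLR n) :=
  TopologicalSpace.induced (fun g => (g : Matrix (Fin n) (Fin n) ℝ)) inferInstance

instance (n : ℕ) : MeasurableSpace (SLR n) := borel _

/-- Euclidean norm on `ℝⁿ`. -/
def eucNorm {n : ℕ} (v : Fin n → ℝ) : ℝ := Real.sqrt (∑ i, v i ^ 2)

/-- `F₀(v) = Σ_{i=1}^p v_i^d − Σ_{i=p+1}^n v_i^d` on `ℝ^{p+q}`. -/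
def F0 (p q d : ℕ) (v : Fin (p + q) → ℝ) : ℝ :=
  ∑ i : Fin (p + q), (if (i : ℕ) < p then (1 : ℝ) else -1) * v i ^ d

/-- The coercion `ℤⁿ → ℝⁿ`. -/
def intVec {n : ℕ} (v : Fin n → ℤ) : Fin n → ℝ := fun i => (v i : ℝ)

/-- Number of points of the lattice `ℤⁿg` lying in `A`. -/
def latCount {n : ℕ} (g : SLR n) (A : Set (Fin n → ℝ)) : ℕ :=
  Nat.card {v : Fin n → ℤ |
    Matrix.vecMul (intVec v) (g : Matrix (Fin n) (Fin n) ℝ) ∈ A}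

/-- The discrepancy `D(ℤⁿg, A) = |#(ℤⁿg ∩ A) − vol(A)|`. -/
def disc {n : ℕ} (g : SLR n) (A : Set (Fin n → ℝ)) : ℝ :=
  |(latCount g A : ℝ) - (volume A).toReal|

/-- The set `A_{g,I,t} = F₀⁻¹(I) ∩ B_t·g`. -/
def Aset (p q d : ℕ) (g : SLR (p + q)) (I : Set ℝ) (t : ℝ) : Set (Fin (p + q) → ℝ) :=
  {w | F0 p q d w ∈ I} ∩
    ((fun v => Matrix.vecMul v (g : Matrix (Fin (p + q)) (Fin (p + q)) ℝ)) ''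
      {v | eucNorm v ≤ t})

/-- The diagonal form `Σ σ_i v_i^d`. -/
def diagForm {n : ℕ} (σ : Fin n → ℝ) (d : ℕ) (v : Fin n → ℝ) : ℝ := ∑ i, σ i * v i ^ d

/-- The sum of the absolute values of the entries of a matrix. -/
def entrySum {n : ℕ} (A : Matrix (Fin n) (Fin n) ℝ) : ℝ := ∑ i, ∑ j, |A i j|

section entrySum

variable {n : ℕ}

lemma entrySum_nonneg (A : Matrix (Fin n) (Fin n) ℝ) : 0 ≤ entrySum A :=
  Finset.sum_nonneg fun _ _ => Finset.sum_nonneg fun _ _ => abs_nonneg _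

lemma entrySum_one : entrySum (1 : Matrix (Fin n) (Fin n) ℝ) = n := by
  simp [entrySum, Matrix.one_apply, apply_ite abs]

lemma abs_entry_le_entrySum (A : Matrix (Fin n) (Fin n) ℝ) (i j : Fin n) :
    |A i j| ≤ entrySum A :=
  (Finset.single_le_sum (f := fun j => |A i j|) (fun _ _ => abs_nonneg _) (Finset.mem_univ j)).trans
    (Finset.single_le_sum (f := fun i => ∑ j, |A i j|)
      (fun _ _ => Finset.sum_nonneg fun _ _ => abs_nonneg _) (Finset.mem_univ i))

lemma entrySum_le_of_entry_le {A : Matrix (Fin n) (Fin n) ℝ} {c : ℝ}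
    (h : ∀ i j, |A i j| ≤ c) : entrySum A ≤ n ^ 2 * c := by
  calc entrySum A ≤ ∑ _i : Fin n, ∑ _j : Fin n, c :=
        Finset.sum_le_sum fun i _ => Finset.sum_le_sum fun j _ => h i j
    _ = n ^ 2 * c := by simp; ring

lemma entrySum_add_le (A B : Matrix (Fin n) (Fin n) ℝ) :
    entrySum (A + B) ≤ entrySum A + entrySum B := by
  simp only [entrySum, ← Finset.sum_add_distrib]
  exact Finset.sum_le_sum fun i _ => Finset.sum_le_sum fun j _ => abs_add_le _ _

lemma abs_entrySum_sub_le (A B : Matrix (Fin n) (Fin n) ℝ) :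
    |entrySum A - entrySum B| ≤ entrySum (A - B) := by
  have h1 := entrySum_add_le (A - B) B
  have h2 := entrySum_add_le (B - A) A
  have h3 : entrySum (B - A) = entrySum (A - B) := by
    simp [entrySum, abs_sub_comm]
  rw [sub_add_cancel] at h1 h2
  rw [abs_le]; constructor <;> linarith

lemma entrySum_mul_le (A B : Matrix (Fin n) (Fin n) ℝ) :
    entrySum (A * B) ≤ entrySum A * entrySum B := by
  have h : ∀ i, ∑ j, |(A * B) i j| ≤ ∑ k, |A i k| * ∑ j, |B k j| := by
    intro i
    calc ∑ j, |(A * B) i j| ≤ ∑ j, ∑ k, |A i k| * |B k j| := by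
          refine Finset.sum_le_sum fun j _ => ?_
          rw [Matrix.mul_apply]
          exact (Finset.abs_sum_le_sum_abs _ _).trans (by simp [abs_mul])
      _ = _ := by rw [Finset.sum_comm]; simp [Finset.mul_sum]
  calc entrySum (A * B) ≤ ∑ i, ∑ k, |A i k| * ∑ j, |B k j| := Finset.sum_le_sum fun i _ => h i
    _ ≤ ∑ i, ∑ k, |A i k| * entrySum B := by
        refine Finset.sum_le_sum fun i _ => Finset.sum_le_sum fun k _ => ?_
        refine mul_le_mul_of_nonneg_left ?_ (abs_nonneg _)
        exact Finset.single_le_sum (f := fun k => ∑ j, |B k j|)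
          (fun _ _ => Finset.sum_nonneg fun _ _ => abs_nonneg _) (Finset.mem_univ k)
    _ = entrySum A * entrySum B := by simp [entrySum, Finset.sum_mul]

lemma norm_vecMul_le (v : Fin n → ℝ) (A : Matrix (Fin n) (Fin n) ℝ) :
    ‖v ᵥ* A‖ ≤ ‖v‖ * entrySum A := by
  refine (pi_norm_le_iff_of_nonneg (mul_nonneg (norm_nonneg _) (entrySum_nonneg _))).2 fun j => ?_
  rw [Real.norm_eq_abs, Matrix.vecMul, dotProduct]
  calc |∑ i, v i * A i j| ≤ ∑ i, |v i| * |A i j| :=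
        (Finset.abs_sum_le_sum_abs _ _).trans (by simp [abs_mul])
    _ ≤ ∑ i, ‖v‖ * ∑ j, |A i j| := by
        refine Finset.sum_le_sum fun i _ => mul_le_mul (norm_le_pi_norm v i) ?_ (abs_nonneg _)
          (norm_nonneg _)
        exact Finset.single_le_sum (f := fun j => |A i j|) (fun _ _ => abs_nonneg _)
          (Finset.mem_univ j)
    _ = ‖v‖ * entrySum A := by simp [entrySum, Finset.mul_sum]

lemma continuous_entrySum : Continuous (entrySum : Matrix (Fin n) (Fin n) ℝ → ℝ) := by
  unfold entrySum
  fun_prop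

end entrySum

section group

variable {n : ℕ}

instance : BorelSpace (SLR n) := ⟨rfl⟩

lemma SLR.isInducing_coe :
    Topology.IsInducing (fun g : SLR n => (g : Matrix (Fin n) (Fin n) ℝ)) := ⟨rfl⟩

lemma SLR.continuous_coe :
    Continuous (fun g : SLR n => (g : Matrix (Fin n) (Fin n) ℝ)) := SLR.isInducing_coe.continuous

instance : ContinuousMul (SLR n) := ⟨by
  rw [SLR.isInducing_coe.continuous_iff]
  have : (fun g : SLR n => (g : Matrix (Fin n) (Fin n) ℝ)) ∘ (fun p : SLR n × SLR n => p.1 * p.2)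
      = fun p => (p.1 : Matrix (Fin n) (Fin n) ℝ) * (p.2 : Matrix (Fin n) (Fin n) ℝ) := by
    ext p; simp
  rw [this]
  exact (SLR.continuous_coe.comp continuous_fst).mul (SLR.continuous_coe.comp continuous_snd)⟩

instance : MeasurableMul (SLR n) where
  measurable_const_mul g := (continuous_const_mul g).measurable
  measurable_mul_const g := (continuous_mul_const g).measurable

lemma SLR.continuous_inv_coe :
    Continuous (fun g : SLR n => ((g⁻¹ : SLR n) : Matrix (Fin n) (Fin n) ℝ)) := by
  simp only [Matrix.SpecialLinearGroup.coe_inv]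
  exact SLR.continuous_coe.matrix_adjugate

lemma SLR.measurable_entry (i j : Fin n) : Measurable (fun g : SLR n => g i j) :=
  (SLR.continuous_coe.matrix_elem i j).measurable

/-- The norm-like function `entrySum` on `SL_n(ℝ)`. -/
def slSize (g : SLR n) : ℝ := entrySum (g : Matrix (Fin n) (Fin n) ℝ)

lemma slSize_nonneg (g : SLR n) : 0 ≤ slSize g := entrySum_nonneg _

lemma slSize_mul_le (g h : SLR n) : slSize (g * h) ≤ slSize g * slSize h := by
  simpa [slSize] using entrySum_mul_le (g : Matrix (Fin n) (Fin n) ℝ) h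

lemma continuous_slSize : Continuous (slSize : SLR n → ℝ) :=
  continuous_entrySum.comp SLR.continuous_coe

lemma measurable_slSize : Measurable (slSize : SLR n → ℝ) := continuous_slSize.measurable

/-- Elements of `SL_n(ℝ)` of size at most `R`. -/
def slBall (n : ℕ) (R : ℝ) : Set (SLR n) := {g | slSize g ≤ R}

lemma measurableSet_slBall (R : ℝ) : MeasurableSet (slBall n R) :=
  measurableSet_le measurable_slSize measurable_const

lemma isCompact_slBall (R : ℝ) : IsCompact (slBall n R) := by
  rw [SLR.isInducing_coe.isCompact_iff]
  have hcl : IsClosed ({A : Matrix (Fin n) (Fin n) ℝ | A.det = 1} ∩ {A | entrySum A ≤ R}) :=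
    (isClosed_eq (Continuous.matrix_det continuous_id) continuous_const).inter
      (isClosed_le continuous_entrySum continuous_const)
  have himg : (fun g : SLR n => (g : Matrix (Fin n) (Fin n) ℝ)) '' slBall n R
      = {A | A.det = 1} ∩ {A | entrySum A ≤ R} := by
    ext A
    constructor
    · rintro ⟨g, hg, rfl⟩
      exact ⟨g.2, hg⟩
    · rintro ⟨h1, h2⟩
      exact ⟨⟨A, h1⟩, h2, rfl⟩
  rw [himg]
  refine IsCompact.of_isClosed_subset
    (isCompact_univ_pi fun _ : Fin n => isCompact_univ_pi fun _ : Fin n =>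
      (isCompact_Icc : IsCompact (Set.Icc (-R) R))) hcl ?_
  rintro A ⟨-, hA⟩ i - j -
  exact abs_le.1 ((abs_entry_le_entrySum A i j).trans hA)

lemma exists_slSize_inv_le (n : ℕ) (R : ℝ) :
    ∃ R' : ℝ, 1 ≤ R' ∧ ∀ g : SLR n, slSize g ≤ R → slSize g⁻¹ ≤ R' := by
  have hc : Continuous (fun g : SLR n => slSize g⁻¹) :=
    continuous_entrySum.comp SLR.continuous_inv_coe
  obtain ⟨C, hC⟩ := (isCompact_slBall (n := n) R).bddAbove_image hc.continuousOn
  exact ⟨max C 1, le_max_right _ _, fun g hg => (hC ⟨g, hg, rfl⟩).trans (le_max_left _ _)⟩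

lemma measure_slBall_lt_top (μ : Measure (SLR n)) [μ.IsHaarMeasure] (R : ℝ) :
    μ (slBall n R) < ⊤ := (isCompact_slBall R).measure_lt_top

/-- The row vector `x g`. -/
def act (x : Fin n → ℝ) (g : SLR n) : Fin n → ℝ := x ᵥ* (g : Matrix (Fin n) (Fin n) ℝ)

lemma act_mul (x : Fin n → ℝ) (g h : SLR n) : act x (g * h) = act (act x g) h := by
  simp [act, Matrix.vecMul_vecMul]

lemma act_one (x : Fin n → ℝ) : act x 1 = x := by simp [act]

lemma act_act_inv (x : Fin n → ℝ) (g : SLR n) : act (act x g) g⁻¹ = x := by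
  rw [← act_mul, mul_inv_cancel, act_one]

lemma act_add (x y : Fin n → ℝ) (g : SLR n) : act (x + y) g = act x g + act y g :=
  Matrix.add_vecMul _ _ _

lemma act_smul (a : ℝ) (x : Fin n → ℝ) (g : SLR n) : act (a • x) g = a • act x g :=
  Matrix.smul_vecMul _ _ _

lemma norm_act_le (x : Fin n → ℝ) (g : SLR n) : ‖act x g‖ ≤ ‖x‖ * slSize g := norm_vecMul_le _ _

lemma measurable_act : Measurable (fun p : (Fin n → ℝ) × SLR n => act p.1 p.2) := by
  refine measurable_pi_lambda _ fun j => ?_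
  simp only [act, Matrix.vecMul, dotProduct]
  refine Finset.measurable_fun_sum _ fun i _ => Measurable.mul ?_ ?_
  · exact (measurable_pi_apply i).comp measurable_fst
  · exact (SLR.measurable_entry i j).comp measurable_snd

lemma measurable_diagForm (σ : Fin n → ℝ) (d : ℕ) : Measurable (diagForm σ d) := by
  unfold diagForm
  fun_prop

lemma volume_preimage_act (g : SLR n) (A : Set (Fin n → ℝ)) :
    volume ((fun x => act x g) ⁻¹' A) = volume A := by
  have hdet : LinearMap.det (Matrix.vecMulLinear (g : Matrix (Fin n) (Fin n) ℝ)) = 1 := by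
    have : Matrix.vecMulLinear (g : Matrix (Fin n) (Fin n) ℝ)
        = Matrix.toLin' (g : Matrix (Fin n) (Fin n) ℝ)ᵀ := by
      ext x j
      simp [Matrix.vecMul, Matrix.mulVec, dotProduct, mul_comm]
    rw [this, LinearMap.det_toLin', Matrix.det_transpose]
    exact g.2
  have := Measure.addHaar_preimage_linearMap (volume : Measure (Fin n → ℝ))
    (f := Matrix.vecMulLinear (g : Matrix (Fin n) (Fin n) ℝ)) (by rw [hdet]; exact one_ne_zero) A
  rw [hdet] at this
  have h2 : (⇑(Matrix.vecMulLinear (g : Matrix (Fin n) (Fin n) ℝ))) = fun x => act x g := by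
    ext x; simp [act]
  rw [h2] at this
  simpa using this

end group

section oneDim

lemma volume_le_of_expanding {φ : ℝ → ℝ} {A J : Set ℝ} {K : ℝ} (hK : 0 < K)
    (hφ : ∀ z ∈ A, ∀ z' ∈ A, K * |z - z'| ≤ |φ z - φ z'|) (hA : Set.MapsTo φ A J) :
    volume A ≤ ENNReal.ofReal K⁻¹ * volume J := by
  have hinj : Set.InjOn φ A := by
    intro z hz z' hz' h
    have := hφ z hz z' hz'
    rw [h, sub_self, abs_zero] at this
    have h0 : |z - z'| ≤ 0 := by
      by_contra hcon
      push Not at hcon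
      nlinarith
    exact sub_eq_zero.1 (abs_eq_zero.1 (le_antisymm h0 (abs_nonneg _)))
  have hL : LipschitzOnWith K⁻¹.toNNReal (Function.invFunOn φ A) (φ '' A) := by
    refine LipschitzOnWith.of_dist_le_mul ?_
    rintro _ ⟨z, hz, rfl⟩ _ ⟨z', hz', rfl⟩
    rw [hinj.leftInvOn_invFunOn hz, hinj.leftInvOn_invFunOn hz',
      Real.coe_toNNReal _ (inv_nonneg.2 hK.le), Real.dist_eq, Real.dist_eq, inv_mul_eq_div,
      le_div_iff₀ hK, mul_comm]
    exact hφ z hz z' hz'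
  have h1 := hL.hausdorffMeasure_image_le (d := 1) zero_le_one
  rw [hinj.leftInvOn_invFunOn.image_image] at h1
  simp only [hausdorffMeasure_real] at h1
  calc volume A ≤ _ := h1
    _ ≤ _ := by
      rw [ENNReal.rpow_one]
      exact mul_le_mul_right (measure_mono hA.image_subset) _

lemma pow_sub_pow_expanding {d : ℕ} (hd : 1 ≤ d) {m z z' : ℝ} (hm : 0 ≤ m) (hz : m ≤ z)
    (hz' : m ≤ z') : m ^ (d - 1) * |z - z'| ≤ |z ^ d - z' ^ d| := by
  wlog h : z' ≤ z generalizing z z'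
  · rw [abs_sub_comm z, abs_sub_comm (z ^ d)]
    exact this hz' hz (le_of_not_ge h)
  obtain ⟨e, rfl⟩ : ∃ e, d = e + 1 := ⟨d - 1, by omega⟩
  have h1 : m ^ e ≤ z' ^ e := pow_le_pow_left₀ hm hz' e
  have h2 : z' ^ e ≤ z ^ e := pow_le_pow_left₀ (hm.trans hz') h e
  have h3 : z' ^ (e + 1) ≤ z ^ (e + 1) := pow_le_pow_left₀ (hm.trans hz') h _
  rw [abs_of_nonneg (sub_nonneg.2 h), abs_of_nonneg (sub_nonneg.2 h3)]
  simp only [Nat.add_sub_cancel, pow_succ]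
  nlinarith [mul_nonneg (sub_nonneg.2 h) (sub_nonneg.2 h1),
    mul_nonneg (hm.trans hz) (sub_nonneg.2 h2)]

lemma volume_pow_preimage_le {d : ℕ} (hd : 1 ≤ d) (hde : Even d) {σ b m : ℝ} (hσ : |σ| = 1)
    (hm : 0 < m) (J : Set ℝ) :
    volume {z : ℝ | m ≤ |z| ∧ σ * z ^ d + b ∈ J}
      ≤ ENNReal.ofReal (2 / m ^ (d - 1)) * volume J := by
  have key : ∀ z z' : ℝ, |(σ * z ^ d + b) - (σ * z' ^ d + b)| = |z ^ d - z' ^ d| := by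
    intro z z'
    rw [show (σ * z ^ d + b) - (σ * z' ^ d + b) = σ * (z ^ d - z' ^ d) by ring, abs_mul, hσ,
      one_mul]
  have hmp : 0 < m ^ (d - 1) := pow_pos hm _
  have h1 : volume {z : ℝ | m ≤ z ∧ σ * z ^ d + b ∈ J}
      ≤ ENNReal.ofReal (m ^ (d - 1))⁻¹ * volume J := by
    refine volume_le_of_expanding (φ := fun z => σ * z ^ d + b) hmp ?_ fun z hz => hz.2
    rintro z ⟨hz, -⟩ z' ⟨hz', -⟩
    rw [key]
    exact pow_sub_pow_expanding hd hm.le hz hz'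
  have h2 : volume {z : ℝ | m ≤ -z ∧ σ * z ^ d + b ∈ J}
      ≤ ENNReal.ofReal (m ^ (d - 1))⁻¹ * volume J := by
    refine volume_le_of_expanding (φ := fun z => σ * z ^ d + b) hmp ?_ fun z hz => hz.2
    rintro z ⟨hz, -⟩ z' ⟨hz', -⟩
    rw [key, ← hde.neg_pow z, ← hde.neg_pow z',
      show |z - z'| = |-z - -z'| by rw [← abs_neg]; congr 1; ring]
    exact pow_sub_pow_expanding hd hm.le hz hz'
  calc volume {z : ℝ | m ≤ |z| ∧ σ * z ^ d + b ∈ J}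
      ≤ volume ({z : ℝ | m ≤ z ∧ σ * z ^ d + b ∈ J} ∪ {z : ℝ | m ≤ -z ∧ σ * z ^ d + b ∈ J}) := by
        refine measure_mono ?_
        rintro z ⟨hz, hJ⟩
        rcases le_abs.1 hz with h | h
        · exact Or.inl ⟨h, hJ⟩
        · exact Or.inr ⟨h, hJ⟩
    _ ≤ _ := (measure_union_le _ _).trans (add_le_add h1 h2)
    _ = _ := by
      rw [← add_mul, ← ENNReal.ofReal_add (by positivity) (by positivity)]
      congr 2
      ring

end oneDim

section slice

lemma exists_abs_eq_norm {n : ℕ} (Y : Fin (n + 1) → ℝ) : ∃ i, |Y i| = ‖Y‖ := by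
  by_contra! h
  have h' : ∀ i, ‖Y i‖ < ‖Y‖ := fun i => lt_of_le_of_ne (norm_le_pi_norm Y i) (h i)
  exact lt_irrefl _ ((pi_norm_lt_iff ((norm_nonneg _).trans_lt (h' 0))).2 h')

/-- The data of the sign vector of a diagonal form. -/
def IsSign {n : ℕ} (σ : Fin n → ℝ) : Prop := ∀ i, |σ i| = 1

lemma diagForm_insertNth {n : ℕ} (σ : Fin (n + 1) → ℝ) (d : ℕ) (i : Fin (n + 1)) (z : ℝ)
    (y : Fin n → ℝ) :
    diagForm σ d (i.insertNth z y) = σ i * z ^ d + diagForm (fun j => σ (i.succAbove j)) d y := by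
  simp [diagForm, Fin.sum_univ_succAbove _ i]

lemma volume_slice_coord_le {n d : ℕ} {σ : Fin (n + 1) → ℝ} (hσ : IsSign σ) (hd : 1 ≤ d)
    (hde : Even d) {J : Set ℝ} (hJ : MeasurableSet J) (Z : Fin (n + 1) → ℝ) {r m : ℝ} (hr : 0 ≤ r)
    (hm : 0 < m) (i : Fin (n + 1)) :
    volume {Y : Fin (n + 1) → ℝ | ‖Y - Z‖ ≤ r ∧ m ≤ |Y i| ∧ diagForm σ d Y ∈ J}
      ≤ ENNReal.ofReal ((2 * r) ^ n * (2 / m ^ (d - 1))) * volume J := by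
  have hmeas : MeasurableSet
      {Y : Fin (n + 1) → ℝ | ‖Y - Z‖ ≤ r ∧ m ≤ |Y i| ∧ diagForm σ d Y ∈ J} := by
    have h1 : Measurable fun Y : Fin (n + 1) → ℝ => ‖Y - Z‖ := by fun_prop
    have h2 : Measurable fun Y : Fin (n + 1) → ℝ => |Y i| := by fun_prop
    exact (measurableSet_le h1 measurable_const).inter
      ((measurableSet_le measurable_const h2).inter (measurable_diagForm σ d hJ))
  have hpr := (volume_preserving_piFinSuccAbove (fun _ : Fin (n + 1) => ℝ) i).symm
  rw [← hpr.measure_preimage hmeas.nullMeasurableSet]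
  set S := (MeasurableEquiv.piFinSuccAbove (fun _ : Fin (n + 1) => ℝ) i).symm ⁻¹'
    {Y : Fin (n + 1) → ℝ | ‖Y - Z‖ ≤ r ∧ m ≤ |Y i| ∧ diagForm σ d Y ∈ J} with hS
  have hSm : MeasurableSet S := hpr.measurable hmeas
  rw [Measure.volume_eq_prod, Measure.prod_apply_symm hSm]
  let Z' : Fin n → ℝ := fun j => Z (i.succAbove j)
  calc ∫⁻ y, volume ((fun x => (x, y)) ⁻¹' S)
      ≤ ∫⁻ y, (Metric.closedBall Z' r).indicator
          (fun _ => ENNReal.ofReal (2 / m ^ (d - 1)) * volume J) y := by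
        refine lintegral_mono fun y => ?_
        by_cases hy : y ∈ Metric.closedBall Z' r
        · rw [Set.indicator_of_mem hy]
          refine le_trans (measure_mono ?_)
            (volume_pow_preimage_le hd hde (hσ i) hm J
              (b := diagForm (fun j => σ (i.succAbove j)) d y))
          rintro z ⟨-, hz1, hz2⟩
          change m ≤ |i.insertNth (α := fun _ => ℝ) z y i| at hz1
          change diagForm σ d (i.insertNth z y) ∈ J at hz2
          rw [diagForm_insertNth] at hz2
          rw [Fin.insertNth_apply_same] at hz1
          exact ⟨hz1, hz2⟩
        · rw [Set.indicator_of_notMem hy]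
          rw [nonpos_iff_eq_zero]
          convert measure_empty (μ := (volume : Measure ℝ))
          refine Set.eq_empty_of_forall_notMem ?_
          rintro z ⟨hz, -⟩
          refine hy ?_
          rw [mem_closedBall_iff_norm, pi_norm_le_iff_of_nonneg hr]
          intro j
          have := (pi_norm_le_iff_of_nonneg hr).1 hz (i.succAbove j)
          simpa [Z'] using this
    _ = _ := by
      rw [lintegral_indicator measurableSet_closedBall, lintegral_const,
        Measure.restrict_apply_univ,
        Real.volume_pi_closedBall _ hr, ENNReal.ofReal_mul (by positivity)]
      simp only [Fintype.card_fin]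
      ring

lemma volume_slice_le {n d : ℕ} {σ : Fin (n + 1) → ℝ} (hσ : IsSign σ) (hd : 1 ≤ d)
    (hde : Even d) {J : Set ℝ} (hJ : MeasurableSet J) (Z : Fin (n + 1) → ℝ) {r m : ℝ} (hr : 0 ≤ r)
    (hm : 0 < m) :
    volume {Y : Fin (n + 1) → ℝ | ‖Y - Z‖ ≤ r ∧ m ≤ ‖Y‖ ∧ diagForm σ d Y ∈ J}
      ≤ ENNReal.ofReal ((n + 1) * ((2 * r) ^ n * (2 / m ^ (d - 1)))) * volume J := by
  calc volume {Y : Fin (n + 1) → ℝ | ‖Y - Z‖ ≤ r ∧ m ≤ ‖Y‖ ∧ diagForm σ d Y ∈ J}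
      ≤ volume (⋃ i, {Y : Fin (n + 1) → ℝ | ‖Y - Z‖ ≤ r ∧ m ≤ |Y i| ∧ diagForm σ d Y ∈ J}) := by
        refine measure_mono ?_
        rintro Y ⟨h1, h2, h3⟩
        obtain ⟨i, hi⟩ := exists_abs_eq_norm Y
        exact Set.mem_iUnion.2 ⟨i, h1, by rw [hi]; exact h2, h3⟩
    _ ≤ ∑ i : Fin (n + 1), ENNReal.ofReal ((2 * r) ^ n * (2 / m ^ (d - 1))) * volume J :=
        (measure_iUnion_fintype_le _ _).trans
          (Finset.sum_le_sum fun i _ => volume_slice_coord_le hσ hd hde hJ Z hr hm i)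
    _ = _ := by
      rw [Finset.sum_const, Finset.card_univ, Fintype.card_fin, nsmul_eq_mul, ← mul_assoc,
        ENNReal.ofReal_mul (p := (n : ℝ) + 1) (by positivity),
        show ((n : ℝ) + 1) = ((n + 1 : ℕ) : ℝ) by push_cast; rfl, ENNReal.ofReal_natCast]

lemma volume_affine_slice_le (n d : ℕ) (R : ℝ) (hR : 0 ≤ R) : ∃ C : ℝ, 0 < C ∧
    ∀ {σ : Fin (n + 1) → ℝ}, IsSign σ → 1 ≤ d → Even d → ∀ {J : Set ℝ}, MeasurableSet J →
    ∀ (g : SLR (n + 1)), slSize g ≤ R → ∀ (u P₀ : Fin (n + 1) → ℝ) (c ε s : ℝ), c ≠ 0 → 0 ≤ ε →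
    0 < s →
    volume {P : Fin (n + 1) → ℝ | ‖P - P₀‖ ≤ ε ∧ s ≤ ‖u + c • P‖ ∧
        diagForm σ d (act (u + c • P) g) ∈ J}
      ≤ ENNReal.ofReal (C * (ε ^ n / (|c| * s ^ (d - 1)))) * volume J := by
  obtain ⟨R', hR', hinv⟩ := exists_slSize_inv_le (n + 1) R
  have hR'0 : 0 < R' := by linarith
  refine ⟨(n + 1) * ((2 * R) ^ n * (2 * R' ^ (d - 1))) + 1, by positivity, ?_⟩
  intro σ hσ hd hde J hJ g hg u P₀ c ε s hc hε hs
  have hc0 : 0 < |c| := abs_pos.2 hc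
  set Z := act (u + c • P₀) g
  set W := {Y : Fin (n + 1) → ℝ | ‖Y - Z‖ ≤ |c| * ε * R ∧ s / R' ≤ ‖Y‖ ∧ diagForm σ d Y ∈ J}
  have hsub : {P : Fin (n + 1) → ℝ | ‖P - P₀‖ ≤ ε ∧ s ≤ ‖u + c • P‖ ∧
        diagForm σ d (act (u + c • P) g) ∈ J}
      ⊆ (fun P => c • P) ⁻¹' ((fun P => u + P) ⁻¹' ((fun x => act x g) ⁻¹' W)) := by
    rintro P ⟨h1, h2, h3⟩
    refine ⟨?_, ?_, h3⟩
    · have : act (u + c • P) g - Z = act (c • (P - P₀)) g := by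
        simp only [Z, act, ← Matrix.sub_vecMul]
        congr 1
        module
      simp only [this]
      calc ‖act (c • (P - P₀)) g‖ ≤ ‖c • (P - P₀)‖ * slSize g := norm_act_le _ _
        _ ≤ |c| * ε * R := by
          have := slSize_nonneg g
          rw [norm_smul, Real.norm_eq_abs]
          gcongr
    · rw [div_le_iff₀ hR'0]
      calc s ≤ ‖u + c • P‖ := h2
        _ = ‖act (act (u + c • P) g) g⁻¹‖ := by rw [act_act_inv]
        _ ≤ ‖act (u + c • P) g‖ * slSize g⁻¹ := norm_act_le _ _
        _ ≤ _ := by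
          gcongr
          exact hinv g hg
  calc volume _ ≤ _ := measure_mono hsub
    _ = ENNReal.ofReal |(c ^ (n + 1))⁻¹| * volume W := by
      rw [Measure.addHaar_preimage_smul _ hc, measure_preimage_add, volume_preimage_act]
      simp
    _ ≤ ENNReal.ofReal |(c ^ (n + 1))⁻¹| *
        (ENNReal.ofReal ((n + 1) * ((2 * (|c| * ε * R)) ^ n * (2 / (s / R') ^ (d - 1)))) *
          volume J) := by
      gcongr
      exact volume_slice_le hσ hd hde hJ Z (by positivity) (by positivity)
    _ = ENNReal.ofReal ((n + 1) * ((2 * R) ^ n * (2 * R' ^ (d - 1)))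
          * (ε ^ n / (|c| * s ^ (d - 1)))) * volume J := by
      rw [← mul_assoc, ← ENNReal.ofReal_mul (by positivity)]
      congr 2
      rw [abs_inv, abs_pow, div_pow, mul_pow, mul_pow, mul_pow, mul_pow]
      field_simp
      ring
    _ ≤ _ := by
      gcongr
      linarith

end slice

section perturbation

variable {n : ℕ}

/-- The identity matrix with row `i` replaced by `P` and row `j` rescaled by `1 / P i`. -/
def rowPert (i j : Fin n) (P : Fin n → ℝ) : Matrix (Fin n) (Fin n) ℝ :=
  (Matrix.diagonal fun k => if k = j then (P i)⁻¹ else 1).updateRow i P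

lemma det_rowPert {i j : Fin n} (hij : i ≠ j) {P : Fin n → ℝ} (hP : P i ≠ 0) :
    (rowPert i j P).det = 1 := by
  set D : Fin n → ℝ := fun k => if k = j then (P i)⁻¹ else 1 with hD
  have hsum : P = ∑ k, (P k * (if k = j then P i else 1)) • (Matrix.diagonal D) k := by
    funext l
    rw [Finset.sum_apply, Finset.sum_eq_single l]
    · by_cases h : l = j <;> simp [hD, h, hP]
    · intro b _ hb
      simp [Matrix.diagonal_apply_ne _ hb]
    · simp
  have hd : (Matrix.diagonal D).det = (P i)⁻¹ := by
    rw [Matrix.det_diagonal, Finset.prod_eq_single j]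
    · simp [hD]
    · intro b _ hb
      simp [hD, hb]
    · simp
  have := Matrix.det_updateRow_sum (Matrix.diagonal D) i
    (fun k => P k * (if k = j then P i else 1))
  rw [← hsum, hd] at this
  rw [rowPert, this]
  simp [hij, hP]

/-- `rowPert` as an element of `SL_n(ℝ)`. -/
def slPert (i j : Fin n) (P : Fin n → ℝ) (hij : i ≠ j) (hP : P i ≠ 0) : SLR n :=
  ⟨rowPert i j P, det_rowPert hij hP⟩

lemma act_single (i : Fin n) (g : SLR n) : act (Pi.single i 1) g = (g : Matrix _ _ ℝ) i := by
  simp [act, Matrix.row]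

lemma act_single_slPert {i j : Fin n} {P : Fin n → ℝ} (hij : i ≠ j) (hP : P i ≠ 0) :
    act (Pi.single i 1) (slPert i j P hij hP) = P := by
  rw [act_single]
  simp [slPert, rowPert]

lemma act_single_slPert_of_ne {i j k : Fin n} {P : Fin n → ℝ} (hij : i ≠ j) (hP : P i ≠ 0)
    (hki : k ≠ i) (hkj : k ≠ j) :
    act (Pi.single k 1) (slPert i j P hij hP) = Pi.single k 1 := by
  rw [act_single]
  funext l
  simp only [slPert, rowPert, Matrix.updateRow_ne hki]
  rw [Matrix.diagonal_apply, if_neg hkj, Pi.single_apply]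
  simp [eq_comm]

lemma ne_zero_of_norm_sub_single_le {i : Fin n} {P : Fin n → ℝ} {ε : ℝ}
    (h : ‖P - Pi.single i 1‖ ≤ ε) (hε : ε ≤ 1 / 2) : 1 / 2 ≤ P i := by
  have := (norm_le_pi_norm (P - Pi.single i 1) i).trans h
  rw [Pi.sub_apply, Pi.single_eq_same, Real.norm_eq_abs] at this
  linarith [(abs_le.1 this).1]

lemma entrySum_rowPert_sub_one_le {i j : Fin n} (hij : i ≠ j) {P : Fin n → ℝ} {ε : ℝ}
    (h : ‖P - Pi.single i 1‖ ≤ ε) (hε : ε ≤ 1 / 2) :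
    entrySum (rowPert i j P - 1) ≤ n ^ 2 * (2 * ε) := by
  have hPi := ne_zero_of_norm_sub_single_le h hε
  have hε0 : 0 ≤ ε := (norm_nonneg _).trans h
  have hcoord : ∀ l, |P l - (Pi.single i (1 : ℝ) : Fin n → ℝ) l| ≤ ε := fun l =>
    (norm_le_pi_norm (P - Pi.single i 1) l).trans h
  refine entrySum_le_of_entry_le fun k l => ?_
  rw [Matrix.sub_apply, rowPert, Matrix.updateRow_apply]
  by_cases hk : k = i
  · subst hk
    have := hcoord l
    rw [if_pos rfl, Matrix.one_apply]
    rw [Pi.single_apply] at this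
    simp only [eq_comm (a := l)] at this
    linarith
  · rw [if_neg hk, Matrix.diagonal_apply, Matrix.one_apply]
    by_cases hkl : k = l
    · rw [if_pos hkl, if_pos hkl]
      by_cases hkj : k = j
      · rw [if_pos hkj]
        have h0 : (0 : ℝ) < P i := by linarith
        have h1 := hcoord i
        rw [Pi.single_eq_same] at h1
        rw [show (P i)⁻¹ - 1 = -((P i - 1) / P i) by field_simp; ring, abs_neg, abs_div,
          abs_of_pos h0, div_le_iff₀ h0]
        nlinarith
      · simp [hkj, hε0]
    · simp [hkl, hε0]

lemma slSize_inv_le_of_near_one {k : SLR n}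
    (h : entrySum ((k : Matrix (Fin n) (Fin n) ℝ) - 1) ≤ 1 / 2) : slSize k⁻¹ ≤ 2 * n := by
  have h1 : ((k⁻¹ : SLR n) : Matrix (Fin n) (Fin n) ℝ)
      = 1 + -((k : Matrix (Fin n) (Fin n) ℝ) - 1) * ((k⁻¹ : SLR n) : Matrix (Fin n) (Fin n) ℝ) := by
    have : (k : Matrix (Fin n) (Fin n) ℝ) * ((k⁻¹ : SLR n) : Matrix (Fin n) (Fin n) ℝ) = 1 := by
      rw [← Matrix.SpecialLinearGroup.coe_mul, mul_inv_cancel, Matrix.SpecialLinearGroup.coe_one]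
    rw [neg_mul, sub_mul, this]
    simp
  have hneg : entrySum (-((k : Matrix (Fin n) (Fin n) ℝ) - 1)) ≤ 1 / 2 := by
    refine le_trans (le_of_eq ?_) h
    simp [entrySum, abs_sub_comm]
  have h2 : slSize k⁻¹ ≤ n + 1 / 2 * slSize k⁻¹ := by
    conv_lhs => rw [slSize, h1]
    refine (entrySum_add_le _ _).trans ?_
    rw [entrySum_one]
    refine add_le_add_right ((entrySum_mul_le _ _).trans ?_) _
    exact mul_le_mul_of_nonneg_right hneg (entrySum_nonneg _)
  linarith

end perturbation

section rotation

lemma fin_zero_ne_two {m : ℕ} : (0 : Fin (m + 3)) ≠ 2 := by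
  rw [Ne, Fin.ext_iff]
  change ¬ 0 = 2 % (m + 3)
  rw [Nat.mod_eq_of_lt (by omega)]
  norm_num

lemma fin_one_ne_two {m : ℕ} : (1 : Fin (m + 3)) ≠ 2 := by
  rw [Ne, Fin.ext_iff]
  change ¬ 1 % (m + 3) = 2 % (m + 3)
  rw [Nat.mod_eq_of_lt (by omega), Nat.mod_eq_of_lt (by omega)]
  norm_num

/-- `|x_i y_j - x_j y_i|`. -/
def absMinor {n : ℕ} (x y : Fin n → ℝ) (i j : Fin n) : ℝ := |x i * y j - x j * y i|

open InnerProductSpace in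
lemma exists_rotation {m : ℕ} (x y : Fin (m + 3) → ℝ) :
    ∃ (O : SLR (m + 3)) (a b c : ℝ), slSize O ≤ ((m + 3 : ℕ) : ℝ) ^ 2 ∧
      slSize O⁻¹ ≤ ((m + 3 : ℕ) : ℝ) ^ 2 ∧ x = act (Pi.single 0 a) O ∧
      y = act (b • Pi.single 0 1 + c • Pi.single 1 1) O ∧
      ∀ i j, absMinor x y i j ≤ 2 * (|a| * |c|) := by
  let f : Fin (m + 3) → EuclideanSpace ℝ (Fin (m + 3)) := fun i =>
    if i = 0 then WithLp.toLp 2 x else WithLp.toLp 2 y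
  have hfr : Module.finrank ℝ (EuclideanSpace ℝ (Fin (m + 3))) = Fintype.card (Fin (m + 3)) := by
    simp
  let B := gramSchmidtOrthonormalBasis hfr f
  let O₀ : Matrix (Fin (m + 3)) (Fin (m + 3)) ℝ :=
    Matrix.of fun i j => B i j
  have hO₀ : O₀ * O₀ᵀ = 1 := by
    ext i j
    have := (orthonormal_iff_ite.1 B.orthonormal) j i
    rw [Matrix.mul_apply, Matrix.one_apply]
    simp only [Matrix.transpose_apply, O₀, Matrix.of_apply]
    rw [PiLp.inner_apply] at this
    simpa [eq_comm] using this
  have hdet : O₀.det * O₀.det = 1 := by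
    have := congrArg Matrix.det hO₀
    rwa [Matrix.det_mul, Matrix.det_transpose, Matrix.det_one] at this
  let O₁ : Matrix (Fin (m + 3)) (Fin (m + 3)) ℝ := O₀.updateRow 2 (O₀.det • O₀ 2)
  have hO₁det : O₁.det = 1 := by
    rw [Matrix.det_updateRow_smul, Matrix.updateRow_eq_self, hdet]
  have hO₁D : O₁ = Matrix.diagonal (fun i => if i = 2 then O₀.det else 1) * O₀ := by
    ext i j
    rw [Matrix.diagonal_mul]
    by_cases h : i = 2 <;> simp [O₁, Matrix.updateRow_apply, h]
  have hO₁ : O₁ * O₁ᵀ = 1 := by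
    rw [hO₁D, Matrix.transpose_mul, Matrix.mul_assoc, ← Matrix.mul_assoc O₀, hO₀, Matrix.one_mul,
      Matrix.diagonal_transpose, Matrix.diagonal_mul_diagonal]
    rw [← Matrix.diagonal_one]
    congr 1
    funext i
    by_cases h : i = 2 <;> simp [h, hdet]
  have hentry : ∀ i j, |O₁ i j| ≤ 1 := by
    intro i j
    have h1 := congrFun (congrFun hO₁ i) i
    rw [Matrix.mul_apply, Matrix.one_apply_eq] at h1
    simp only [Matrix.transpose_apply] at h1
    have h2 := Finset.single_le_sum (f := fun j => O₁ i j * O₁ i j)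
      (fun j _ => mul_self_nonneg _) (Finset.mem_univ j)
    rw [h1] at h2
    exact abs_le_one_iff_mul_self_le_one.2 h2
  let O : SLR (m + 3) := ⟨O₁, hO₁det⟩
  have hinv : ((O⁻¹ : SLR (m + 3)) : Matrix (Fin (m + 3)) (Fin (m + 3)) ℝ) = O₁ᵀ := by
    have h1 : ((O⁻¹ : SLR (m + 3)) : Matrix (Fin (m + 3)) (Fin (m + 3)) ℝ) * O₁ = 1 := by
      have : (O⁻¹ * O) = 1 := inv_mul_cancel O
      have := congrArg (fun g : SLR (m + 3) => (g : Matrix (Fin (m + 3)) (Fin (m + 3)) ℝ)) this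
      simpa only [Matrix.SpecialLinearGroup.coe_mul, Matrix.SpecialLinearGroup.coe_one] using this
    exact left_inv_eq_right_inv h1 hO₁
  have hrow0 : ∀ j, O₁ 0 j = B 0 j := fun j => by
    rw [hO₁D, Matrix.diagonal_mul]; simp [O₀, fin_zero_ne_two]
  have hrow1 : ∀ j, O₁ 1 j = B 1 j := fun j => by
    rw [hO₁D, Matrix.diagonal_mul]; simp [O₀, fin_one_ne_two]
  have hx : ∀ j, x j = inner ℝ (B 0) (f 0) * O₁ 0 j := by
    intro j
    have h1 := B.sum_repr' (f 0)
    rw [Finset.sum_eq_single 0] at h1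
    · rw [hrow0]
      have := congrArg (fun v : EuclideanSpace ℝ (Fin (m + 3)) => v j) h1
      simpa [f] using this.symm
    · intro i _ hi
      rw [gramSchmidtOrthonormalBasis_inv_triangular hfr f (Fin.pos_of_ne_zero hi), zero_smul]
    · simp
  have hy : ∀ j, y j = inner ℝ (B 0) (f 1) * O₁ 0 j + inner ℝ (B 1) (f 1) * O₁ 1 j := by
    intro j
    have h1 := B.sum_repr' (f 1)
    rw [Fin.sum_univ_succ, Fin.sum_univ_succ, Finset.sum_eq_zero, add_zero] at h1
    · rw [hrow0, hrow1]
      have := congrArg (fun v : EuclideanSpace ℝ (Fin (m + 3)) => v j) h1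
      simpa [f] using this.symm
    · intro i _
      rw [gramSchmidtOrthonormalBasis_inv_triangular hfr f (by
        rw [Fin.lt_def]; simp), zero_smul]
  refine ⟨O, inner ℝ (B 0) (f 0), inner ℝ (B 0) (f 1), inner ℝ (B 1) (f 1), ?_, ?_, ?_, ?_, ?_⟩
  · change entrySum O₁ ≤ _
    simpa using entrySum_le_of_entry_le (A := O₁) hentry
  · rw [slSize, hinv]
    simpa using entrySum_le_of_entry_le (A := O₁ᵀ) fun i j => hentry j i
  · rw [show (Pi.single 0 (inner ℝ (B 0) (f 0)) : Fin (m + 3) → ℝ)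
      = (inner ℝ (B 0) (f 0)) • Pi.single 0 (1 : ℝ) by simp [← Pi.single_smul], act_smul,
        act_single]
    funext j
    exact hx j
  · rw [act_add, act_smul, act_smul, act_single, act_single]
    funext j
    exact hy j
  · intro i j
    rw [absMinor, hx i, hx j, hy i, hy j]
    set a : ℝ := inner ℝ (B 0) (f 0)
    set b : ℝ := inner ℝ (B 0) (f 1)
    set c : ℝ := inner ℝ (B 1) (f 1)
    rw [show a * O₁ 0 i * (b * O₁ 0 j + c * O₁ 1 j) - a * O₁ 0 j * (b * O₁ 0 i + c * O₁ 1 i)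
      = (a * c) * (O₁ 0 i * O₁ 1 j - O₁ 0 j * O₁ 1 i) by ring, abs_mul, abs_mul, mul_comm (2 : ℝ)]
    refine mul_le_mul_of_nonneg_left ?_ (by positivity)
    have h1 : |O₁ 0 i * O₁ 1 j| ≤ 1 := by
      rw [abs_mul]; exact mul_le_one₀ (hentry _ _) (abs_nonneg _) (hentry _ _)
    have h2 : |O₁ 0 j * O₁ 1 i| ≤ 1 := by
      rw [abs_mul]; exact mul_le_one₀ (hentry _ _) (abs_nonneg _) (hentry _ _)
    exact (abs_sub _ _).trans (by linarith)

end rotation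

section correlation

variable {n : ℕ}

/-- The set of `g` such that the form takes a value in `J` at `x g`. -/
def hit (σ : Fin n → ℝ) (d : ℕ) (J : Set ℝ) (x : Fin n → ℝ) : Set (SLR n) :=
  {g | diagForm σ d (act x g) ∈ J}

lemma measurableSet_hit_prod (σ : Fin n → ℝ) (d : ℕ) {J : Set ℝ} (hJ : MeasurableSet J) :
    MeasurableSet {p : (Fin n → ℝ) × SLR n | p.2 ∈ hit σ d J p.1} :=
  (measurable_diagForm σ d).comp measurable_act hJ

lemma measurableSet_hit (σ : Fin n → ℝ) (d : ℕ) {J : Set ℝ} (hJ : MeasurableSet J)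
    (x : Fin n → ℝ) : MeasurableSet (hit σ d J x) :=
  measurable_prodMk_left (measurableSet_hit_prod σ d hJ)

lemma mul_mem_hit {σ : Fin n → ℝ} {d : ℕ} {J : Set ℝ} {x : Fin n → ℝ} {k g : SLR n} :
    k * g ∈ hit σ d J x ↔ g ∈ hit σ d J (act x k) := by
  simp [hit, act_mul]

/-- The measure of the set of `g` of bounded size for which `x g` and `y g` are both hits. -/
def corr (μ : Measure (SLR n)) (σ : Fin n → ℝ) (d : ℕ) (J : Set ℝ) (R : ℝ) (x y : Fin n → ℝ) :
    ENNReal := μ (slBall n R ∩ (hit σ d J x ∩ hit σ d J y))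

variable (μ : Measure (SLR n)) (σ : Fin n → ℝ) (d : ℕ) (J : Set ℝ)

lemma corr_mono {R R' : ℝ} (h : R ≤ R') (x y : Fin n → ℝ) :
    corr μ σ d J R x y ≤ corr μ σ d J R' x y :=
  measure_mono fun _ hg => ⟨le_trans hg.1 h, hg.2⟩

variable [μ.IsHaarMeasure]

lemma corr_act_le (R : ℝ) (x y : Fin n → ℝ) (k : SLR n) :
    corr μ σ d J R (act x k) (act y k) ≤ corr μ σ d J (slSize k * R) x y := by
  rw [corr, corr, ← measure_preimage_mul μ k (slBall n (slSize k * R) ∩ _)]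
  refine measure_mono ?_
  rintro g ⟨hg, hx, hy⟩
  refine ⟨?_, mul_mem_hit.2 hx, mul_mem_hit.2 hy⟩
  exact (slSize_mul_le k g).trans (mul_le_mul_of_nonneg_left hg (slSize_nonneg k))

lemma corr_le_act (R : ℝ) (x y : Fin n → ℝ) (k : SLR n) :
    corr μ σ d J R x y ≤ corr μ σ d J (slSize k⁻¹ * R) (act x k) (act y k) := by
  have := corr_act_le μ σ d J R (act x k) (act y k) k⁻¹
  rwa [act_act_inv, act_act_inv] at this

end correlation

section averaging

/-- A radius small enough for `slPert` to stay close to the identity. -/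
def pertRadius (n : ℕ) : ℝ := 1 / (4 * (n + 1) ^ 2)

lemma pertRadius_pos (n : ℕ) : 0 < pertRadius n := by unfold pertRadius; positivity

lemma pertRadius_le (n : ℕ) : pertRadius n ≤ 1 / 4 := by
  unfold pertRadius
  refine one_div_le_one_div_of_le (by norm_num) ?_
  have : (0 : ℝ) ≤ n := n.cast_nonneg
  nlinarith

lemma sq_mul_pertRadius_le (n : ℕ) : (n : ℝ) ^ 2 * (2 * pertRadius n) ≤ 1 / 2 := by
  have h0 : (0 : ℝ) ≤ n := n.cast_nonneg
  unfold pertRadius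
  rw [mul_one_div, mul_div_assoc', div_le_div_iff₀ (by positivity) (by norm_num)]
  nlinarith

lemma slPert_near_one {n : ℕ} {i j : Fin n} (hij : i ≠ j) {P : Fin n → ℝ}
    (h : ‖P - Pi.single i 1‖ ≤ pertRadius n) (hP : P i ≠ 0) :
    entrySum ((slPert i j P hij hP : Matrix (Fin n) (Fin n) ℝ) - 1) ≤ 1 / 2 :=
  (entrySum_rowPert_sub_one_le hij h ((pertRadius_le n).trans (by norm_num))).trans
    (sq_mul_pertRadius_le n)

lemma measure_le_of_forall_le_slice (n d : ℕ) (hd : 1 ≤ d) (hde : Even d) {σ : Fin (n + 1) → ℝ}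
    (hσ : IsSign σ) (μ : Measure (SLR (n + 1))) [μ.IsHaarMeasure] (R : ℝ) (hR : 0 ≤ R) :
    ∃ C : ℝ, 0 < C ∧ ∀ (J : Set ℝ), MeasurableSet J → ∀ (H : Set (SLR (n + 1))), MeasurableSet H →
    ∀ (u P₀ : Fin (n + 1) → ℝ) (c s : ℝ) (A : ENNReal), c ≠ 0 → 0 < s →
    (∀ P, ‖P - P₀‖ ≤ pertRadius (n + 1) → s ≤ ‖u + c • P‖) →
    (∀ P, ‖P - P₀‖ ≤ pertRadius (n + 1) →
      A ≤ μ (slBall (n + 1) R ∩ (H ∩ hit σ d J (u + c • P)))) →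
    A ≤ ENNReal.ofReal (C / (|c| * s ^ (d - 1))) * volume J * μ (slBall (n + 1) R ∩ H) := by
  obtain ⟨C, hC, hslice⟩ := volume_affine_slice_le n d R hR
  set ε := pertRadius (n + 1) with hε
  have hε0 : 0 < ε := pertRadius_pos _
  refine ⟨C * ε ^ n / (2 * ε) ^ (n + 1), by positivity, ?_⟩
  intro J hJ H hH u P₀ c s A hc hs hfar hA
  have hc0 : 0 < |c| := abs_pos.2 hc
  set ν := μ.restrict (slBall (n + 1) R ∩ H) with hν
  have hfin : μ (slBall (n + 1) R ∩ H) < ⊤ :=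
    (measure_mono Set.inter_subset_left).trans_lt (measure_slBall_lt_top μ R)
  have : IsFiniteMeasure ν := ⟨by rw [hν, Measure.restrict_apply_univ]; exact hfin⟩
  set E : Set ((Fin (n + 1) → ℝ) × SLR (n + 1)) :=
    {p | ‖p.1 - P₀‖ ≤ ε ∧ p.2 ∈ hit σ d J (u + c • p.1)} with hE
  have hEm : MeasurableSet E := by
    have h1 : Measurable fun p : (Fin (n + 1) → ℝ) × SLR (n + 1) => ‖p.1 - P₀‖ := by fun_prop
    refine (measurableSet_le h1 measurable_const).inter ?_
    have h2 : Measurable fun p : (Fin (n + 1) → ℝ) × SLR (n + 1) => (u + c • p.1, p.2) := by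
      fun_prop
    exact h2 (measurableSet_hit_prod σ d hJ)
  have hball : volume (Metric.closedBall P₀ ε) = ENNReal.ofReal ((2 * ε) ^ (n + 1)) := by
    rw [Real.volume_pi_closedBall _ hε0.le, Fintype.card_fin]
  have hlow : A * ENNReal.ofReal ((2 * ε) ^ (n + 1)) ≤ (volume.prod ν) E := by
    rw [Measure.prod_apply hEm, ← hball, ← setLIntegral_const]
    rw [← lintegral_indicator measurableSet_closedBall]
    refine lintegral_mono fun P => ?_
    by_cases hP : P ∈ Metric.closedBall P₀ ε
    · rw [Set.indicator_of_mem hP]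
      have hP' : ‖P - P₀‖ ≤ ε := mem_closedBall_iff_norm.1 hP
      have hsec : Prod.mk P ⁻¹' E = hit σ d J (u + c • P) := by
        ext g; simp [hE, hP']
      rw [hsec, hν, Measure.restrict_apply (measurableSet_hit σ d hJ _)]
      refine (hA P hP').trans (le_of_eq ?_)
      congr 1
      ext g
      simp only [Set.mem_inter_iff]
      tauto
    · rw [Set.indicator_of_notMem hP]
      exact zero_le
  have hup : (volume.prod ν) E
      ≤ ENNReal.ofReal (C * (ε ^ n / (|c| * s ^ (d - 1)))) * volume J
        * μ (slBall (n + 1) R ∩ H) := by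
    rw [Measure.prod_apply_symm hEm]
    calc ∫⁻ g, volume ((fun P => (P, g)) ⁻¹' E) ∂ν
        ≤ ∫⁻ _g in slBall (n + 1) R ∩ H,
            ENNReal.ofReal (C * (ε ^ n / (|c| * s ^ (d - 1)))) * volume J ∂μ := by
          refine setLIntegral_mono' ((measurableSet_slBall R).inter hH) fun g hg => ?_
          refine le_trans (measure_mono ?_)
            (hslice hσ hd hde hJ g hg.1 u P₀ c ε s hc hε0.le hs)
          rintro P ⟨h1, h2⟩
          exact ⟨h1, hfar P h1, h2⟩
      _ = _ := by rw [setLIntegral_const]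
  have hpos : 0 < (2 * ε) ^ (n + 1) := by positivity
  have hcancel : ENNReal.ofReal ((2 * ε) ^ (n + 1)) * ENNReal.ofReal ((2 * ε) ^ (n + 1))⁻¹ = 1 := by
    rw [← ENNReal.ofReal_mul hpos.le, mul_inv_cancel₀ hpos.ne', ENNReal.ofReal_one]
  calc A = A * ENNReal.ofReal ((2 * ε) ^ (n + 1)) * ENNReal.ofReal ((2 * ε) ^ (n + 1))⁻¹ := by
        rw [mul_assoc, hcancel, mul_one]
    _ ≤ ENNReal.ofReal (C * (ε ^ n / (|c| * s ^ (d - 1)))) * volume J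
        * μ (slBall (n + 1) R ∩ H) * ENNReal.ofReal ((2 * ε) ^ (n + 1))⁻¹ :=
      mul_le_mul_left (hlow.trans hup) _
    _ = ENNReal.ofReal (C * (ε ^ n / (|c| * s ^ (d - 1)))) * ENNReal.ofReal ((2 * ε) ^ (n + 1))⁻¹
        * volume J * μ (slBall (n + 1) R ∩ H) := by ring
    _ = _ := by
      rw [← ENNReal.ofReal_mul (by positivity)]
      congr 3
      field_simp

end averaging

section bounds

lemma norm_single_one {n : ℕ} (i : Fin n) : ‖(Pi.single i 1 : Fin n → ℝ)‖ = 1 := by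
  rw [Pi.norm_single, norm_one]

lemma single_bound {m d : ℕ} (hd : 1 ≤ d) (hde : Even d) {σ : Fin (m + 3) → ℝ}
    (hσ : IsSign σ) (μ : Measure (SLR (m + 3))) [μ.IsHaarMeasure] (R : ℝ) (hR : 0 ≤ R) :
    ∃ C : ℝ, 0 < C ∧ ∀ J : Set ℝ, MeasurableSet J →
    ∀ x : Fin (m + 3) → ℝ, x ≠ 0 →
    corr μ σ d J R x x ≤ ENNReal.ofReal (C / ‖x‖ ^ d) * volume J := by
  set N : ℝ := ((m + 3 : ℕ) : ℝ) ^ 2 with hN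
  set R₂ : ℝ := 2 * ((m + 3 : ℕ) : ℝ) * (N * R) with hR₂
  have hN0 : 0 < N := by positivity
  obtain ⟨C, hC, hslice⟩ := measure_le_of_forall_le_slice (m + 2) d hd hde hσ μ R₂ (by positivity)
  refine ⟨C * (2 ^ (d - 1) * N ^ d) * ((μ (slBall (m + 3) R₂)).toReal + 1), by positivity, ?_⟩
  intro J hJ x hx
  obtain ⟨O, a, -, -, hO, -, hxO, -, -⟩ := exists_rotation x x
  have hnx : ‖x‖ ≤ |a| * N := by
    calc ‖x‖ = ‖act (Pi.single 0 a) O‖ := by rw [← hxO]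
      _ ≤ ‖(Pi.single 0 a : Fin (m + 3) → ℝ)‖ * slSize O := norm_act_le _ _
      _ ≤ |a| * N := by
        rw [Pi.norm_single, Real.norm_eq_abs]
        gcongr
  have hx0 : 0 < ‖x‖ := norm_pos_iff.2 hx
  have ha0 : 0 < |a| := by
    by_contra! h
    nlinarith [abs_nonneg a]
  have hxO' : x = act (a • Pi.single 0 1) O := by
    rw [hxO, ← Pi.single_smul, smul_eq_mul, mul_one]
  have h1 : corr μ σ d J R x x
      ≤ corr μ σ d J (N * R) (a • Pi.single 0 1) (a • Pi.single 0 1) := by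
    conv_lhs => rw [hxO']
    exact (corr_act_le _ _ _ _ _ _ _ _).trans
      (corr_mono _ _ _ _ (mul_le_mul_of_nonneg_right hO hR) _ _)
  have h2 := hslice J hJ Set.univ MeasurableSet.univ 0 (Pi.single 0 1) a (|a| / 2)
    (corr μ σ d J (N * R) (a • Pi.single 0 1) (a • Pi.single 0 1)) (abs_pos.1 ha0) (by positivity)
    (by
      intro P hP
      have := ne_zero_of_norm_sub_single_le hP ((pertRadius_le _).trans (by norm_num))
      rw [zero_add, norm_smul, Real.norm_eq_abs]
      have h3 : 1 / 2 ≤ ‖P‖ := (this.trans (le_abs_self _)).trans (norm_le_pi_norm P 0)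
      nlinarith)
    (by
      intro P hP
      have h3 := ne_zero_of_norm_sub_single_le hP ((pertRadius_le _).trans (by norm_num))
      have hP0 : P 0 ≠ 0 := by intro h; rw [h] at h3; norm_num at h3
      have h4 := slSize_inv_le_of_near_one (slPert_near_one fin_zero_ne_two hP hP0)
      refine (corr_le_act μ σ d J _ _ _ (slPert 0 2 P fin_zero_ne_two hP0)).trans ?_
      rw [act_smul, act_single_slPert]
      refine (corr_mono _ _ _ _ (mul_le_mul_of_nonneg_right h4 (by positivity)) _ _).trans ?_
      rw [corr, Set.inter_self, zero_add, Set.univ_inter])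
  refine (h1.trans h2).trans ?_
  rw [Set.inter_univ]
  set M := (μ (slBall (m + 3) R₂)).toReal
  have hM : 0 ≤ M := ENNReal.toReal_nonneg
  have hμM : μ (slBall (m + 2 + 1) R₂) = ENNReal.ofReal M :=
    (ENNReal.ofReal_toReal (measure_slBall_lt_top μ R₂).ne).symm
  rw [hμM, mul_right_comm, ← ENNReal.ofReal_mul (by positivity)]
  gcongr
  have hpow : |a| * (|a| / 2) ^ (d - 1) = |a| ^ d / 2 ^ (d - 1) := by
    obtain ⟨e, rfl⟩ : ∃ e, d = e + 1 := ⟨d - 1, by omega⟩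
    rw [Nat.add_sub_cancel, div_pow, pow_succ']
    ring
  rw [hpow]
  have hxd : ‖x‖ ^ d ≤ |a| ^ d * N ^ d := by
    rw [← mul_pow]
    exact pow_le_pow_left₀ hx0.le hnx d
  rw [div_div_eq_mul_div, div_mul_eq_mul_div, div_le_div_iff₀ (by positivity) (by positivity)]
  calc C * 2 ^ (d - 1) * M * ‖x‖ ^ d ≤ C * 2 ^ (d - 1) * (M + 1) * (|a| ^ d * N ^ d) := by
        gcongr
        linarith
    _ = _ := by ring

lemma pair_bound {m d : ℕ} (hd : 1 ≤ d) (hde : Even d) {σ : Fin (m + 3) → ℝ}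
    (hσ : IsSign σ) (μ : Measure (SLR (m + 3))) [μ.IsHaarMeasure] (R : ℝ) (hR : 0 ≤ R) :
    ∃ C : ℝ, 0 < C ∧ ∀ J : Set ℝ, MeasurableSet J →
    ∀ (x y : Fin (m + 3) → ℝ) (s : ℝ) (i j : Fin (m + 3)), 0 < s → s ≤ ‖x‖ → s ≤ ‖y‖ →
    0 < absMinor x y i j →
    corr μ σ d J R x y
      ≤ ENNReal.ofReal (C / (s ^ (2 * (d - 1)) * absMinor x y i j)) * volume J ^ 2 := by
  set N : ℝ := ((m + 3 : ℕ) : ℝ) ^ 2 with hN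
  set R₂ : ℝ := 2 * ((m + 3 : ℕ) : ℝ) * (N * R) with hR₂
  have hN0 : 0 < N := by positivity
  obtain ⟨C₁, hC₁, hslice⟩ := measure_le_of_forall_le_slice (m + 2) d hd hde hσ μ R₂ (by positivity)
  obtain ⟨C₂, hC₂, hsingle⟩ := single_bound hd hde hσ μ R₂ (by positivity)
  refine ⟨C₁ * C₂ * 2 * (4 * N ^ 2) ^ (d - 1) * 1, by positivity, ?_⟩
  intro J hJ x y s i j hs hsx hsy hq
  obtain ⟨O, a, b, c, hO, -, hxO, hyO, hminor⟩ := exists_rotation x y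
  have hac : absMinor x y i j ≤ 2 * (|a| * |c|) := hminor i j
  have hxO' : x = act (a • Pi.single 0 1) O := by
    rw [hxO, ← Pi.single_smul, smul_eq_mul, mul_one]
  have hac0 : 0 < |a| * |c| := by linarith
  have ha0 : 0 < |a| := pos_of_mul_pos_left hac0 (abs_nonneg _)
  have hc0 : 0 < |c| := pos_of_mul_pos_right hac0 (abs_nonneg _)
  have hnx : s ≤ |a| * N := by
    calc s ≤ ‖act (a • Pi.single 0 1) O‖ := by rw [← hxO']; exact hsx
      _ ≤ ‖a • (Pi.single 0 1 : Fin (m + 3) → ℝ)‖ * slSize O := norm_act_le _ _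
      _ ≤ |a| * N := by
        rw [norm_smul, norm_single_one, Real.norm_eq_abs, mul_one]
        gcongr
  have hny : s ≤ 2 * max |b| |c| * N := by
    calc s ≤ ‖act (b • Pi.single 0 1 + c • Pi.single 1 1) O‖ := by rw [← hyO]; exact hsy
      _ ≤ ‖b • (Pi.single 0 1 : Fin (m + 3) → ℝ) + c • Pi.single 1 1‖ * slSize O := norm_act_le _ _
      _ ≤ 2 * max |b| |c| * N := by
        have : ‖b • (Pi.single 0 1 : Fin (m + 3) → ℝ) + c • Pi.single 1 1‖ ≤ 2 * max |b| |c| := by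
          refine (norm_add_le _ _).trans ?_
          rw [norm_smul, norm_single_one, norm_smul, norm_single_one, Real.norm_eq_abs,
            Real.norm_eq_abs]
          linarith [le_max_left |b| |c|, le_max_right |b| |c|]
        have := slSize_nonneg O
        gcongr
  set M := max |b| |c| with hM
  have hM0 : 0 < M := hc0.trans_le (le_max_right _ _)
  have h1 : corr μ σ d J R x y
      ≤ corr μ σ d J (N * R) (a • Pi.single 0 1) (b • Pi.single 0 1 + c • Pi.single 1 1) := by
    conv_lhs => rw [hxO', hyO]
    exact (corr_act_le _ _ _ _ _ _ _ _).trans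
      (corr_mono _ _ _ _ (mul_le_mul_of_nonneg_right hO hR) _ _)
  have hne01 : (0 : Fin (m + 3)) ≠ 1 := by simp
  have h2 := hslice J hJ (hit σ d J (a • Pi.single 0 1)) (measurableSet_hit σ d hJ _)
    (b • Pi.single 0 1) (Pi.single 1 1) c (M / 2)
    (corr μ σ d J (N * R) (a • Pi.single 0 1) (b • Pi.single 0 1 + c • Pi.single 1 1))
    (abs_pos.1 hc0) (by positivity)
    (by
      intro P hP
      have h3 := ne_zero_of_norm_sub_single_le hP ((pertRadius_le _).trans (by norm_num))
      by_cases hbc : |b| ≤ |c|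
      · have hMc : M = |c| := max_eq_right hbc
        have h4 := norm_le_pi_norm (b • Pi.single (0 : Fin (m + 3)) (1 : ℝ) + c • P) 1
        refine le_trans ?_ h4
        rw [Pi.add_apply, Pi.smul_apply, Pi.smul_apply, Pi.single_eq_of_ne hne01.symm, hMc,
          smul_zero, zero_add, norm_smul, Real.norm_eq_abs, Real.norm_eq_abs]
        nlinarith [le_abs_self (P 1)]
      · have hMb : M = |b| := max_eq_left (le_of_not_ge hbc)
        have h4 := norm_le_pi_norm (b • Pi.single (0 : Fin (m + 3)) (1 : ℝ) + c • P) 0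
        refine le_trans ?_ h4
        have h5 := (norm_le_pi_norm (P - Pi.single 1 1) 0).trans (hP.trans (pertRadius_le _))
        rw [Pi.sub_apply, Pi.single_eq_of_ne hne01, sub_zero, Real.norm_eq_abs] at h5
        rw [Pi.add_apply, Pi.smul_apply, Pi.smul_apply, Pi.single_eq_same, hMb, smul_eq_mul,
          smul_eq_mul, mul_one, Real.norm_eq_abs]
        have h6 : |c * P 0| ≤ |b| * (1 / 4) := by
          rw [abs_mul]
          exact mul_le_mul (le_of_not_ge hbc) h5 (abs_nonneg _) (abs_nonneg _)
        have h7 := abs_sub_abs_le_abs_sub b (-(c * P 0))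
        rw [abs_neg, sub_neg_eq_add] at h7
        linarith [abs_nonneg b])
    (by
      intro P hP
      have h3 := ne_zero_of_norm_sub_single_le hP ((pertRadius_le _).trans (by norm_num))
      have hP0 : P 1 ≠ 0 := by intro h; rw [h] at h3; norm_num at h3
      have h4 := slSize_inv_le_of_near_one (slPert_near_one fin_one_ne_two hP hP0)
      refine (corr_le_act μ σ d J _ _ _ (slPert 1 2 P fin_one_ne_two hP0)).trans ?_
      rw [act_add, act_smul, act_smul, act_smul, act_single_slPert,
        act_single_slPert_of_ne _ _ hne01 fin_zero_ne_two]
      exact corr_mono _ _ _ _ (mul_le_mul_of_nonneg_right h4 (by positivity)) _ _)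
  have ha : a • (Pi.single 0 1 : Fin (m + 3) → ℝ) ≠ 0 := by
    rw [← norm_pos_iff, norm_smul, norm_single_one, Real.norm_eq_abs, mul_one]
    exact ha0
  have h3 := hsingle J hJ (a • Pi.single 0 1) ha
  rw [corr, Set.inter_self, norm_smul, norm_single_one, Real.norm_eq_abs, mul_one] at h3
  refine (h1.trans h2).trans ((mul_le_mul_right h3 _).trans ?_)
  rw [show ∀ u v w : ENNReal, u * v * (w * v) = u * w * v ^ 2 by intro u v w; ring,
    ← ENNReal.ofReal_mul (by positivity)]
  gcongr
  obtain ⟨e, rfl⟩ : ∃ e, d = e + 1 := ⟨d - 1, by omega⟩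
  simp only [Nat.add_sub_cancel] at *
  rw [div_mul_div_comm, mul_one, div_le_div_iff₀ (by positivity) (by positivity)]
  have h5 : s ^ (2 * e) ≤ (M / 2) ^ e * |a| ^ e * (4 * N ^ 2) ^ e := by
    rw [pow_mul, ← mul_pow, ← mul_pow]
    refine pow_le_pow_left₀ (by positivity) ?_ e
    nlinarith [mul_le_mul hnx hny hs.le (by positivity)]
  calc C₁ * C₂ * (s ^ (2 * e) * absMinor x y i j)
      ≤ C₁ * C₂ * ((M / 2) ^ e * |a| ^ e * (4 * N ^ 2) ^ e * (2 * (|a| * |c|))) := by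
        gcongr
    _ = _ := by ring

end bounds

section weight

variable {n : ℕ}

/-- A compactly supported Lipschitz weight on `SL_n(ℝ)`. -/
def weight (R : ℝ) (g : SLR n) : ℝ := max 0 (R - slSize g)

lemma weight_nonneg (R : ℝ) (g : SLR n) : 0 ≤ weight R g := le_max_left _ _

lemma weight_le {R : ℝ} (hR : 0 ≤ R) (g : SLR n) : weight R g ≤ R :=
  max_le hR (by linarith [slSize_nonneg g])

lemma weight_eq_zero {R : ℝ} {g : SLR n} (h : R ≤ slSize g) : weight R g = 0 :=
  max_eq_left (by linarith)

lemma measurable_weight (R : ℝ) : Measurable (weight R : SLR n → ℝ) :=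
  measurable_const.max (measurable_const.sub measurable_slSize)

/-- The indicator function of `hit`. -/
def hitVal (σ : Fin n → ℝ) (d : ℕ) (J : Set ℝ) (x : Fin n → ℝ) (g : SLR n) : ℝ :=
  (hit σ d J x).indicator (fun _ => 1) g

variable {σ : Fin n → ℝ} {d : ℕ} {J : Set ℝ}

lemma hitVal_nonneg (x : Fin n → ℝ) (g : SLR n) : 0 ≤ hitVal σ d J x g :=
  Set.indicator_nonneg (fun _ _ => zero_le_one) _

lemma hitVal_le_one (x : Fin n → ℝ) (g : SLR n) : hitVal σ d J x g ≤ 1 :=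
  Set.indicator_le_self' (fun _ _ => zero_le_one) _

lemma hitVal_act (x : Fin n → ℝ) (k g : SLR n) :
    hitVal σ d J (act x k) g = hitVal σ d J x (k * g) := by
  unfold hitVal
  by_cases h : g ∈ hit σ d J (act x k)
  · rw [Set.indicator_of_mem h, Set.indicator_of_mem (mul_mem_hit.2 h)]
  · rw [Set.indicator_of_notMem h, Set.indicator_of_notMem (fun h' => h (mul_mem_hit.1 h'))]

lemma measurable_hitVal (hJ : MeasurableSet J) :
    Measurable (fun p : (Fin n → ℝ) × SLR n => hitVal σ d J p.1 p.2) := by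
  have : (fun p : (Fin n → ℝ) × SLR n => hitVal σ d J p.1 p.2)
      = {p : (Fin n → ℝ) × SLR n | p.2 ∈ hit σ d J p.1}.indicator (fun _ => 1) := by
    ext p
    rfl
  rw [this]
  exact measurable_const.indicator (measurableSet_hit_prod σ d hJ)

lemma measurable_hitVal_right (hJ : MeasurableSet J) (x : Fin n → ℝ) :
    Measurable (hitVal σ d J x) :=
  measurable_const.indicator (measurableSet_hit σ d hJ x)

variable (μ : Measure (SLR n)) [μ.IsHaarMeasure]

lemma integrable_weight_mul {R : ℝ} (hR : 0 ≤ R) {Φ : SLR n → ℝ} (hΦ : Measurable Φ) {K : ℝ}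
    (hK : ∀ g, |Φ g| ≤ K) : Integrable (fun g => weight R g * Φ g) μ := by
  refine Integrable.mono' (g := (slBall n R).indicator fun _ => R * K) ?_
    ((measurable_weight R).mul hΦ).aestronglyMeasurable ?_
  · exact (integrable_indicator_iff (measurableSet_slBall R)).2
      (integrableOn_const (measure_slBall_lt_top μ R).ne)
  · refine Filter.Eventually.of_forall fun g => ?_
    rw [Real.norm_eq_abs, abs_mul, abs_of_nonneg (weight_nonneg R g)]
    by_cases hg : g ∈ slBall n R
    · rw [Set.indicator_of_mem hg]
      exact mul_le_mul (weight_le hR g) (hK g) (abs_nonneg _) hR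
    · rw [Set.indicator_of_notMem hg, weight_eq_zero (le_of_lt (not_le.1 hg)), zero_mul]

/-- The weighted correlation of the hits at `x` and `y`. -/
def wcorr (σ : Fin n → ℝ) (d : ℕ) (J : Set ℝ) (R : ℝ) (x y : Fin n → ℝ) : ℝ :=
  ∫ g, weight R g * (hitVal σ d J x g * hitVal σ d J y g) ∂μ

lemma abs_hitVal_mul_le (x y : Fin n → ℝ) (g : SLR n) :
    |hitVal σ d J x g * hitVal σ d J y g| ≤ 1 := by
  rw [abs_of_nonneg (mul_nonneg (hitVal_nonneg _ _) (hitVal_nonneg _ _))]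
  exact mul_le_one₀ (hitVal_le_one _ _) (hitVal_nonneg _ _) (hitVal_le_one _ _)

lemma corr_ne_top (R : ℝ) (x y : Fin n → ℝ) : corr μ σ d J R x y ≠ ⊤ :=
  ((measure_mono Set.inter_subset_left).trans_lt (measure_slBall_lt_top μ R)).ne

lemma integral_hit_le {R : ℝ} (hJ : MeasurableSet J) (x y : Fin n → ℝ)
    {Φ : SLR n → ℝ} {K : ℝ} (hK : 0 ≤ K) (hΦ : ∀ g, |Φ g| ≤ K)
      (hsupp : ∀ g, R < slSize g → Φ g = 0) :
    |∫ g, Φ g * (hitVal σ d J x g * hitVal σ d J y g) ∂μ| ≤ K * (corr μ σ d J R x y).toReal := by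
  set B := slBall n R ∩ (hit σ d J x ∩ hit σ d J y) with hB
  have hBm : MeasurableSet B := (measurableSet_slBall R).inter
    ((measurableSet_hit σ d hJ x).inter (measurableSet_hit σ d hJ y))
  have hint : Integrable (B.indicator fun _ => K) μ :=
    (integrable_indicator_iff hBm).2 (integrableOn_const (corr_ne_top μ R x y))
  have := norm_integral_le_of_norm_le hint (f := fun g => Φ g *
    (hitVal σ d J x g * hitVal σ d J y g)) (Filter.Eventually.of_forall fun g => ?_)
  · rw [integral_indicator_const _ hBm, smul_eq_mul, mul_comm] at this
    exact this
  · by_cases hg : g ∈ B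
    · rw [Set.indicator_of_mem hg, Real.norm_eq_abs, abs_mul]
      calc |Φ g| * _ ≤ K * 1 := mul_le_mul (hΦ g) (abs_hitVal_mul_le x y g) (abs_nonneg _) hK
        _ = K := mul_one K
    · rw [Set.indicator_of_notMem hg]
      have : Φ g * (hitVal σ d J x g * hitVal σ d J y g) = 0 := by
        by_cases h1 : R < slSize g
        · rw [hsupp g h1, zero_mul]
        by_cases h2 : g ∈ hit σ d J x
        · have h3 : g ∉ hit σ d J y := fun h3 => hg ⟨not_lt.1 h1, h2, h3⟩
          simp [hitVal, h3]
        · simp [hitVal, h2]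
      rw [this, norm_zero]

lemma wcorr_le {R : ℝ} (hR : 0 ≤ R) (hJ : MeasurableSet J) (x y : Fin n → ℝ) :
    |wcorr μ σ d J R x y| ≤ R * (corr μ σ d J R x y).toReal :=
  integral_hit_le μ hJ x y hR (fun g => by rw [abs_of_nonneg (weight_nonneg R g)]
                                           exact weight_le hR g)
    fun _ hg => weight_eq_zero hg.le

lemma abs_wcorr_sub_act_le {R θ : ℝ} (hR : 0 ≤ R) (hJ : MeasurableSet J) (x y : Fin n → ℝ)
    (k : SLR n) (hk : entrySum ((k : Matrix (Fin n) (Fin n) ℝ) - 1) ≤ θ) (hθ : θ ≤ 1 / 2) :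
    |wcorr μ σ d J R x y - wcorr μ σ d J R (act x k) (act y k)|
      ≤ 2 * R * θ * (corr μ σ d J (2 * R) (act x k) (act y k)).toReal := by
  have hθ0 : 0 ≤ θ := (entrySum_nonneg _).trans hk
  have hmeas : Measurable fun g => hitVal σ d J x g * hitVal σ d J y g :=
    (measurable_hitVal_right hJ x).mul (measurable_hitVal_right hJ y)
  have hint := integrable_weight_mul μ hR hmeas (abs_hitVal_mul_le x y)
  have hmeas' : Measurable fun g => hitVal σ d J (act x k) g * hitVal σ d J (act y k) g :=
    (measurable_hitVal_right hJ _).mul (measurable_hitVal_right hJ _)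
  have hint' := integrable_weight_mul μ hR hmeas' (abs_hitVal_mul_le _ _)
  have hintk := hint.comp_mul_left k
  have h1 : wcorr μ σ d J R x y
      = ∫ g, weight R (k * g) * (hitVal σ d J (act x k) g * hitVal σ d J (act y k) g) ∂μ := by
    rw [wcorr, ← integral_mul_left_eq_self _ k]
    simp only [hitVal_act]
  have h2 : Integrable (fun g => weight R (k * g) *
      (hitVal σ d J (act x k) g * hitVal σ d J (act y k) g)) μ := by
    simpa only [hitVal_act] using hintk
  rw [h1, wcorr, ← integral_sub h2 hint']
  simp only [← sub_mul]
  have hsize : ∀ g : SLR n, |slSize (k * g) - slSize g| ≤ θ * slSize g := by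
    intro g
    refine (abs_entrySum_sub_le _ _).trans ?_
    have : ((k * g : SLR n) : Matrix (Fin n) (Fin n) ℝ) - g
        = ((k : Matrix (Fin n) (Fin n) ℝ) - 1) * g := by
      rw [Matrix.SpecialLinearGroup.coe_mul, sub_mul, one_mul]
    rw [this]
    exact (entrySum_mul_le _ _).trans (mul_le_mul_of_nonneg_right hk (entrySum_nonneg _))
  have hzero : ∀ g : SLR n, 2 * R < slSize g → weight R (k * g) - weight R g = 0 := by
    intro g hg
    have h3 := (abs_le.1 (hsize g)).1
    have h4 : θ * slSize g ≤ 1 / 2 * slSize g :=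
      mul_le_mul_of_nonneg_right hθ (slSize_nonneg g)
    rw [weight_eq_zero (by linarith), weight_eq_zero (by linarith), sub_zero]
  refine integral_hit_le μ hJ _ _ (by positivity) (fun g => ?_) hzero
  by_cases hg : 2 * R < slSize g
  · rw [hzero g hg, abs_zero]
    positivity
  · have h5 : |weight R (k * g) - weight R g| ≤ |slSize (k * g) - slSize g| := by
      have h6 := abs_max_sub_max_le_max 0 (R - slSize (k * g)) 0 (R - slSize g)
      rwa [sub_zero, abs_zero, sub_sub_sub_cancel_left _ _ R,
        max_eq_right (abs_nonneg (slSize g - slSize (k * g))),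
        abs_sub_comm (slSize g)] at h6
    refine h5.trans ((hsize g).trans ?_)
    rw [mul_comm]
    exact mul_le_mul_of_nonneg_right (not_lt.1 hg) hθ0

lemma abs_wcorr_sub_le {m d : ℕ} {σ : Fin (m + 3) → ℝ} (μ : Measure (SLR (m + 3)))
    [μ.IsHaarMeasure] {R : ℝ} (hR : 0 ≤ R) : ∃ C : ℝ, 0 < C ∧ ∀ J : Set ℝ, MeasurableSet J →
    ∀ (x y y' : Fin (m + 3) → ℝ) (Q T : ℝ) (i j : Fin (m + 3)), 0 < Q → Q ≤ absMinor x y i j →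
    ‖x‖ ≤ T → ‖y' - y‖ ≤ 1 → C * T ≤ Q →
    |wcorr μ σ d J R x y - wcorr μ σ d J R x y'|
      ≤ C * (T / Q) * (corr μ σ d J (2 * R) x y').toReal := by
  set N : ℝ := ((m + 3 : ℕ) : ℝ) ^ 2 with hN
  have hN0 : 0 < N := by positivity
  have hρ := pertRadius_pos (m + 3)
  refine ⟨2 * N ^ 2 / pertRadius (m + 3) + 8 * N ^ 5 + 8 * R * N ^ 5, by positivity, ?_⟩
  intro J hJ x y y' Q T i j hQ hQm hxT hyy hCT
  obtain ⟨O, a, b, c, hO, hO', hxO, hyO, hminor⟩ := exists_rotation x y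
  have hT0 : 0 ≤ T := (norm_nonneg _).trans hxT
  have ha : |a| ≤ T * N := by
    have h1 : act x O⁻¹ = Pi.single 0 a := by rw [hxO, act_act_inv]
    have h2 := norm_act_le x O⁻¹
    rw [h1, Pi.norm_single, Real.norm_eq_abs] at h2
    exact h2.trans (mul_le_mul hxT hO' (slSize_nonneg _) hT0)
  have hQc : Q ≤ 2 * (T * N * |c|) :=
    hQm.trans ((hminor i j).trans (by gcongr))
  have hc : 0 < |c| := by
    by_contra h
    have : |c| = 0 := le_antisymm (not_lt.1 h) (abs_nonneg c)
    rw [this] at hQc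
    linarith
  have hT : 0 < T := by
    rcases hT0.lt_or_eq with h | h
    · exact h
    · rw [← h] at hQc
      linarith
  have hc0 : c ≠ 0 := abs_pos.1 hc
  have hcinv : |c|⁻¹ ≤ 2 * N * T / Q := by
    rw [inv_le_iff_one_le_mul₀ hc, div_mul_eq_mul_div, le_div_iff₀ hQ]
    linarith
  set η : Fin (m + 3) → ℝ := c⁻¹ • act (y' - y) O⁻¹ with hη
  set ε : ℝ := 2 * N ^ 2 * (T / Q) with hε
  have hηε : ‖η‖ ≤ ε := by
    rw [hη, norm_smul, norm_inv, Real.norm_eq_abs]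
    calc |c|⁻¹ * ‖act (y' - y) O⁻¹‖ ≤ (2 * N * T / Q) * (1 * N) := by
          refine mul_le_mul hcinv ((norm_act_le _ _).trans ?_) (norm_nonneg _) (by positivity)
          exact mul_le_mul hyy hO' (slSize_nonneg _) zero_le_one
      _ = ε := by rw [hε]; ring
  have hTQ : 0 ≤ T / Q := by positivity
  have hCT' : (2 * N ^ 2 / pertRadius (m + 3) + 8 * N ^ 5 + 8 * R * N ^ 5) * (T / Q) ≤ 1 := by
    rw [mul_div_assoc', div_le_one hQ]; exact hCT
  have hε1 : ε ≤ pertRadius (m + 3) := by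
    have h1 : 2 * N ^ 2 / pertRadius (m + 3) * (T / Q) ≤ 1 := by
      refine le_trans (mul_le_mul_of_nonneg_right ?_ hTQ) hCT'
      have h2 : 0 ≤ 8 * N ^ 5 := by positivity
      have h3 : 0 ≤ 8 * R * N ^ 5 := by positivity
      linarith
    rw [div_mul_eq_mul_div, div_le_one hρ] at h1
    exact h1
  have hεh : ε ≤ 1 / 2 := hε1.trans ((pertRadius_le _).trans (by norm_num))
  set P : Fin (m + 3) → ℝ := Pi.single 1 1 + η with hP
  have hPε : ‖P - Pi.single 1 1‖ ≤ ε := by rw [hP, add_sub_cancel_left]; exact hηε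
  have hP1 : P 1 ≠ 0 := by
    have := ne_zero_of_norm_sub_single_le hPε hεh
    intro h
    rw [h] at this
    norm_num at this
  have h12 : (1 : Fin (m + 3)) ≠ 2 := fin_one_ne_two
  have h01 : (0 : Fin (m + 3)) ≠ 1 := by simp
  have h02 : (0 : Fin (m + 3)) ≠ 2 := fin_zero_ne_two
  set k : SLR (m + 3) := slPert 1 2 P h12 hP1 with hk
  set k' : SLR (m + 3) := O⁻¹ * k * O with hk'
  have hs0 : act (Pi.single 0 1) k = Pi.single 0 1 := act_single_slPert_of_ne h12 hP1 h01 h02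
  have hs0a : act (Pi.single 0 a) k = Pi.single 0 a := by
    have : (Pi.single 0 a : Fin (m + 3) → ℝ) = a • Pi.single 0 1 := by
      rw [← Pi.single_smul, smul_eq_mul, mul_one]
    rw [this, act_smul, hs0]
  have hx' : act x k' = x := by
    rw [hk', act_mul, act_mul]
    conv_lhs => rw [hxO]
    rw [act_act_inv, hs0a, ← hxO]
  have hy' : act y k' = y' := by
    have h1 : act y O⁻¹ = b • Pi.single 0 1 + c • Pi.single 1 1 := by rw [hyO, act_act_inv]
    rw [hk', act_mul, act_mul, h1, act_add, act_smul, act_smul, hs0, hk, act_single_slPert, hP,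
      smul_add, ← add_assoc, act_add, ← hyO, hη, smul_smul, mul_inv_cancel₀ hc0, one_smul]
    have h2 : act (act (y' - y) O⁻¹) O = y' - y := by
      rw [← act_mul, inv_mul_cancel, act_one]
    rw [h2]
    abel
  have hθ : entrySum ((k' : Matrix (Fin (m + 3)) (Fin (m + 3)) ℝ) - 1) ≤ 4 * N ^ 5 * (T / Q) := by
    have h1 : ((k' : Matrix (Fin (m + 3)) (Fin (m + 3)) ℝ) - 1)
        = (O⁻¹ : SLR (m + 3)) * ((k : Matrix (Fin (m + 3)) (Fin (m + 3)) ℝ) - 1) * O := by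
      rw [hk', mul_sub, sub_mul, mul_one, Matrix.SpecialLinearGroup.coe_mul,
        Matrix.SpecialLinearGroup.coe_mul, ← Matrix.SpecialLinearGroup.coe_mul O⁻¹ O,
        inv_mul_cancel, Matrix.SpecialLinearGroup.coe_one]
    rw [h1]
    have h2 : entrySum ((k : Matrix (Fin (m + 3)) (Fin (m + 3)) ℝ) - 1) ≤ N * (2 * ε) :=
      entrySum_rowPert_sub_one_le h12 hPε hεh
    calc _ ≤ slSize O⁻¹ * entrySum ((k : Matrix (Fin (m + 3)) (Fin (m + 3)) ℝ) - 1) * slSize O :=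
          (entrySum_mul_le _ _).trans
            (mul_le_mul_of_nonneg_right (entrySum_mul_le _ _) (entrySum_nonneg _))
      _ ≤ N * (N * (2 * ε)) * N := by
          refine mul_le_mul (mul_le_mul hO' h2 (entrySum_nonneg _) hN0.le) hO (slSize_nonneg _) ?_
          positivity
      _ = 4 * N ^ 5 * (T / Q) := by rw [hε]; ring
  have hθh : 4 * N ^ 5 * (T / Q) ≤ 1 / 2 := by
    have h2 : 0 ≤ 2 * N ^ 2 / pertRadius (m + 3) * (T / Q) := by positivity
    have h3 : 0 ≤ 8 * R * N ^ 5 * (T / Q) := by positivity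
    rw [add_mul, add_mul] at hCT'
    linarith
  have hfin := abs_wcorr_sub_act_le (σ := σ) (d := d) μ hR hJ x y k' hθ hθh
  rw [hx', hy'] at hfin
  refine hfin.trans (mul_le_mul_of_nonneg_right ?_ ENNReal.toReal_nonneg)
  have h2 : 0 ≤ 2 * N ^ 2 / pertRadius (m + 3) * (T / Q) := by positivity
  have h3 : 0 ≤ 8 * N ^ 5 * (T / Q) := by positivity
  rw [add_mul, add_mul]
  linarith

end weight

section latticeSums

open Finset

lemma sum_comp_le_sum_mul {ι κ : Type*} [DecidableEq κ] {s : Finset ι} {t : Finset κ} {g : ι → κ}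
    (hg : ∀ i ∈ s, g i ∈ t) {c φ : κ → ℝ} (hφ : ∀ r ∈ t, 0 ≤ φ r)
    (hc : ∀ r ∈ t, ((s.filter fun i => g i = r).card : ℝ) ≤ c r) :
    ∑ i ∈ s, φ (g i) ≤ ∑ r ∈ t, c r * φ r := by
  rw [← sum_fiberwise_of_maps_to hg]
  refine sum_le_sum fun r hr => ?_
  have : ∑ i ∈ s with g i = r, φ (g i) = ∑ i ∈ s with g i = r, φ r :=
    sum_congr rfl fun i hi => by rw [(mem_filter.1 hi).2]
  rw [this, sum_const, nsmul_eq_mul]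
  exact mul_le_mul_of_nonneg_right (hc r hr) (hφ r hr)

lemma card_natAbs_eq_le (s : Finset ℤ) (r : ℕ) : (s.filter fun k => k.natAbs = r).card ≤ 2 := by
  have : (s.filter fun k => k.natAbs = r) ⊆ {(r : ℤ), -(r : ℤ)} := by
    intro k hk
    have := (mem_filter.1 hk).2
    simp only [mem_insert, mem_singleton]
    omega
  exact (card_le_card this).trans card_le_two

lemma sum_natAbs_le (N : ℕ) {φ : ℕ → ℝ} (hφ : ∀ r ∈ Icc 1 N, 0 ≤ φ r) :
    ∑ k ∈ (Icc (-(N : ℤ)) N).filter (· ≠ 0), φ k.natAbs ≤ ∑ r ∈ Icc 1 N, 2 * φ r := by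
  refine sum_comp_le_sum_mul (g := Int.natAbs) (c := fun _ => 2) (fun k hk => ?_) hφ
    fun r _ => by exact_mod_cast card_natAbs_eq_le _ r
  simp only [mem_filter, mem_Icc] at hk ⊢
  omega

/-- The harmonic sum. -/
def harm (N : ℕ) : ℝ := ∑ k ∈ Icc 1 N, 1 / (k : ℝ)

lemma harm_nonneg (N : ℕ) : 0 ≤ harm N := sum_nonneg fun _ _ => by positivity

lemma harm_le (N : ℕ) : harm N ≤ 1 + Real.log N := by
  refine le_trans (le_of_eq ?_) (harmonic_le_one_add_log N)
  rw [harm, harmonic_eq_sum_Icc]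
  push_cast
  simp

/-- The pairs of integers of absolute value at most `B`. -/
def sqBox (B : ℕ) : Finset (ℤ × ℤ) := Icc (-(B : ℤ)) B ×ˢ Icc (-(B : ℤ)) B

lemma mem_sqBox {B : ℕ} {x : ℤ × ℤ} :
    x ∈ sqBox B ↔ (-(B : ℤ) ≤ x.1 ∧ x.1 ≤ B) ∧ (-(B : ℤ) ≤ x.2 ∧ x.2 ≤ B) := by
  simp [sqBox]

/-- The determinant of two integer vectors in the plane. -/
def detZ (u x : ℤ × ℤ) : ℤ := u.1 * x.2 - x.1 * u.2

/-- The sup norm of an integer vector in the plane. -/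
def supZ (u : ℤ × ℤ) : ℕ := max u.1.natAbs u.2.natAbs

lemma detZ_swap (u x : ℤ × ℤ) : detZ u.swap x.swap = -detZ u x := by
  simp [detZ]; ring

lemma swap_mem_sqBox {B : ℕ} {x : ℤ × ℤ} : x.swap ∈ sqBox B ↔ x ∈ sqBox B := by
  simp [mem_sqBox, and_comm]

lemma card_swap_filter (B : ℕ) (P : ℤ × ℤ → Prop) [DecidablePred P] :
    ((sqBox B).filter P).card = ((sqBox B).filter fun x => P x.swap).card := by
  refine card_bij' (fun x _ => x.swap) (fun x _ => x.swap) ?_ ?_ ?_ ?_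
  · intro x hx
    simp only [mem_filter, swap_mem_sqBox, Prod.swap_swap] at hx ⊢
    exact hx
  · intro x hx
    simp only [mem_filter, swap_mem_sqBox] at hx ⊢
    exact hx
  · simp
  · simp

lemma card_modEq_le {a b : ℤ} (hab : a ≤ b) {r : ℕ} (hr : 0 < r) (v : ℤ) :
    (((Ioc a b).filter fun p => p ≡ v [ZMOD r]).card : ℝ) ≤ ((b : ℝ) - a) / r + 1 := by
  have hr' : (0 : ℤ) < r := by exact_mod_cast hr
  have h1 : ((((Ioc a b).filter fun p => p ≡ v [ZMOD r]).card : ℤ) : ℚ)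
      ≤ ((b : ℚ) - a) / r + 1 := by
    rw [Int.Ioc_filter_modEq_card a b hr', Int.cast_max]
    have hab' : (a : ℚ) ≤ b := by exact_mod_cast hab
    refine max_le ?_ (by
      have : 0 ≤ ((b : ℚ) - a) / r := div_nonneg (by linarith) (by positivity)
      push_cast; linarith)
    push_cast
    have h2 := Int.floor_le (((b : ℚ) - v) / r)
    have h3 := Int.lt_floor_add_one (((a : ℚ) - v) / r)
    have h4 : ((b : ℚ) - a) / r = ((b : ℚ) - v) / r - ((a : ℚ) - v) / r := by
      rw [← sub_div]; congr 1; ring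
    linarith
  have h5 : (((((Ioc a b).filter fun p => p ≡ v [ZMOD r]).card : ℤ) : ℚ) : ℝ)
      ≤ ((((b : ℚ) - a) / r + 1 : ℚ) : ℝ) := by exact_mod_cast h1
  push_cast at h5
  exact h5

lemma card_detZ_eq_aux (u : ℤ × ℤ) (k : ℤ) (B : ℕ) (hu : IsCoprime u.1 u.2) (h0 : u.1 ≠ 0)
    (hB : u.1.natAbs ≤ B) :
    (((sqBox B).filter fun x => detZ u x = k).card : ℝ) * u.1.natAbs ≤ 4 * B := by
  rcases ((sqBox B).filter fun x => detZ u x = k).eq_empty_or_nonempty with h | ⟨x₀, hx₀⟩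
  · rw [h]; simp
  have hr : (0 : ℤ) < u.1.natAbs := by omega
  have hle : ((sqBox B).filter fun x => detZ u x = k).card
      ≤ ((Ioc (-(B : ℤ) - 1) B).filter fun p => p ≡ x₀.1 [ZMOD (u.1.natAbs : ℤ)]).card := by
    refine card_le_card_of_injOn Prod.fst ?_ ?_
    · intro x hx
      have hx := mem_filter.1 hx
      have h1 := mem_sqBox.1 hx.1
      have h2 := (mem_filter.1 hx₀).2
      refine mem_filter.2 ⟨mem_Ioc.2 ⟨by omega, h1.1.2⟩, ?_⟩
      have h3 : u.1 * (x₀.2 - x.2) = u.2 * (x₀.1 - x.1) := by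
        have h4 := hx.2
        simp only [detZ] at h4 h2
        linarith
      have h5 : u.1 ∣ x₀.1 - x.1 := hu.dvd_of_dvd_mul_left ⟨_, h3.symm⟩
      exact Int.modEq_iff_dvd.2 (Int.natAbs_dvd.2 h5)
    · intro x hx y hy hxy
      have hx := (mem_filter.1 hx).2
      have hy := (mem_filter.1 hy).2
      simp only [detZ] at hx hy
      refine Prod.ext hxy (mul_left_cancel₀ h0 ?_)
      rw [hxy] at hx
      linarith
  set r : ℝ := (u.1.natAbs : ℝ) with hrdef
  have hrpos : 0 < r := by rw [hrdef]; exact_mod_cast hr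
  have hrB : r ≤ B := by rw [hrdef]; exact_mod_cast hB
  have hbound := card_modEq_le (a := -(B : ℤ) - 1) (b := B) (by omega)
    (show 0 < u.1.natAbs by omega) x₀.1
  have hba : (((B : ℤ) : ℝ) - ((-(B : ℤ) - 1 : ℤ) : ℝ)) = 2 * B + 1 := by push_cast; ring
  rw [hba, ← hrdef] at hbound
  have hB1 : (1 : ℝ) ≤ B := by
    have : 1 ≤ u.1.natAbs := by omega
    exact_mod_cast this.trans hB
  calc _ ≤ ((2 * B + 1) / r + 1) * r :=
        mul_le_mul_of_nonneg_right (le_trans (by exact_mod_cast hle) hbound) hrpos.le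
    _ = 2 * B + 1 + r := by field_simp
    _ ≤ 4 * B := by linarith

lemma card_detZ_eq (u : ℤ × ℤ) (k : ℤ) (B : ℕ) (hu : IsCoprime u.1 u.2) (hB : supZ u ≤ B) :
    (((sqBox B).filter fun x => detZ u x = k).card : ℝ) * supZ u ≤ 4 * B := by
  have hne : u.1 ≠ 0 ∨ u.2 ≠ 0 := by
    by_contra! h
    rw [h.1, h.2] at hu
    exact not_isCoprime_zero_zero hu
  rcases le_total u.2.natAbs u.1.natAbs with h | h
  · have hs : supZ u = u.1.natAbs := max_eq_left h
    rw [hs] at hB ⊢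
    exact card_detZ_eq_aux u k B hu (by omega) hB
  · have hs : supZ u = u.2.natAbs := max_eq_right h
    rw [hs] at hB ⊢
    have h1 := card_detZ_eq_aux u.swap (-k) B hu.symm (by simp; omega) hB
    rw [card_swap_filter]
    have h2 : ∀ x, detZ u x.swap = k ↔ detZ u.swap x = -k := by
      intro x
      have := detZ_swap u x.swap
      rw [Prod.swap_swap] at this
      rw [this]
      omega
    simp only [h2]
    exact h1

lemma sum_inv_detZ_le {u : ℤ × ℤ} (hu0 : u ≠ 0) {B : ℕ} (hB : supZ u ≤ B) (Q : ℕ) :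
    ∑ x ∈ (sqBox B).filter (fun x => detZ u x ≠ 0 ∧ (detZ u x).natAbs ≤ Q),
      1 / ((detZ u x).natAbs : ℝ) ≤ 8 * B / supZ u * harm Q := by
  have hg : 0 < u.1.gcd u.2 := by
    rw [Int.gcd_pos_iff]
    by_contra! h
    exact hu0 (Prod.ext h.1 h.2)
  obtain ⟨a, b, hab, ha, hb⟩ := Int.exists_gcd_one hg
  set γ := u.1.gcd u.2
  set u' : ℤ × ℤ := (a, b) with hu'
  have hdet : ∀ x, detZ u x = detZ u' x * γ := by
    intro x; simp only [detZ, hu']; rw [ha, hb]; ring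
  have hsup : supZ u = supZ u' * γ := by
    simp only [supZ, hu']
    rw [ha, hb, Int.natAbs_mul, Int.natAbs_mul, Int.natAbs_natCast, max_mul]
  have hcop : IsCoprime u'.1 u'.2 := Int.isCoprime_iff_gcd_eq_one.2 hab
  have hsup'B : supZ u' ≤ B := le_trans (by rw [hsup]; exact Nat.le_mul_of_pos_right _ hg) hB
  have hsup' : 0 < supZ u' := by
    rw [supZ, lt_max_iff]
    by_contra! h
    have h1 : a = 0 := by simp only [hu'] at h; omega
    have h2 : b = 0 := by simp only [hu'] at h; omega
    rw [h1, h2] at hab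
    simp at hab
  have hγ : (0 : ℝ) < γ := by exact_mod_cast hg
  have hs0 : (0 : ℝ) < supZ u' := by exact_mod_cast hsup'
  calc _ ≤ ∑ x ∈ (sqBox B).filter (fun x => detZ u' x ≠ 0 ∧ (detZ u' x).natAbs ≤ Q),
        1 / (γ * ((detZ u' x).natAbs : ℝ)) := by
        refine (sum_le_sum_of_subset_of_nonneg ?_ fun _ _ _ => by positivity).trans
          (sum_le_sum fun x _ => ?_)
        · intro x hx
          have hx := mem_filter.1 hx
          have h1 : (detZ u x).natAbs = (detZ u' x).natAbs * γ := by
            rw [hdet, Int.natAbs_mul, Int.natAbs_natCast]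
          refine mem_filter.2 ⟨hx.1, fun h => hx.2.1 (by rw [hdet, h, zero_mul]), ?_⟩
          exact le_trans (by rw [h1]; exact Nat.le_mul_of_pos_right _ hg) hx.2.2
        · rw [hdet, Int.natAbs_mul, Int.natAbs_natCast]
          push_cast
          rw [mul_comm]
    _ ≤ ∑ k ∈ (Icc (-(Q : ℤ)) Q).filter (· ≠ 0),
        4 * B / supZ u' * (1 / (γ * (k.natAbs : ℝ))) := by
        refine sum_comp_le_sum_mul (g := detZ u') (c := fun _ => 4 * (B : ℝ) / supZ u')
          (φ := fun k : ℤ => 1 / (γ * (k.natAbs : ℝ))) ?_ (fun _ _ => by positivity) ?_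
        · intro x hx
          have hx := (mem_filter.1 hx).2
          exact mem_filter.2 ⟨mem_Icc.2 ⟨by omega, by omega⟩, hx.1⟩
        · intro k _
          rw [le_div_iff₀ hs0]
          refine le_trans (mul_le_mul_of_nonneg_right ?_ hs0.le) (card_detZ_eq u' k B hcop hsup'B)
          exact_mod_cast card_le_card (by
            rw [filter_filter]
            exact monotone_filter_right _ fun x _ h => h.2)
    _ ≤ ∑ r ∈ Icc 1 Q, 2 * (4 * B / supZ u' * (1 / (γ * (r : ℝ)))) :=
        sum_natAbs_le Q (φ := fun r => 4 * B / supZ u' * (1 / (γ * (r : ℝ))))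
          fun _ _ => by positivity
    _ = 8 * B / supZ u * harm Q := by
        rw [harm, mul_sum, hsup]
        refine sum_congr rfl fun r _ => ?_
        push_cast
        field_simp
        ring

lemma card_detZ_le_aux {u : ℤ × ℤ} (h0 : u.1 ≠ 0) (B Q : ℕ) :
    (((sqBox B).filter fun x => (detZ u x).natAbs ≤ Q).card : ℝ)
      ≤ (2 * B + 1) * (2 * Q / u.1.natAbs + 1) := by
  have hr : (0 : ℝ) < u.1.natAbs := by
    have : 0 < u.1.natAbs := by omega
    exact_mod_cast this
  have h := card_le_mul_card_image_of_maps_to (s := (sqBox B).filter fun x => (detZ u x).natAbs ≤ Q)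
    (t := Icc (-(B : ℤ)) B) (f := Prod.fst) (fun x hx => (by
      have := mem_sqBox.1 (mem_filter.1 hx).1
      exact mem_Icc.2 this.1)) (⌊2 * (Q : ℝ) / u.1.natAbs⌋₊ + 1) ?_
  · have h2 : (((sqBox B).filter fun x => (detZ u x).natAbs ≤ Q).card : ℝ)
        ≤ ((⌊2 * (Q : ℝ) / u.1.natAbs⌋₊ + 1) : ℕ) * ((Icc (-(B : ℤ)) B).card : ℕ) := by
      exact_mod_cast h
    have h3 : ((Icc (-(B : ℤ)) B).card : ℝ) = 2 * B + 1 := by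
      rw [Int.card_Icc]
      have : ((B : ℤ) + 1 - -(B : ℤ)).toNat = 2 * B + 1 := by omega
      rw [this]; push_cast; ring
    refine h2.trans ?_
    rw [h3, mul_comm]
    push_cast
    gcongr
    exact Nat.floor_le (by positivity)
  · intro p _
    set S := ((sqBox B).filter fun x => (detZ u x).natAbs ≤ Q).filter fun x => x.1 = p with hS
    rcases S.eq_empty_or_nonempty with h | h
    · rw [h]; simp
    obtain ⟨x₀, hx₀, hmin⟩ := exists_min_image S Prod.snd h
    have hmem : ∀ x ∈ S, (detZ u x).natAbs ≤ Q ∧ x.1 = p := fun x hx =>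
      ⟨(mem_filter.1 (mem_filter.1 hx).1).2, (mem_filter.1 hx).2⟩
    have hle : S.card ≤ (Icc x₀.2 (x₀.2 + ⌊2 * (Q : ℝ) / u.1.natAbs⌋₊)).card := by
      refine card_le_card_of_injOn Prod.snd ?_ ?_
      · intro x hx
        have h1 := hmem x hx
        have h2 := hmem x₀ hx₀
        have h3 := hmin x hx
        refine mem_coe.2 (mem_Icc.2 ⟨h3, ?_⟩)
        have h4 : u.1 * (x.2 - x₀.2) = detZ u x - detZ u x₀ := by
          simp only [detZ, h1.2, h2.2]; ring
        have h5 : u.1.natAbs * (x.2 - x₀.2).natAbs ≤ 2 * Q := by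
          rw [← Int.natAbs_mul, h4]
          omega
        have h6 : (x.2 - x₀.2).natAbs ≤ ⌊2 * (Q : ℝ) / u.1.natAbs⌋₊ := by
          refine Nat.le_floor ?_
          rw [le_div_iff₀ hr, mul_comm]
          exact_mod_cast h5
        omega
      · intro x hx y hy hxy
        exact Prod.ext ((hmem x hx).2.trans (hmem y hy).2.symm) hxy
    refine hle.trans ?_
    rw [Int.card_Icc]
    omega

lemma card_detZ_le {u : ℤ × ℤ} (h0 : u ≠ 0) (B Q : ℕ) :
    (((sqBox B).filter fun x => (detZ u x).natAbs ≤ Q).card : ℝ)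
      ≤ (2 * B + 1) * (2 * Q / supZ u + 1) := by
  have hne : u.1 ≠ 0 ∨ u.2 ≠ 0 := by
    by_contra! h
    exact h0 (Prod.ext h.1 h.2)
  rcases le_total u.2.natAbs u.1.natAbs with h | h
  · have hs : supZ u = u.1.natAbs := max_eq_left h
    rw [hs]
    exact card_detZ_le_aux (by omega) B Q
  · have hs : supZ u = u.2.natAbs := max_eq_right h
    rw [hs, card_swap_filter]
    have h2 : ∀ x, (detZ u x.swap).natAbs = (detZ u.swap x).natAbs := by
      intro x
      have := detZ_swap u x.swap
      rw [Prod.swap_swap] at this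
      rw [this, Int.natAbs_neg]
    simp only [h2]
    exact card_detZ_le_aux (u := u.swap) (by simp; omega) B Q

lemma card_supZ_eq_le (B r : ℕ) (hr : 1 ≤ r) :
    (((sqBox B).filter fun u => supZ u = r).card : ℝ) ≤ 12 * r := by
  have hI : ((Icc (-(r : ℤ)) r).card) = 2 * r + 1 := by rw [Int.card_Icc]; omega
  have : (sqBox B).filter (fun u => supZ u = r)
      ⊆ ({(r : ℤ), -(r : ℤ)} : Finset ℤ) ×ˢ Icc (-(r : ℤ)) r ∪
        Icc (-(r : ℤ)) r ×ˢ ({(r : ℤ), -(r : ℤ)} : Finset ℤ) := by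
    intro u hu
    have h := (mem_filter.1 hu).2
    rw [supZ] at h
    simp only [mem_union, mem_product, mem_insert, mem_singleton, mem_Icc]
    omega
  have h2 := (card_le_card this).trans (card_union_le _ _)
  rw [card_product, card_product, hI] at h2
  have h3 : ({(r : ℤ), -(r : ℤ)} : Finset ℤ).card ≤ 2 := card_le_two
  have h4 : ((sqBox B).filter fun u => supZ u = r).card ≤ 12 * r := by nlinarith
  exact_mod_cast h4

lemma sum_supZ_le (B : ℕ) {φ : ℕ → ℝ} (hφ : ∀ r, 0 ≤ φ r) :
    ∑ u ∈ (sqBox B).filter (· ≠ 0), φ (supZ u) ≤ ∑ r ∈ Icc 1 B, 12 * r * φ r := by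
  refine sum_comp_le_sum_mul (g := supZ) (c := fun r => 12 * (r : ℝ)) (fun u hu => ?_)
    (fun r _ => hφ r) fun r hr => ?_
  · have h := mem_filter.1 hu
    have h1 := mem_sqBox.1 h.1
    have hne : u.1 ≠ 0 ∨ u.2 ≠ 0 := by
      by_contra! h'
      exact h.2 (Prod.ext h'.1 h'.2)
    rw [mem_Icc, supZ]
    omega
  · refine le_trans ?_ (card_supZ_eq_le B r (mem_Icc.1 hr).1)
    exact_mod_cast card_le_card (filter_subset_filter _ (filter_subset _ _))

/-- The sum over triples of plane vectors controlling nonparallel pairs with small minors. -/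
lemma sum_triple_le (B Q : ℕ) :
    ∑ u ∈ (sqBox B).filter (· ≠ 0),
      (∑ x ∈ (sqBox B).filter (fun x => detZ u x ≠ 0 ∧ (detZ u x).natAbs ≤ Q),
        1 / ((detZ u x).natAbs : ℝ)) * ((sqBox B).filter fun x => (detZ u x).natAbs ≤ Q).card
      ≤ 600 * (B ^ 2 * Q * (harm Q * harm B) + B ^ 3 * harm Q) := by
  set φ : ℕ → ℝ := fun r => 8 * B / r * harm Q * (3 * B * (2 * Q / r + 1)) with hφ
  have hQ := harm_nonneg Q
  rcases Nat.eq_zero_or_pos B with hB0 | hB0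
  · have : (sqBox B).filter (· ≠ 0) = ∅ := by
      rw [filter_eq_empty_iff]
      intro u hu h
      have := mem_sqBox.1 hu
      exact h (Prod.ext (by simp; omega) (by simp; omega))
    rw [this, sum_empty, hB0]
    simp
  have hB1 : (1 : ℝ) ≤ B := by exact_mod_cast hB0
  calc _ ≤ ∑ u ∈ (sqBox B).filter (· ≠ 0), φ (supZ u) := by
        refine sum_le_sum fun u hu => ?_
        have h := mem_filter.1 hu
        have h1 := mem_sqBox.1 h.1
        have hle : supZ u ≤ B := by rw [supZ]; omega
        refine mul_le_mul (sum_inv_detZ_le h.2 hle Q) ((card_detZ_le h.2 B Q).trans ?_)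
          (by positivity) (by positivity)
        exact mul_le_mul_of_nonneg_right (by linarith) (by positivity)
    _ ≤ ∑ r ∈ Icc 1 B, 12 * r * φ r := sum_supZ_le B fun r => by positivity
    _ = ∑ r ∈ Icc 1 B, (576 * B ^ 2 * Q * harm Q * (1 / (r : ℝ)) + 288 * B ^ 2 * harm Q) := by
        refine sum_congr rfl fun r hr => ?_
        have : (0 : ℝ) < r := by exact_mod_cast (mem_Icc.1 hr).1
        simp only [hφ]
        field_simp
        ring
    _ = 576 * B ^ 2 * Q * harm Q * harm B + 288 * B ^ 3 * harm Q := by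
        rw [sum_add_distrib, ← mul_sum, sum_const, Nat.card_Icc, nsmul_eq_mul, Nat.add_sub_cancel]
        change 576 * (B : ℝ) ^ 2 * Q * harm Q * harm B + _ = _
        ring
    _ ≤ _ := by
        have h1 : 0 ≤ (B : ℝ) ^ 2 * Q * (harm Q * harm B) := by
          have := harm_nonneg B
          positivity
        have h2 : 0 ≤ (B : ℝ) ^ 3 * harm Q := by positivity
        linarith

/-- The integer vectors of sup norm at most `B`. -/
def intBox (n B : ℕ) : Finset (Fin n → ℤ) := Fintype.piFinset fun _ => Icc (-(B : ℤ)) B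

/-- The sup norm of an integer vector. -/
def supN {n : ℕ} (v : Fin n → ℤ) : ℕ := univ.sup fun i => (v i).natAbs

variable {n : ℕ}

lemma natAbs_le_supN (v : Fin n → ℤ) (i : Fin n) : (v i).natAbs ≤ supN v :=
  le_sup (f := fun i => (v i).natAbs) (mem_univ i)

lemma supN_le_iff {v : Fin n → ℤ} {B : ℕ} : supN v ≤ B ↔ ∀ i, (v i).natAbs ≤ B := by
  simp [supN, Finset.sup_le_iff]

lemma mem_intBox {v : Fin n → ℤ} {B : ℕ} : v ∈ intBox n B ↔ supN v ≤ B := by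
  rw [intBox, Fintype.mem_piFinset, supN_le_iff]
  refine forall_congr' fun i => ?_
  rw [mem_Icc]
  omega

lemma supN_eq_zero {v : Fin n → ℤ} : supN v = 0 ↔ v = 0 := by
  rw [← Nat.le_zero, supN_le_iff]
  constructor
  · intro h
    funext i
    have := h i
    simp only [Pi.zero_apply]
    omega
  · rintro rfl
    simp

lemma supN_pos {v : Fin n → ℤ} (h : v ≠ 0) : 0 < supN v :=
  Nat.pos_of_ne_zero fun h' => h (supN_eq_zero.1 h')

lemma exists_natAbs_eq_supN {v : Fin n → ℤ} (h : v ≠ 0) : ∃ i, (v i).natAbs = supN v := by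
  have hne : Nonempty (Fin n) := by
    by_contra h'
    rw [not_nonempty_iff] at h'
    exact h (funext fun i => h'.elim i)
  obtain ⟨i, -, hi⟩ := exists_mem_eq_sup univ univ_nonempty fun i => (v i).natAbs
  exact ⟨i, hi.symm⟩

lemma norm_intVec (v : Fin n → ℤ) : ‖intVec v‖ = supN v := by
  refine le_antisymm ((pi_norm_le_iff_of_nonneg (by positivity)).2 fun i => ?_) ?_
  · rw [intVec, Real.norm_eq_abs, ← Int.cast_abs, ← Nat.cast_natAbs]
    exact_mod_cast natAbs_le_supN v i
  · rcases eq_or_ne v 0 with rfl | h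
    · rw [supN_eq_zero.2 rfl]; simp
    · obtain ⟨i, hi⟩ := exists_natAbs_eq_supN h
      rw [← hi]
      refine le_trans (le_of_eq ?_) (norm_le_pi_norm (intVec v) i)
      rw [intVec, Real.norm_eq_abs, ← Int.cast_abs, ← Nat.cast_natAbs]

lemma card_Icc_neg (B : ℕ) : (Icc (-(B : ℤ)) B).card = 2 * B + 1 := by
  rw [Int.card_Icc]; omega

lemma card_sqBox (B : ℕ) : (sqBox B).card = (2 * B + 1) ^ 2 := by
  rw [sqBox, card_product, card_Icc_neg, sq]

lemma card_intBox (n B : ℕ) : (intBox n B).card = (2 * B + 1) ^ n := by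
  rw [intBox, Fintype.card_piFinset]
  simp only [card_Icc_neg, prod_const, card_univ, Fintype.card_fin]

lemma card_supN_eq_le (n B r : ℕ) (hr : 1 ≤ r) :
    (((intBox (n + 1) B).filter fun v => supN v = r).card : ℝ)
      ≤ 2 * (n + 1) * (3 * (r : ℝ)) ^ n := by
  have hsub : (intBox (n + 1) B).filter (fun v => supN v = r) ⊆ univ.biUnion fun i : Fin (n + 1) =>
      Fintype.piFinset fun l => if l = i then ({(r : ℤ), -(r : ℤ)} : Finset ℤ)
        else Icc (-(r : ℤ)) r := by
    intro v hv
    have h := (mem_filter.1 hv).2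
    have hv0 : v ≠ 0 := fun h0 => by rw [supN_eq_zero.2 h0] at h; omega
    obtain ⟨i, hi⟩ := exists_natAbs_eq_supN hv0
    refine mem_biUnion.2 ⟨i, mem_univ _, Fintype.mem_piFinset.2 fun l => ?_⟩
    by_cases hl : l = i
    · rw [if_pos hl, hl, mem_insert, mem_singleton]
      omega
    · rw [if_neg hl, mem_Icc]
      have := natAbs_le_supN v l
      omega
  have hcard := (card_le_card hsub).trans card_biUnion_le
  have heach : ∀ i : Fin (n + 1), (Fintype.piFinset fun l => if l = i then
      ({(r : ℤ), -(r : ℤ)} : Finset ℤ) else Icc (-(r : ℤ)) r).card ≤ 2 * (3 * r) ^ n := by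
    intro i
    rw [Fintype.card_piFinset, Fin.prod_univ_succAbove _ i, if_pos rfl]
    refine Nat.mul_le_mul card_le_two ?_
    refine (prod_le_pow_card univ _ (3 * r) fun l _ => ?_).trans (by simp)
    rw [if_neg (Fin.succAbove_ne i l), card_Icc_neg]
    omega
  have h2 := hcard.trans (sum_le_sum fun i _ => heach i)
  rw [sum_const, card_univ, Fintype.card_fin, smul_eq_mul] at h2
  have h3 : (((intBox (n + 1) B).filter fun v => supN v = r).card : ℝ)
      ≤ (((n + 1) * (2 * (3 * r) ^ n) : ℕ) : ℝ) := by exact_mod_cast h2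
  refine h3.trans (le_of_eq ?_)
  push_cast
  ring

lemma sum_supN_le (n B : ℕ) {φ : ℕ → ℝ} (hφ : ∀ r, 0 ≤ φ r) :
    ∑ v ∈ (intBox (n + 1) B).filter (· ≠ 0), φ (supN v)
      ≤ ∑ r ∈ Icc 1 B, 2 * (n + 1) * (3 * (r : ℝ)) ^ n * φ r := by
  refine sum_comp_le_sum_mul (g := supN) (c := fun r => 2 * (n + 1) * (3 * (r : ℝ)) ^ n)
    (fun v hv => ?_) (fun r _ => hφ r) fun r hr => ?_
  · have h := mem_filter.1 hv
    exact mem_Icc.2 ⟨supN_pos h.2, mem_intBox.1 h.1⟩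
  · refine le_trans ?_ (card_supN_eq_le n B r (mem_Icc.1 hr).1)
    exact_mod_cast card_le_card (filter_subset_filter _ (filter_subset _ _))

lemma sum_inv_supN_pow_le {n e : ℕ} (he : e ≤ n) (B : ℕ) :
    ∑ v ∈ (intBox (n + 1) B).filter (· ≠ 0), 1 / (supN v : ℝ) ^ e
      ≤ 2 * (n + 1) * 3 ^ n * (B : ℝ) ^ (n + 1 - e) := by
  refine (sum_supN_le n B (φ := fun r => 1 / (r : ℝ) ^ e) fun r => by positivity).trans ?_
  calc _ ≤ ∑ _r ∈ Icc 1 B, 2 * (n + 1) * 3 ^ n * (B : ℝ) ^ (n - e) := by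
        refine sum_le_sum fun r hr => ?_
        have h := mem_Icc.1 hr
        have hr0 : (0 : ℝ) < r := by exact_mod_cast h.1
        have hrB : (r : ℝ) ≤ B := by exact_mod_cast h.2
        have : (r : ℝ) ^ n = r ^ (n - e) * r ^ e := by rw [← pow_add, Nat.sub_add_cancel he]
        rw [mul_pow, this]
        have h2 : 2 * ((n : ℝ) + 1) * (3 ^ n * (r ^ (n - e) * r ^ e)) * (1 / (r : ℝ) ^ e)
            = 2 * (n + 1) * 3 ^ n * r ^ (n - e) := by field_simp
        rw [h2]
        gcongr
    _ = _ := by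
        rw [sum_const, Nat.card_Icc, nsmul_eq_mul, Nat.sub_add_comm he, pow_succ]
        push_cast
        ring

/-- The minors of a pair of integer vectors. -/
def minorZ (p : (Fin n → ℤ) × (Fin n → ℤ)) (i j : Fin n) : ℤ := p.1 i * p.2 j - p.1 j * p.2 i

lemma minorZ_eq_detZ (p : (Fin n → ℤ) × (Fin n → ℤ)) (i j : Fin n) :
    minorZ p i j = detZ (p.1 i, p.2 i) (p.1 j, p.2 j) := rfl

lemma absMinor_intVec (v w : Fin n → ℤ) (i j : Fin n) :
    absMinor (intVec v) (intVec w) i j = ((minorZ (v, w) i j).natAbs : ℝ) := by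
  rw [Nat.cast_natAbs, Int.cast_abs, absMinor, minorZ]
  push_cast
  rfl

lemma exists_eq_smul_of_minorZ_eq_zero {v w : Fin n → ℤ} (hv : v ≠ 0)
    (h : ∀ i j, minorZ (v, w) i j = 0) :
    ∃ (x : Fin n → ℤ) (k l : ℤ), k ≠ 0 ∧ v = k • x ∧ w = l • x := by
  obtain ⟨i, hi⟩ := Function.ne_iff.1 hv
  have hg : 0 < (v i).gcd (w i) := Int.gcd_pos_iff.2 (Or.inl hi)
  obtain ⟨k, l, hkl, hk, hl⟩ := Int.exists_gcd_one hg
  set γ := (v i).gcd (w i)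
  have hγ : (γ : ℤ) ≠ 0 := by omega
  have hk0 : k ≠ 0 := by rintro rfl; simp at hk; exact hi hk
  have hcop : IsCoprime k l := Int.isCoprime_iff_gcd_eq_one.2 hkl
  have hrel : ∀ j, k * w j = l * v j := by
    intro j
    have := h i j
    simp only [minorZ] at this
    rw [hk, hl] at this
    refine mul_left_cancel₀ hγ ?_
    linarith
  have hdvd : ∀ j, k ∣ v j := fun j => hcop.dvd_of_dvd_mul_left ⟨_, (hrel j).symm⟩
  choose x hx using hdvd
  refine ⟨x, k, l, hk0, funext fun j => by simp [hx j], funext fun j => ?_⟩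
  refine mul_left_cancel₀ hk0 ?_
  rw [hrel, hx]
  simp
  ring

lemma supN_smul (k : ℤ) (x : Fin n → ℤ) : supN (k • x) = k.natAbs * supN x := by
  rcases eq_or_ne x 0 with rfl | hx
  · rw [smul_zero, supN_eq_zero.2 rfl, mul_zero]
  refine le_antisymm (supN_le_iff.2 fun i => ?_) ?_
  · simp only [Pi.smul_apply, smul_eq_mul, Int.natAbs_mul]
    exact Nat.mul_le_mul_left _ (natAbs_le_supN x i)
  · obtain ⟨i, hi⟩ := exists_natAbs_eq_supN hx
    rw [← hi, ← Int.natAbs_mul]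
    exact natAbs_le_supN (k • x) i

/-- Parallel pairs of nonzero integer vectors are rare. -/
lemma card_parallel_le {n : ℕ} (hn : 2 ≤ n) (B : ℕ) :
    ((((intBox (n + 1) B).filter (· ≠ 0) ×ˢ (intBox (n + 1) B).filter (· ≠ 0)).filter
      fun p => ∀ i j, minorZ p i j = 0).card : ℝ) ≤ 8 * (n + 1) * 3 ^ n * (B : ℝ) ^ (n + 1) := by
  set M : (Fin (n + 1) → ℤ) → Finset ℤ := fun x =>
    (Icc (-(B : ℤ)) B).filter fun k => k ≠ 0 ∧ k.natAbs * supN x ≤ B with hM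
  have hsub : ((intBox (n + 1) B).filter (· ≠ 0) ×ˢ (intBox (n + 1) B).filter (· ≠ 0)).filter
      (fun p => ∀ i j, minorZ p i j = 0) ⊆ ((intBox (n + 1) B).filter (· ≠ 0)).biUnion fun x =>
      (M x ×ˢ M x).image fun kl => (kl.1 • x, kl.2 • x) := by
    rintro ⟨v, w⟩ hp
    obtain ⟨hp1, hp2⟩ := mem_filter.1 hp
    obtain ⟨hv, hw⟩ := mem_product.1 hp1
    obtain ⟨hvB, hv0⟩ := mem_filter.1 hv
    obtain ⟨hwB, hw0⟩ := mem_filter.1 hw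
    obtain ⟨x, k, l, hk, rfl, rfl⟩ := exists_eq_smul_of_minorZ_eq_zero hv0 hp2
    have hx : x ≠ 0 := by rintro rfl; simp at hv0
    have hl : l ≠ 0 := by rintro rfl; simp at hw0
    have hx1 := supN_pos hx
    simp only [mem_intBox, supN_smul] at hvB hwB
    have hk1 : 1 ≤ k.natAbs := by omega
    have hk2 : k.natAbs ≤ B := by nlinarith
    have hl2 : l.natAbs ≤ B := by nlinarith
    refine mem_biUnion.2 ⟨x, mem_filter.2 ⟨mem_intBox.2 (by nlinarith), hx⟩,
      mem_image.2 ⟨(k, l), mem_product.2 ⟨?_, ?_⟩, rfl⟩⟩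
    · exact mem_filter.2 ⟨mem_Icc.2 (by omega), hk, hvB⟩
    · exact mem_filter.2 ⟨mem_Icc.2 (by omega), hl, hwB⟩
  have hMcard : ∀ x, x ≠ 0 → ((M x).card : ℝ) ≤ 2 * (B / supN x) := by
    intro x hx
    have hx1 := supN_pos hx
    obtain ⟨q, hq⟩ : ∃ q, q = B / supN x := ⟨_, rfl⟩
    have h1 : M x ⊆ (Icc (-(q : ℤ)) q).erase 0 := by
      intro k hk
      obtain ⟨-, hk0, hk⟩ := mem_filter.1 hk
      have : k.natAbs ≤ q := hq ▸ (Nat.le_div_iff_mul_le hx1).2 hk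
      exact mem_erase.2 ⟨hk0, mem_Icc.2 (by omega)⟩
    have h2 := card_le_card h1
    rw [card_erase_of_mem (mem_Icc.2 (by omega)), card_Icc_neg] at h2
    have h3 : (M x).card ≤ 2 * q := by omega
    calc ((M x).card : ℝ) ≤ 2 * (q : ℝ) := by exact_mod_cast h3
      _ ≤ _ := by rw [hq]; gcongr; exact Nat.cast_div_le
  have h1 := (card_le_card hsub).trans card_biUnion_le
  calc _ ≤ ∑ x ∈ (intBox (n + 1) B).filter (· ≠ 0),
        (((M x ×ˢ M x).image fun kl => (kl.1 • x, kl.2 • x)).card : ℝ) := by exact_mod_cast h1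
    _ ≤ ∑ x ∈ (intBox (n + 1) B).filter (· ≠ 0), 4 * (B : ℝ) ^ 2 * (1 / (supN x : ℝ) ^ 2) := by
        refine sum_le_sum fun x hx => ?_
        have hx0 := (mem_filter.1 hx).2
        have h2 : (((M x ×ˢ M x).image fun kl => (kl.1 • x, kl.2 • x)).card : ℝ)
            ≤ (M x).card * (M x).card := by
          exact_mod_cast card_image_le.trans (card_product _ _).le
        have h3 : (0 : ℝ) < supN x := by exact_mod_cast supN_pos hx0
        refine h2.trans ((mul_le_mul (hMcard x hx0) (hMcard x hx0) (by positivity)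
          (by positivity)).trans (le_of_eq ?_))
        field_simp
        ring
    _ ≤ 4 * (B : ℝ) ^ 2 * (2 * (n + 1) * 3 ^ n * (B : ℝ) ^ (n + 1 - 2)) := by
        rw [← mul_sum]
        exact mul_le_mul_of_nonneg_left (sum_inv_supN_pow_le hn B) (by positivity)
    _ = _ := by
        have : (B : ℝ) ^ (n + 1) = B ^ 2 * B ^ (n + 1 - 2) := by
          rw [← pow_add]; congr 1; omega
        rw [this]; ring

/-- The nonparallel pairs with small minors contribute little. -/
lemma sum_inv_minorZ_le {m : ℕ} {i j k : Fin (m + 3)} (hij : i ≠ j) (hik : i ≠ k) (hjk : j ≠ k)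
    (B Q : ℕ) :
    ∑ p ∈ (intBox (m + 3) B ×ˢ intBox (m + 3) B).filter (fun p => minorZ p i j ≠ 0 ∧
        (minorZ p i j).natAbs ≤ Q ∧ (minorZ p i k).natAbs ≤ Q),
      1 / ((minorZ p i j).natAbs : ℝ)
      ≤ ((2 * B + 1) ^ 2) ^ m * (600 * (B ^ 2 * Q * (harm Q * harm B) + B ^ 3 * harm Q)) := by
  set U : (Fin (m + 3) → ℤ) × (Fin (m + 3) → ℤ) → Fin (m + 3) → ℤ × ℤ :=
    fun p l => (p.1 l, p.2 l) with hU
  set t : Finset (Σ _ : ℤ × ℤ, (ℤ × ℤ) × (ℤ × ℤ)) := ((sqBox B).filter (· ≠ 0)).sigma fun u =>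
    ((sqBox B).filter fun x => detZ u x ≠ 0 ∧ (detZ u x).natAbs ≤ Q) ×ˢ
      ((sqBox B).filter fun x => (detZ u x).natAbs ≤ Q) with ht
  have hUmem : ∀ p ∈ intBox (m + 3) B ×ˢ intBox (m + 3) B, ∀ l, U p l ∈ sqBox B := by
    intro p hp l
    obtain ⟨h1, h2⟩ := mem_product.1 hp
    have h1 := (natAbs_le_supN p.1 l).trans (mem_intBox.1 h1)
    have h2 := (natAbs_le_supN p.2 l).trans (mem_intBox.1 h2)
    refine mem_sqBox.2 ?_
    simp only [hU]
    omega
  have key := sum_comp_le_sum_mul (s := (intBox (m + 3) B ×ˢ intBox (m + 3) B).filter (fun p =>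
      minorZ p i j ≠ 0 ∧ (minorZ p i j).natAbs ≤ Q ∧ (minorZ p i k).natAbs ≤ Q)) (t := t)
    (g := fun p => ⟨U p i, U p j, U p k⟩) (c := fun _ => ((2 * (B : ℝ) + 1) ^ 2) ^ m)
    (φ := fun r => 1 / ((detZ r.1 r.2.1).natAbs : ℝ)) ?_ (fun _ _ => by positivity) ?_
  · refine le_trans key ?_
    rw [← mul_sum, ht, sum_sigma]
    refine mul_le_mul_of_nonneg_left (le_trans (le_of_eq ?_) (sum_triple_le B Q)) (by positivity)
    refine sum_congr rfl fun u _ => ?_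
    rw [sum_product, sum_mul]
    refine sum_congr rfl fun x _ => ?_
    simp only [sum_const, nsmul_eq_mul]
    rw [mul_comm]
  · intro p hp
    obtain ⟨hp, h1, h2, h3⟩ := mem_filter.1 hp
    rw [minorZ_eq_detZ] at h1 h2 h3
    refine mem_sigma.2 ⟨mem_filter.2 ⟨hUmem p hp i, fun h0 => h1 ?_⟩, mem_product.2
      ⟨mem_filter.2 ⟨hUmem p hp j, h1, h2⟩, mem_filter.2 ⟨hUmem p hp k, h3⟩⟩⟩
    have h0 : (p.1 i, p.2 i) = (0 : ℤ × ℤ) := h0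
    rw [h0]
    simp [detZ]
  · rintro r -
    set S := ((intBox (m + 3) B ×ˢ intBox (m + 3) B).filter (fun p =>
      minorZ p i j ≠ 0 ∧ (minorZ p i j).natAbs ≤ Q ∧ (minorZ p i k).natAbs ≤ Q)).filter
      fun p => (⟨U p i, U p j, U p k⟩ : Σ _ : ℤ × ℤ, (ℤ × ℤ) × (ℤ × ℤ)) = r with hS
    rcases S.eq_empty_or_nonempty with h | ⟨p₀, hp₀⟩
    · rw [h]; simp; positivity
    set K : Finset (Fin (m + 3)) := {i, j, k} with hK
    have hKcard : K.card = 3 := card_eq_three.2 ⟨i, j, k, hij, hik, hjk, rfl⟩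
    have hle : S.card ≤ (Fintype.piFinset fun l => if l ∈ K then {U p₀ l} else sqBox B).card := by
      refine card_le_card_of_injOn U ?_ ?_
      · intro p hp
        have hp1 := (mem_filter.1 hp)
        have hp0 := (mem_filter.1 hp₀).2
        have he := hp1.2.trans hp0.symm
        simp only [Sigma.mk.injEq, heq_eq_eq, Prod.mk.injEq] at he
        refine mem_coe.2 (Fintype.mem_piFinset.2 fun l => ?_)
        by_cases hl : l ∈ K
        · rw [if_pos hl, mem_singleton]
          simp only [hK, mem_insert, mem_singleton] at hl
          rcases hl with rfl | rfl | rfl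
          · exact he.1
          · exact he.2.1
          · exact he.2.2
        · rw [if_neg hl]
          exact hUmem p (mem_filter.1 hp1.1).1 l
      · intro p _ p' _ h
        refine Prod.ext (funext fun l => ?_) (funext fun l => ?_)
        · exact congrArg Prod.fst (congrFun h l)
        · exact congrArg Prod.snd (congrFun h l)
    have hcard : (Fintype.piFinset fun l => if l ∈ K then {U p₀ l} else sqBox B).card
        = ((2 * B + 1) ^ 2) ^ m := by
      rw [Fintype.card_piFinset]
      have : ∀ l, (if l ∈ K then ({U p₀ l} : Finset (ℤ × ℤ)) else sqBox B).card
          = if l ∈ K then 1 else (2 * B + 1) ^ 2 := by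
        intro l
        split_ifs
        · simp
        · exact card_sqBox B
      simp only [this]
      rw [prod_ite, prod_const_one, one_mul, prod_const]
      congr 1
      have h2 := card_compl K
      rw [hKcard, Fintype.card_fin] at h2
      have h3 : univ.filter (fun l => l ∉ K) = Kᶜ := by ext; simp
      rw [h3, h2]
      omega
    rw [hcard] at hle
    exact_mod_cast hle

end latticeSums

section averages

variable {n : ℕ} {G : Type*} [MeasurableSpace G]

/-- The half-open unit cube. -/
def unitCube (n : ℕ) : Set (Fin n → ℝ) := Set.univ.pi fun _ => Set.Ico 0 1

lemma measurableSet_unitCube (n : ℕ) : MeasurableSet (unitCube n) :=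
  MeasurableSet.univ_pi fun _ => measurableSet_Ico

lemma volume_unitCube (n : ℕ) : volume (unitCube n) = 1 := by
  rw [unitCube, volume_pi_pi]
  simp

instance (n : ℕ) : IsProbabilityMeasure (volume.restrict (unitCube n)) :=
  ⟨by rw [Measure.restrict_apply_univ, volume_unitCube]⟩

lemma zero_mem_unitCube (n : ℕ) : (0 : Fin n → ℝ) ∈ unitCube n := by
  simp [unitCube]

lemma norm_le_one_of_mem_unitCube {ξ : Fin n → ℝ} (h : ξ ∈ unitCube n) : ‖ξ‖ ≤ 1 := by
  refine (pi_norm_le_iff_of_nonneg zero_le_one).2 fun i => ?_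
  have := h i (Set.mem_univ i)
  rw [Real.norm_eq_abs, abs_of_nonneg this.1]
  exact this.2.le

/-- The average of `f` over the unit cube with corner `v`. -/
def avg (f : (Fin n → ℝ) → G → ℝ) (v : Fin n → ℝ) (g : G) : ℝ :=
  ∫ ξ in unitCube n, f (v + ξ) g

/-- A jointly measurable family of functions with values in `[0, 1]`. -/
structure UnitFamily (f : (Fin n → ℝ) → G → ℝ) : Prop where
  meas : Measurable fun p : (Fin n → ℝ) × G => f p.1 p.2
  nonneg : ∀ x g, 0 ≤ f x g
  le_one : ∀ x g, f x g ≤ 1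

namespace UnitFamily

variable {f : (Fin n → ℝ) → G → ℝ}

lemma meas_left (hf : UnitFamily f) (g : G) :
    Measurable fun x => f x g := hf.meas.comp measurable_prodMk_right

lemma meas_right (hf : UnitFamily f) (x : Fin n → ℝ) : Measurable (f x) := by
  have h : Measurable fun g : G => (x, g) := measurable_prodMk_left
  exact hf.meas.comp h

lemma abs_le_one (hf : UnitFamily f) (x : Fin n → ℝ) (g : G) : |f x g| ≤ 1 :=
  abs_le.2 ⟨by linarith [hf.nonneg x g], hf.le_one x g⟩

lemma integrable_left (hf : UnitFamily f) {κ : Measure (Fin n → ℝ)} [IsFiniteMeasure κ]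
    (v : Fin n → ℝ) (g : G) :
    Integrable (fun ξ => f (v + ξ) g) κ :=
  Integrable.of_bound ((hf.meas_left g).comp (measurable_const_add v)).aestronglyMeasurable 1
    (Filter.Eventually.of_forall fun _ => hf.abs_le_one _ _)

lemma avg_nonneg (hf : UnitFamily f) (v : Fin n → ℝ) (g : G) : 0 ≤ avg f v g :=
  integral_nonneg fun _ => hf.nonneg _ _

lemma avg_le_one (hf : UnitFamily f) (v : Fin n → ℝ) (g : G) : avg f v g ≤ 1 := by
  have := integral_mono (hf.integrable_left v g)
    (integrable_const (μ := volume.restrict (unitCube n))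
    (1 : ℝ)) fun ξ => hf.le_one (v + ξ) g
  simpa [avg] using this

lemma measurable_avg (hf : UnitFamily f) (v : Fin n → ℝ) : Measurable (avg f v) := by
  have h : Measurable fun p : G × (Fin n → ℝ) => f (v + p.2) p.1 :=
    hf.meas.comp ((measurable_snd.const_add v).prodMk measurable_fst)
  exact (h.stronglyMeasurable.integral_prod_right (ν := volume.restrict (unitCube n))).measurable

variable {ν : Measure G} [IsFiniteMeasure ν] {Φ : G → ℝ} {K : ℝ}

lemma integrable_prod (hf : UnitFamily f) (hΦ : Measurable Φ) (hK : ∀ g, |Φ g| ≤ K)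
    (v : Fin n → ℝ) :
    Integrable (fun p : G × (Fin n → ℝ) => Φ p.1 * f (v + p.2) p.1)
      (ν.prod (volume.restrict (unitCube n))) := by
  have h : Measurable fun p : G × (Fin n → ℝ) => f (v + p.2) p.1 :=
    hf.meas.comp ((measurable_snd.const_add v).prodMk measurable_fst)
  refine Integrable.of_bound ((hΦ.comp measurable_fst).mul h).aestronglyMeasurable K
    (Filter.Eventually.of_forall fun p => ?_)
  rw [Real.norm_eq_abs, abs_mul]
  calc _ ≤ K * 1 := mul_le_mul (hK _) (hf.abs_le_one _ _) (abs_nonneg _)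
        ((abs_nonneg _).trans (hK p.1))
    _ = K := mul_one K

lemma integral_mul_avg (hf : UnitFamily f) (hΦ : Measurable Φ) (hK : ∀ g, |Φ g| ≤ K)
    (v : Fin n → ℝ) :
    ∫ g, Φ g * avg f v g ∂ν = ∫ ξ in unitCube n, ∫ g, Φ g * f (v + ξ) g ∂ν := by
  rw [← integral_integral_swap (hf.integrable_prod hΦ hK v)]
  simp only [avg, integral_const_mul]

lemma integrable_mul (hf : UnitFamily f) (hΦ : Measurable Φ) (hK : ∀ g, |Φ g| ≤ K) (x : Fin n → ℝ) :
    Integrable (fun g => Φ g * f x g) ν := by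
  refine Integrable.of_bound (hΦ.mul (hf.meas_right x)).aestronglyMeasurable K
    (Filter.Eventually.of_forall fun g => ?_)
  rw [Real.norm_eq_abs, abs_mul]
  calc _ ≤ K * 1 := mul_le_mul (hK _) (hf.abs_le_one _ _) (abs_nonneg _)
        ((abs_nonneg _).trans (hK g))
    _ = K := mul_one K

lemma integrable (hf : UnitFamily f) (x : Fin n → ℝ) : Integrable (f x) ν :=
  Integrable.of_bound (hf.meas_right x).aestronglyMeasurable 1
    (Filter.Eventually.of_forall fun _ => hf.abs_le_one _ _)

lemma integrable_avg (hf : UnitFamily f) (x : Fin n → ℝ) : Integrable (avg f x) ν :=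
  Integrable.of_bound (hf.measurable_avg x).aestronglyMeasurable 1
    (Filter.Eventually.of_forall fun g => abs_le.2
      ⟨by linarith [hf.avg_nonneg x g], hf.avg_le_one x g⟩)

end UnitFamily

/-- The deviation of `f` at `v` from its average. -/
def dev (f : (Fin n → ℝ) → G → ℝ) (v : Fin n → ℝ) (g : G) : ℝ := f v g - avg f v g

namespace UnitFamily

variable {f : (Fin n → ℝ) → G → ℝ}

lemma abs_dev_le (hf : UnitFamily f) (v : Fin n → ℝ) (g : G) : |dev f v g| ≤ 1 := by
  rw [dev, abs_le]
  constructor <;>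
    linarith [hf.nonneg v g, hf.le_one v g, hf.avg_nonneg v g, hf.avg_le_one v g]

lemma abs_dev_le_add (hf : UnitFamily f) (v : Fin n → ℝ) (g : G) :
    |dev f v g| ≤ f v g + avg f v g := by
  rw [dev, abs_le]
  constructor <;> linarith [hf.nonneg v g, hf.avg_nonneg v g]

lemma measurable_dev (hf : UnitFamily f) (v : Fin n → ℝ) : Measurable (dev f v) :=
  (hf.meas_right v).sub (hf.measurable_avg v)

variable {ν : Measure G} [IsFiniteMeasure ν] {Φ : G → ℝ} {K : ℝ}

lemma abs_integral_mul_dev_le (hf : UnitFamily f) (hΦ : Measurable Φ) (hK : ∀ g, |Φ g| ≤ K)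
    (v : Fin n → ℝ) {B : ℝ}
    (hB : ∀ ξ ∈ unitCube n, |∫ g, Φ g * f v g ∂ν - ∫ g, Φ g * f (v + ξ) g ∂ν| ≤ B) :
    |∫ g, Φ g * dev f v g ∂ν| ≤ B := by
  have hint : Integrable (fun g => Φ g * avg f v g) ν :=
    Integrable.of_bound (hΦ.mul (hf.measurable_avg v)).aestronglyMeasurable K
      (Filter.Eventually.of_forall fun g => by
        rw [Real.norm_eq_abs, abs_mul, abs_of_nonneg (hf.avg_nonneg v g)]
        calc _ ≤ K * 1 := mul_le_mul (hK _) (hf.avg_le_one _ _) (hf.avg_nonneg _ _)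
              ((abs_nonneg _).trans (hK g))
          _ = K := mul_one K)
  have h1 : ∫ g, Φ g * dev f v g ∂ν
      = ∫ ξ in unitCube n, (∫ g, Φ g * f v g ∂ν - ∫ g, Φ g * f (v + ξ) g ∂ν) := by
    rw [integral_sub (integrable_const _) (hf.integrable_prod hΦ hK v).integral_prod_right,
      ← hf.integral_mul_avg hΦ hK, integral_const]
    simp only [dev, mul_sub]
    rw [integral_sub (hf.integrable_mul hΦ hK v) hint]
    simp
  rw [h1, ← Real.norm_eq_abs]
  have := norm_setIntegral_le_of_norm_le_const (μ := volume) (s := unitCube n)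
    (by rw [volume_unitCube]; exact ENNReal.one_lt_top) (C := B) (f := fun ξ =>
      (∫ g, Φ g * f v g ∂ν - ∫ g, Φ g * f (v + ξ) g ∂ν)) hB
  simpa [Measure.real, volume_unitCube] using this

lemma abs_integral_dev_mul_dev_le (hf : UnitFamily f) (v w : Fin n → ℝ) {B : ℝ}
    (hB : ∀ η ∈ unitCube n, ∀ ξ ∈ unitCube n,
      |∫ g, f (v + η) g * f w g ∂ν - ∫ g, f (v + η) g * f (w + ξ) g ∂ν| ≤ B) :
    |∫ g, dev f v g * dev f w g ∂ν| ≤ 2 * B := by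
  have h1 : ∀ η ∈ unitCube n, |∫ g, dev f w g * f (v + η) g ∂ν| ≤ B := by
    intro η hη
    simp only [mul_comm (dev f w _)]
    exact hf.abs_integral_mul_dev_le (hf.meas_right _) (hf.abs_le_one _) w (hB η hη)
  simp only [mul_comm (dev f v _)]
  refine hf.abs_integral_mul_dev_le (hf.measurable_dev w) (hf.abs_dev_le w) v fun ξ hξ => ?_
  have h2 := h1 0 (zero_mem_unitCube n)
  rw [add_zero] at h2
  exact (abs_sub _ _).trans (by linarith [h1 ξ hξ])

/-- Sums of averages are integrals over unions of cubes. -/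
lemma sum_avg_eq (hf : UnitFamily f) (W : Finset (Fin n → ℤ)) (g : G) :
    ∑ w ∈ W, avg f (intVec w) g = ∫ x in {x : Fin n → ℝ | (fun i => ⌊x i⌋) ∈ W}, f x g := by
  have hcell : ∀ w : Fin n → ℤ, {x : Fin n → ℝ | (fun i => ⌊x i⌋) = w}
      = Set.univ.pi fun i => Set.Ico (w i : ℝ) (w i + 1) := by
    intro w
    ext x
    simp only [Set.mem_pi, Set.mem_univ, true_implies, Set.mem_Ico]
    refine funext_iff.trans (forall_congr' fun i => ?_)
    exact Int.floor_eq_iff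
  have hmeas : ∀ w : Fin n → ℤ, MeasurableSet {x : Fin n → ℝ | (fun i => ⌊x i⌋) = w} := by
    intro w
    rw [hcell]
    exact MeasurableSet.univ_pi fun _ => measurableSet_Ico
  have hfin : ∀ w : Fin n → ℤ, volume {x : Fin n → ℝ | (fun i => ⌊x i⌋) = w} < ⊤ := by
    intro w
    rw [hcell, volume_pi_pi]
    simp
  have hunion : {x : Fin n → ℝ | (fun i => ⌊x i⌋) ∈ W}
      = ⋃ w ∈ W, {x : Fin n → ℝ | (fun i => ⌊x i⌋) = w} := by
    ext x; simp
  rw [hunion, integral_biUnion_finset W (fun w _ => hmeas w)]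
  · refine Finset.sum_congr rfl fun w _ => ?_
    have hpre : (fun ξ : Fin n → ℝ => intVec w + ξ) ⁻¹' {x : Fin n → ℝ | (fun i => ⌊x i⌋) = w}
        = unitCube n := by
      rw [hcell]
      ext ξ
      simp [unitCube, intVec]
    rw [avg, ← hpre]
    exact (measurePreserving_add_left volume (intVec w)).setIntegral_preimage_emb
      (measurableEmbedding_addLeft _) (fun x => f x g) _
  · intro w _ w' _ hne
    refine Set.disjoint_left.2 fun x hx hx' => hne ?_
    exact Eq.trans (Eq.symm hx) hx'
  · intro w _
    have : IsFiniteMeasure (volume.restrict {x : Fin n → ℝ | (fun i => ⌊x i⌋) = w}) :=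
      ⟨by rw [Measure.restrict_apply_univ]; exact hfin w⟩
    exact Integrable.of_bound (hf.meas_left g).aestronglyMeasurable 1
      (Filter.Eventually.of_forall fun _ => hf.abs_le_one _ _)

lemma sum_avg_le (hf : UnitFamily f) (W : Finset (Fin n → ℤ)) (g : G) {Y : Set (Fin n → ℝ)}
    (hYfin : volume Y ≠ ⊤)
    (hWY : ∀ x : Fin n → ℝ, (fun i => ⌊x i⌋) ∈ W → f x g ≠ 0 → x ∈ Y) :
    ∑ w ∈ W, avg f (intVec w) g ≤ (volume Y).toReal := by
  set Z := toMeasurable volume Y with hZ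
  have hZm : MeasurableSet Z := measurableSet_toMeasurable _ _
  have hZv : volume Z = volume Y := measure_toMeasurable Y
  have hind : Integrable (Z.indicator fun _ => (1 : ℝ)) volume :=
    (integrable_indicator_iff hZm).2 (integrableOn_const (by rw [hZv]; exact hYfin))
  rw [hf.sum_avg_eq, ← hZv]
  calc _ ≤ ∫ x in {x : Fin n → ℝ | (fun i => ⌊x i⌋) ∈ W}, Z.indicator (fun _ => (1 : ℝ)) x := by
        refine integral_mono_of_nonneg (Filter.Eventually.of_forall fun x => hf.nonneg x g)
          hind.integrableOn ?_
        have hmeas : MeasurableSet {x : Fin n → ℝ | (fun i => ⌊x i⌋) ∈ W} := by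
          have : Measurable fun x : Fin n → ℝ => fun i => ⌊x i⌋ :=
            measurable_pi_lambda _ fun i => (measurable_pi_apply i).floor
          exact this (W.measurableSet)
        refine (ae_restrict_iff' hmeas).2 (Filter.Eventually.of_forall fun x hx => ?_)
        by_cases h : f x g = 0
        · simp only [h]
          exact Set.indicator_nonneg (fun _ _ => zero_le_one) _
        · rw [Set.indicator_of_mem (subset_toMeasurable _ _ (hWY x hx h))]
          exact hf.le_one x g
    _ ≤ ∫ x, Z.indicator (fun _ => (1 : ℝ)) x :=
        setIntegral_le_integral hind (Filter.Eventually.of_forall fun x =>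
          Set.indicator_nonneg (fun _ _ => zero_le_one) _)
    _ = (volume Z).toReal := by
        rw [integral_indicator_const _ hZm, smul_eq_mul, mul_one]
        rfl

end UnitFamily

end averages

section secondMoment

open Finset

/-- Correlation bounds for a family of functions on a finite measure space, as satisfied by the
indicators of `x g ∈ F₀⁻¹(J)` with `L = |J|`. -/
structure CorrBound {G : Type*} [MeasurableSpace G] (m d : ℕ) (ν : Measure G)
    (f : (Fin (m + 3) → ℝ) → G → ℝ) (L C : ℝ) : Prop where
  unit : UnitFamily f
  one_le : 1 ≤ C
  nonneg : 0 ≤ L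
  mass : ν.real Set.univ ≤ C
  single : ∀ x, x ≠ 0 → ∫ g, f x g ∂ν ≤ C * L / ‖x‖ ^ d
  pair : ∀ x y s i j, 0 < s → s ≤ ‖x‖ → s ≤ ‖y‖ → 0 < absMinor x y i j →
    ∫ g, f x g * f y g ∂ν ≤ C * L ^ 2 / (s ^ (2 * (d - 1)) * absMinor x y i j)
  shift : ∀ x y y' s T Q i j, 0 < s → s ≤ ‖x‖ → s ≤ ‖y'‖ → ‖x‖ ≤ T → ‖y' - y‖ ≤ 1 →
    C * T ≤ Q → 0 < Q → Q ≤ absMinor x y i j →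
    |∫ g, f x g * f y g ∂ν - ∫ g, f x g * f y' g ∂ν|
      ≤ C * (T / Q) * L ^ 2 / (s ^ (2 * (d - 1)) * Q)
  slab : ∀ g P₀ ε s, 0 < ε → 0 < s →
    volume {y | ‖y - P₀‖ ≤ ε ∧ s ≤ ‖y‖ ∧ f y g ≠ 0}
      ≤ ENNReal.ofReal (C * ε ^ (m + 2) * L / s ^ (d - 1))

namespace CorrBound

variable {G : Type*} [MeasurableSpace G] {m d : ℕ} {ν : Measure G}
  {f : (Fin (m + 3) → ℝ) → G → ℝ} {L C : ℝ}

lemma pos (hf : CorrBound m d ν f L C) : 0 < C := zero_lt_one.trans_le hf.one_le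

lemma integral_le (hf : CorrBound m d ν f L C) {s : ℝ} (hs : 0 < s) {x : Fin (m + 3) → ℝ}
    (hx : s ≤ ‖x‖) :
    ∫ g, f x g ∂ν ≤ C * L / s ^ d := by
  have hx0 : x ≠ 0 := norm_pos_iff.1 (hs.trans_le hx)
  refine (hf.single x hx0).trans ?_
  have := mul_nonneg hf.pos.le hf.nonneg
  gcongr

lemma integral_avg_le [IsFiniteMeasure ν] (hf : CorrBound m d ν f L C) {B : ℝ} (v : Fin (m + 3) → ℝ)
    (h : ∀ ξ ∈ unitCube (m + 3), ∫ g, f (v + ξ) g ∂ν ≤ B) : ∫ g, avg f v g ∂ν ≤ B := by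
  have h1 := hf.unit.integral_mul_avg (ν := ν) (Φ := fun _ => 1) measurable_const (K := 1)
    (by simp) v
  simp only [one_mul] at h1
  rw [h1]
  have hi := (hf.unit.integrable_prod (ν := ν) (Φ := fun _ => 1) measurable_const (K := 1)
    (by simp) v).integral_prod_right
  simp only [one_mul] at hi
  have := setIntegral_mono_on hi (integrable_const (μ := volume.restrict (unitCube (m + 3))) B)
    (measurableSet_unitCube _) h
  simpa [Measure.real, volume_unitCube] using this

/-- Averages of `f` over lattice cubes close to a line. -/
lemma sum_avg_near_le (hf : CorrBound m d ν f L C) {s T Q : ℝ} (hs : 1 ≤ s) (hTQ : 2 * T ≤ Q)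
    (hQ : 4 * Q ≤ s * T)
    (hT : 0 < T) (S : Finset (Fin (m + 3) → ℤ))
    (hS : ∀ w ∈ S, s + 1 ≤ ‖intVec w‖ ∧ ‖intVec w‖ ≤ T - 1) (v : Fin (m + 3) → ℤ) (hv : v ∈ S)
    (hSv : ∀ w ∈ S, ∀ i j, ((minorZ (v, w) i j).natAbs : ℝ) ≤ 2 * Q) (g : G) :
    ∑ w ∈ S, avg f (intVec w) g
      ≤ 7 * 8 ^ (m + 2) * C * (T * (Q / s) ^ (m + 1) * L / s ^ (d - 1)) := by
  obtain ⟨hv1, hv2⟩ := hS v hv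
  have hs0 : 0 < s := by linarith
  have hQ0 : 0 < Q := by linarith
  set ρ := 4 * Q / s with hρ
  have hρ0 : 0 < ρ := by positivity
  have hρT : ρ ≤ T := by rw [hρ, div_le_iff₀ hs0]; linarith
  obtain ⟨i, hi⟩ := exists_abs_eq_norm (intVec v)
  set a := intVec v i with ha
  have ha0 : 0 < |a| := by rw [hi]; linarith
  have ha0' : a ≠ 0 := abs_pos.1 ha0
  set K := ⌈T / ρ⌉₊ + 1 with hK
  set P : ℤ → Fin (m + 3) → ℝ := fun k => (k * ρ / a) • intVec v with hP
  set Y : ℤ → Set (Fin (m + 3) → ℝ) := fun k =>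
    {y | ‖y - P k‖ ≤ 2 * ρ ∧ s ≤ ‖y‖ ∧ f y g ≠ 0} with hY
  set E := C * (2 * ρ) ^ (m + 2) * L / s ^ (d - 1) with hE
  have hE0 : 0 ≤ E := by
    have := hf.pos.le
    have := hf.nonneg
    positivity
  have hvol : volume (⋃ k ∈ Icc (-(K : ℤ)) K, Y k) ≤ ENNReal.ofReal ((2 * K + 1) * E) := by
    refine (measure_biUnion_finset_le _ _).trans ?_
    calc _ ≤ ∑ _k ∈ Icc (-(K : ℤ)) K, ENNReal.ofReal E :=
          sum_le_sum fun k _ => hf.slab g (P k) (2 * ρ) s (by linarith) hs0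
      _ = _ := by
          rw [sum_const, card_Icc_neg, nsmul_eq_mul, ENNReal.ofReal_mul (by positivity)]
          congr 1
          rw [show (2 * (K : ℝ) + 1) = ((2 * K + 1 : ℕ) : ℝ) by push_cast; ring,
            ENNReal.ofReal_natCast]
  have hmain := hf.unit.sum_avg_le S g (Y := ⋃ k ∈ Icc (-(K : ℤ)) K, Y k)
    (ne_top_of_le_ne_top ENNReal.ofReal_ne_top hvol) ?_
  · refine hmain.trans ((ENNReal.toReal_le_of_le_ofReal (by positivity) hvol).trans ?_)
    have hKle : (2 * (K : ℝ) + 1) ≤ 7 * (T / ρ) := by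
      have h1 : 1 ≤ T / ρ := (one_le_div hρ0).2 hρT
      have h2 := (Nat.ceil_lt_add_one (show 0 ≤ T / ρ by positivity)).le
      rw [hK]; push_cast; linarith
    calc _ ≤ 7 * (T / ρ) * E := mul_le_mul_of_nonneg_right hKle hE0
      _ = 7 * 2 ^ (m + 2) * C * (T * ρ ^ (m + 1) * L / s ^ (d - 1)) := by
          rw [hE, mul_pow, pow_succ ρ (m + 1)]; field_simp
      _ ≤ _ := by
          have h1 : ρ ^ (m + 1) = 4 ^ (m + 1) * (Q / s) ^ (m + 1) := by
            rw [← mul_pow]; congr 1; rw [hρ]; ring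
          have h2 : (8 : ℝ) ^ (m + 2) = 2 ^ (m + 2) * (4 ^ (m + 1) * 4) := by
            rw [← pow_succ, ← mul_pow]; norm_num
          rw [h1, h2]
          have := hf.pos.le
          have := hf.nonneg
          have h3 : 0 ≤ 7 * 2 ^ (m + 2) * C * (T * (4 ^ (m + 1) * (Q / s) ^ (m + 1)) * L
            / s ^ (d - 1)) := by positivity
          calc _ ≤ 4 * (7 * 2 ^ (m + 2) * C * (T * (4 ^ (m + 1) * (Q / s) ^ (m + 1)) * L
            / s ^ (d - 1))) := by linarith
            _ = _ := by ring
  · intro x hx hfx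
    obtain ⟨hw1, hw2⟩ := hS _ hx
    set w : Fin (m + 3) → ℤ := fun i => ⌊x i⌋ with hw
    have hξ : ∀ j, 0 ≤ x j - w j ∧ x j - w j ≤ 1 := fun j =>
      ⟨by linarith [Int.floor_le (x j)], by linarith [Int.lt_floor_add_one (x j)]⟩
    have hxw : ‖x - intVec w‖ ≤ 1 := by
      refine (pi_norm_le_iff_of_nonneg zero_le_one).2 fun j => ?_
      rw [Real.norm_eq_abs, abs_le]
      have := hξ j
      simp only [Pi.sub_apply, intVec]
      constructor <;> linarith
    have hxs : s ≤ ‖x‖ := by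
      have := norm_sub_norm_le (intVec w) x
      rw [norm_sub_rev] at this
      linarith
    have hxT : ‖x‖ ≤ T := by
      have := norm_sub_norm_le x (intVec w)
      linarith
    have hmin : ∀ j, |a * x j - intVec v j * x i| ≤ 4 * Q := by
      intro j
      have h1 : |a * intVec w j - intVec v j * intVec w i| ≤ 2 * Q := by
        have := hSv w hx i j
        rwa [← absMinor_intVec, absMinor] at this
      have h2 : |a| ≤ T := by rw [hi]; linarith
      have h3 : |intVec v j| ≤ T := by
        have := norm_le_pi_norm (intVec v) j
        rw [Real.norm_eq_abs] at this; linarith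
      have h4 : |x j - intVec w j| ≤ 1 := by
        rw [abs_le]; have := hξ j; simp only [intVec]; constructor <;> linarith
      have h5 : |x i - intVec w i| ≤ 1 := by
        rw [abs_le]; have := hξ i; simp only [intVec]; constructor <;> linarith
      have h6 : a * x j - intVec v j * x i = (a * intVec w j - intVec v j * intVec w i)
        + (a * (x j - intVec w j) - intVec v j * (x i - intVec w i)) := by ring
      rw [h6]
      have h7 : |a * (x j - intVec w j)| ≤ T * 1 := by
        rw [abs_mul]; exact mul_le_mul h2 h4 (abs_nonneg _) hT.le
      have h8 : |intVec v j * (x i - intVec w i)| ≤ T * 1 := by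
        rw [abs_mul]; exact mul_le_mul h3 h5 (abs_nonneg _) hT.le
      have h9 := abs_add_le (a * intVec w j - intVec v j * intVec w i)
        (a * (x j - intVec w j) - intVec v j * (x i - intVec w i))
      have h10 := abs_sub (a * (x j - intVec w j)) (intVec v j * (x i - intVec w i))
      linarith
    refine Set.mem_biUnion (x := ⌊x i / ρ⌋) ?_ ⟨?_, hxs, hfx⟩
    · have hxi : |x i / ρ| ≤ T / ρ := by
        rw [abs_div, abs_of_pos hρ0]
        have := norm_le_pi_norm x i
        rw [Real.norm_eq_abs] at this
        gcongr
        linarith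
      have h1 := abs_le.1 hxi
      have h2 := Nat.le_ceil (T / ρ)
      have h3 := Int.floor_le (x i / ρ)
      have h4 := Int.lt_floor_add_one (x i / ρ)
      refine mem_coe.2 (mem_Icc.2 ⟨?_, ?_⟩)
      · have : (-(K : ℝ)) ≤ ⌊x i / ρ⌋ := by rw [hK]; push_cast; linarith
        exact_mod_cast this
      · have : (⌊x i / ρ⌋ : ℝ) ≤ K := by rw [hK]; push_cast; linarith
        exact_mod_cast this
    · refine (pi_norm_le_iff_of_nonneg (by linarith)).2 fun j => ?_
      set k := ⌊x i / ρ⌋ with hk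
      have h3 := Int.floor_le (x i / ρ)
      have h4 := Int.lt_floor_add_one (x i / ρ)
      have h5 : |x i - k * ρ| ≤ ρ := by
        rw [le_div_iff₀ hρ0] at h3
        rw [div_lt_iff₀ hρ0] at h4
        rw [abs_le]; constructor <;> linarith
      have h6 : (x - P k) j = (a * x j - intVec v j * x i) / a
          + (x i - k * ρ) * (intVec v j / a) := by
        simp only [hP, Pi.sub_apply, Pi.smul_apply, smul_eq_mul]
        field_simp
        ring
      rw [Real.norm_eq_abs, h6]
      refine (abs_add_le _ _).trans ?_
      have h7 : |(a * x j - intVec v j * x i) / a| ≤ ρ := by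
        rw [abs_div, hρ]
        have := hmin j
        have : s ≤ |a| := by rw [hi]; linarith
        gcongr
      have h8 : |(x i - k * ρ) * (intVec v j / a)| ≤ ρ * 1 := by
        rw [abs_mul]
        refine mul_le_mul h5 ?_ (abs_nonneg _) hρ0.le
        rw [abs_div, div_le_one ha0, hi, ← Real.norm_eq_abs]
        exact norm_le_pi_norm _ j
      linarith

end CorrBound

end secondMoment

section secondMoment

open Finset

namespace CorrBound

variable {G : Type*} [MeasurableSpace G] {m d : ℕ} {ν : Measure G} [IsFiniteMeasure ν]
  {f : (Fin (m + 3) → ℝ) → G → ℝ} {L C : ℝ}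

lemma abs_integral_dev_mul_le_of_far (hf : CorrBound m d ν f L C) {s T Q : ℝ} (hs : 0 < s)
    (hCQ : C * T ≤ Q)
    (hTQ : 2 * T ≤ Q) {v w : Fin (m + 3) → ℝ} (hv : s + 1 ≤ ‖v‖ ∧ ‖v‖ ≤ T - 1)
    (hw : s + 1 ≤ ‖w‖ ∧ ‖w‖ ≤ T - 1) {i j : Fin (m + 3)} (hij : 2 * Q ≤ absMinor v w i j) :
    |∫ g, dev f v g * dev f w g ∂ν|
      ≤ 2 * (C * (T / Q) * L ^ 2 / (s ^ (2 * (d - 1)) * Q)) := by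
  have hT : 0 < T := by linarith [hv.1, hv.2]
  have hQ : 0 < Q := by linarith
  refine hf.unit.abs_integral_dev_mul_dev_le v w fun η hη ξ hξ => ?_
  have hη1 := norm_le_one_of_mem_unitCube hη
  have hξ1 := norm_le_one_of_mem_unitCube hξ
  have h1 : s ≤ ‖v + η‖ := by
    have := norm_sub_le (v + η) η
    rw [add_sub_cancel_right] at this
    linarith [hv.1]
  have h2 : s ≤ ‖w + ξ‖ := by
    have := norm_sub_le (w + ξ) ξ
    rw [add_sub_cancel_right] at this
    linarith [hw.1]
  have h3 : ‖v + η‖ ≤ T := by linarith [norm_add_le v η, hv.2]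
  refine hf.shift (v + η) w (w + ξ) s T Q i j hs h1 h2 h3 ?_ hCQ hQ ?_
  · rwa [add_sub_cancel_left]
  · have hb : ∀ k l, |η k * w l| ≤ T := by
      intro k l
      rw [abs_mul]
      have a1 := norm_le_pi_norm η k
      have a2 := norm_le_pi_norm w l
      rw [Real.norm_eq_abs] at a1 a2
      calc _ ≤ 1 * T := mul_le_mul (by linarith) (by linarith [hw.2]) (abs_nonneg _) zero_le_one
        _ = T := one_mul T
    have e : v i * w j - v j * w i = ((v + η) i * w j - (v + η) j * w i)
        - (η i * w j - η j * w i) := by simp only [Pi.add_apply]; ring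
    rw [absMinor] at hij ⊢
    rw [e] at hij
    have a1 := abs_sub ((v + η) i * w j - (v + η) j * w i) (η i * w j - η j * w i)
    have a2 := abs_sub (η i * w j) (η j * w i)
    linarith [hb i j, hb j i]

lemma sum_integral_mul_near_le (hf : CorrBound m d ν f L C) {s T Q : ℕ} (hs : 1 ≤ s)
    (S : Finset (Fin (m + 3) → ℤ))
    (hS : ∀ w ∈ S, s + 1 ≤ supN w ∧ supN w + 1 ≤ T) :
    ∑ p ∈ (S ×ˢ S).filter (fun p => ∀ i j, (minorZ p i j).natAbs ≤ Q),
        ∫ g, f (intVec p.1) g * f (intVec p.2) g ∂ν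
      ≤ 8 * (m + 3) * 3 ^ (m + 2) * (T : ℝ) ^ (m + 3) * (C * L / (s : ℝ) ^ d)
        + (m + 3) ^ 2 * (C * L ^ 2 / (s : ℝ) ^ (2 * (d - 1)) * (((2 * T + 1) ^ 2) ^ m *
          (600 * (T ^ 2 * Q * (harm Q * harm T) + T ^ 3 * harm Q)))) := by
  have hs0 : (0 : ℝ) < s := by exact_mod_cast hs
  have hC := hf.pos
  have hL := hf.nonneg
  set A := C * L / (s : ℝ) ^ d with hA
  set A' := C * L ^ 2 / (s : ℝ) ^ (2 * (d - 1)) with hA'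
  have hA0 : 0 ≤ A := by positivity
  have hA'0 : 0 ≤ A' := by positivity
  set Nr := (S ×ˢ S).filter (fun p => ∀ i j, (minorZ p i j).natAbs ≤ Q) with hNr
  have hn : ∀ w ∈ S, (s : ℝ) ≤ ‖intVec w‖ := fun w hw => by
    rw [norm_intVec]; exact_mod_cast (by have := (hS w hw).1; omega : s ≤ supN w)
  have hpt : ∀ p ∈ Nr, ∫ g, f (intVec p.1) g * f (intVec p.2) g ∂ν
      ≤ (if ∀ i j, minorZ p i j = 0 then A else 0) + ∑ i, ∑ j, if i ≠ j ∧ minorZ p i j ≠ 0 then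
        A' * (1 / ((minorZ p i j).natAbs : ℝ)) else 0 := by
    intro p hp
    obtain ⟨hp1, hp2⟩ := mem_product.1 (mem_filter.1 hp).1
    have hnn : ∀ i j, 0 ≤ if i ≠ j ∧ minorZ p i j ≠ 0 then
        A' * (1 / ((minorZ p i j).natAbs : ℝ)) else 0 := fun i j => by
      split_ifs <;> positivity
    split_ifs with h
    · refine le_add_of_le_of_nonneg ?_ (sum_nonneg fun i _ => sum_nonneg fun j _ => hnn i j)
      refine le_trans ?_ (hf.integral_le hs0 (hn _ hp1))
      refine integral_mono (hf.unit.integrable_mul (hf.unit.meas_right _) (hf.unit.abs_le_one _) _)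
        (hf.unit.integrable _) fun g => ?_
      exact mul_le_of_le_one_right (hf.unit.nonneg _ _) (hf.unit.le_one _ _)
    · push Not at h
      obtain ⟨i, j, hij⟩ := h
      have hne : i ≠ j := by rintro rfl; simp [minorZ] at hij
      rw [zero_add]
      refine le_trans ?_ (single_le_sum (f := fun i => ∑ j, if i ≠ j ∧ minorZ p i j ≠ 0 then
        A' * (1 / ((minorZ p i j).natAbs : ℝ)) else 0)
        (fun i _ => sum_nonneg fun j _ => hnn i j) (mem_univ i))
      refine le_trans ?_ (single_le_sum (fun j _ => hnn i j) (mem_univ j))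
      rw [if_pos ⟨hne, hij⟩]
      have hpos : 0 < absMinor (intVec p.1) (intVec p.2) i j := by
        rw [absMinor_intVec]; exact_mod_cast Int.natAbs_pos.2 hij
      refine (hf.pair _ _ s i j hs0 (hn _ hp1) (hn _ hp2) hpos).trans (le_of_eq ?_)
      rw [absMinor_intVec, hA', div_mul_eq_div_mul_one_div]
  refine (sum_le_sum hpt).trans ?_
  rw [sum_add_distrib]
  refine add_le_add ?_ ?_
  · rw [← sum_filter, sum_const, nsmul_eq_mul]
    refine mul_le_mul_of_nonneg_right ?_ hA0
    have := card_parallel_le (n := m + 2) (by omega) T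
    push_cast at this
    refine le_trans ?_ (this.trans (le_of_eq (by ring)))
    norm_cast
    refine card_le_card fun p hp => ?_
    obtain ⟨hp1, hp2⟩ := mem_filter.1 hp
    obtain ⟨hv, hw⟩ := mem_product.1 (mem_filter.1 hp1).1
    have key : ∀ w ∈ S, w ∈ (intBox (m + 2 + 1) T).filter (· ≠ 0) := by
      intro w hw
      have := hS w hw
      refine mem_filter.2 ⟨mem_intBox.2 (by omega), ?_⟩
      rintro rfl
      have : supN (0 : Fin (m + 3) → ℤ) = 0 := supN_eq_zero.2 rfl
      omega
    exact mem_filter.2 ⟨mem_product.2 ⟨key _ hv, key _ hw⟩, hp2⟩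
  · rw [sum_comm]
    simp_rw [sum_comm (s := Nr)]
    set D := A' * ((((2 * (T : ℝ) + 1) ^ 2) ^ m *
          (600 * (T ^ 2 * Q * (harm Q * harm T) + T ^ 3 * harm Q)))) with hD
    have hD0 : 0 ≤ D := by
      have := harm_nonneg Q
      have := harm_nonneg T
      positivity
    have hb : ∀ i j, (∑ p ∈ Nr, if i ≠ j ∧ minorZ p i j ≠ 0 then
        A' * (1 / ((minorZ p i j).natAbs : ℝ)) else 0) ≤ D := by
      intro i j
      by_cases hij : i = j
      · simp [hij, hD0]
      · obtain ⟨k, hk⟩ : ∃ k : Fin (m + 3), k ∉ ({i, j} : Finset (Fin (m + 3))) := by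
          by_contra! h
          have h1 : (univ : Finset (Fin (m + 3))).card ≤ ({i, j} : Finset (Fin (m + 3))).card :=
            card_le_card fun x _ => h x
          have h2 : ({i, j} : Finset (Fin (m + 3))).card ≤ 2 := card_le_two
          rw [card_univ, Fintype.card_fin] at h1
          omega
        simp only [mem_insert, mem_singleton, not_or] at hk
        rw [← sum_filter, ← mul_sum]
        refine mul_le_mul_of_nonneg_left ?_ hA'0
        refine le_trans (sum_le_sum_of_subset_of_nonneg ?_ fun _ _ _ => by positivity)
          (sum_inv_minorZ_le hij (Ne.symm hk.1) (Ne.symm hk.2) T Q)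
        intro p hp
        obtain ⟨hp1, hp2⟩ := mem_filter.1 hp
        obtain ⟨hp3, hp4⟩ := mem_filter.1 hp1
        obtain ⟨hv, hw⟩ := mem_product.1 hp3
        refine mem_filter.2 ⟨mem_product.2 ⟨mem_intBox.2 ?_, mem_intBox.2 ?_⟩, hp2.2, hp4 _ _,
          hp4 _ _⟩
        · have := hS _ hv; omega
        · have := hS _ hw; omega
    calc _ ≤ ∑ _i : Fin (m + 3), ∑ _j : Fin (m + 3), D :=
          sum_le_sum fun i _ => sum_le_sum fun j _ => hb i j
      _ = _ := by
          simp only [sum_const, card_univ, Fintype.card_fin, nsmul_eq_mul]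
          push_cast
          ring

/-- The second moment of the deviation over a family of large integer vectors. -/
theorem integral_sq_sum_dev_le (hf : CorrBound m d ν f L C) {s T Q : ℕ} (hs : 1 ≤ s)
    (hCQ : C * T ≤ Q) (hTQ : 2 * T ≤ Q)
    (hQ : 4 * Q ≤ s * T) (hT : 0 < T) (S : Finset (Fin (m + 3) → ℤ))
    (hS : ∀ w ∈ S, s + 1 ≤ supN w ∧ supN w + 1 ≤ T) :
    ∫ g, (∑ v ∈ S, dev f (intVec v) g) ^ 2 ∂ν
      ≤ (2 * T + 1) ^ (2 * (m + 3)) *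
          (2 * (C * (T / Q) * L ^ 2 / ((s : ℝ) ^ (2 * (d - 1)) * Q)))
        + (8 * (m + 3) * 3 ^ (m + 2) * (T : ℝ) ^ (m + 3) * (C * L / (s : ℝ) ^ d)
        + (m + 3) ^ 2 * (C * L ^ 2 / (s : ℝ) ^ (2 * (d - 1)) * (((2 * T + 1) ^ 2) ^ m *
          (600 * (T ^ 2 * (2 * Q : ℕ) * (harm (2 * Q) * harm T) + T ^ 3 * harm (2 * Q))))))
        + 7 * 8 ^ (m + 2) * C * (T * ((Q : ℝ) / s) ^ (m + 1) * L / (s : ℝ) ^ (d - 1)) *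
          (3 * ((2 * T + 1) ^ (m + 3) * (C * L / (s : ℝ) ^ d))) := by
  have hs0 : (0 : ℝ) < s := by exact_mod_cast hs
  have hs1 : (1 : ℝ) ≤ s := by exact_mod_cast hs
  have hT0 : (0 : ℝ) < T := by exact_mod_cast hT
  have hTQ' : 2 * (T : ℝ) ≤ Q := by exact_mod_cast hTQ
  have hQ' : 4 * (Q : ℝ) ≤ s * T := by exact_mod_cast hQ
  have hC := hf.pos
  have hL := hf.nonneg
  have hnorm : ∀ w ∈ S, (s : ℝ) + 1 ≤ ‖intVec w‖ ∧ ‖intVec w‖ ≤ (T : ℝ) - 1 := by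
    intro w hw
    obtain ⟨h1, h2⟩ := hS w hw
    rw [norm_intVec]
    have h1' : (s : ℝ) + 1 ≤ supN w := by exact_mod_cast h1
    have h2' : (supN w : ℝ) + 1 ≤ T := by exact_mod_cast h2
    exact ⟨h1', by linarith⟩
  set P : (Fin (m + 3) → ℤ) × (Fin (m + 3) → ℤ) → Prop := fun p =>
    ∀ i j, (minorZ p i j).natAbs ≤ 2 * Q with hP
  have hdec : DecidablePred P := fun p => inferInstanceAs (Decidable (∀ i j, _))
  set D : (Fin (m + 3) → ℤ) → G → ℝ := fun v => dev f (intVec v) with hD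
  have hDD : ∀ v w, Integrable (fun g => D v g * D w g) ν := fun v w =>
    Integrable.of_bound ((hf.unit.measurable_dev _).mul
      (hf.unit.measurable_dev _)).aestronglyMeasurable 1 (Filter.Eventually.of_forall fun g => by
        rw [Real.norm_eq_abs, abs_mul]
        exact mul_le_one₀ (hf.unit.abs_dev_le _ _) (abs_nonneg _) (hf.unit.abs_dev_le _ _))
  have hexp : ∫ g, (∑ v ∈ S, D v g) ^ 2 ∂ν = ∑ p ∈ S ×ˢ S, ∫ g, D p.1 g * D p.2 g ∂ν := by
    rw [← integral_finsetSum _ fun p _ => hDD p.1 p.2]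
    refine integral_congr_ae (Filter.Eventually.of_forall fun g => ?_)
    simp only [sq, sum_mul_sum, sum_product]
  have hcard : ((S.card : ℕ) : ℝ) ≤ (2 * T + 1) ^ (m + 3) := by
    have h : S ⊆ intBox (m + 3) T := fun w hw => mem_intBox.2 (by have := hS w hw; omega)
    have := card_le_card h
    rw [card_intBox] at this
    exact_mod_cast this
  change ∫ g, (∑ v ∈ S, D v g) ^ 2 ∂ν ≤ _
  rw [hexp, ← sum_filter_not_add_sum_filter (S ×ˢ S) P, add_assoc]
  refine add_le_add ?_ ?_
  · set F := 2 * (C * ((T : ℝ) / Q) * L ^ 2 / ((s : ℝ) ^ (2 * (d - 1)) * Q)) with hF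
    have hF0 : 0 ≤ F := by positivity
    calc _ ≤ ∑ _p ∈ (S ×ˢ S).filter (fun p => ¬ P p), F := by
          refine sum_le_sum fun p hp => (le_abs_self _).trans ?_
          obtain ⟨hp1, hp2⟩ := mem_filter.1 hp
          obtain ⟨hv, hw⟩ := mem_product.1 hp1
          simp only [hP] at hp2
          push Not at hp2
          obtain ⟨i, j, hij⟩ := hp2
          refine hf.abs_integral_dev_mul_le_of_far hs0 hCQ hTQ' (hnorm _ hv) (hnorm _ hw)
            (i := i) (j := j) ?_
          rw [absMinor_intVec]
          exact_mod_cast hij.le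
      _ ≤ _ := by
          rw [sum_const, nsmul_eq_mul]
          refine mul_le_mul_of_nonneg_right ?_ hF0
          calc _ ≤ (((S ×ˢ S).card : ℕ) : ℝ) := by exact_mod_cast card_filter_le _ _
            _ = (S.card : ℝ) * S.card := by rw [card_product]; push_cast; ring
            _ ≤ (2 * T + 1) ^ (m + 3) * (2 * T + 1) ^ (m + 3) := by gcongr
            _ = _ := by rw [← pow_add]; congr 1; ring
  · set a : (Fin (m + 3) → ℤ) → G → ℝ := fun v => f (intVec v) with ha
    set b : (Fin (m + 3) → ℤ) → G → ℝ := fun v => avg f (intVec v) with hb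
    have ha0 : ∀ v g, 0 ≤ a v g := fun v g => hf.unit.nonneg _ _
    have hb0 : ∀ v g, 0 ≤ b v g := fun v g => hf.unit.avg_nonneg _ _
    have hai : ∀ v, Integrable (a v) ν := fun v => hf.unit.integrable _
    have hbi : ∀ v, Integrable (b v) ν := fun v => hf.unit.integrable_avg _
    have haa : ∀ v w, Integrable (fun g => a v g * a w g) ν := fun v w =>
      hf.unit.integrable_mul (hf.unit.meas_right _) (hf.unit.abs_le_one _) _
    set W := 7 * 8 ^ (m + 2) * C * (T * ((Q : ℝ) / s) ^ (m + 1) * L / (s : ℝ) ^ (d - 1)) with hW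
    have hW0 : 0 ≤ W := by positivity
    set Nr := (S ×ˢ S).filter P with hNr
    have hnear : ∀ v ∈ S, ∀ g, ∑ w ∈ S.filter (fun w => P (v, w)), b w g ≤ W := by
      intro v hv g
      have hvv : v ∈ S.filter (fun w => P (v, w)) := by
        refine mem_filter.2 ⟨hv, fun i j => ?_⟩
        simp [minorZ, mul_comm]
      refine hf.sum_avg_near_le hs1 hTQ' hQ' hT0 _
        (fun w hw => hnorm w (mem_filter.1 hw).1) v hvv (fun w hw i j => ?_) g
      exact_mod_cast (mem_filter.1 hw).2 i j
    have hsum : ∀ (c : (Fin (m + 3) → ℤ) → ℝ) (e : (Fin (m + 3) → ℤ) → ℝ),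
        ∑ p ∈ Nr, c p.1 * e p.2 = ∑ v ∈ S, c v * ∑ w ∈ S.filter (fun w => P (v, w)), e w := by
      intro c e
      rw [hNr, sum_filter, sum_product]
      refine sum_congr rfl fun v _ => ?_
      rw [mul_sum, sum_filter]
    have hsymm : ∀ (c : (Fin (m + 3) → ℤ) → ℝ) (e : (Fin (m + 3) → ℤ) → ℝ),
        ∑ p ∈ Nr, c p.1 * e p.2 = ∑ p ∈ Nr, e p.1 * c p.2 := by
      intro c e
      refine sum_nbij' Prod.swap Prod.swap ?_ ?_ (fun _ _ => rfl) (fun _ _ => rfl)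
        fun p _ => mul_comm _ _
      all_goals
        intro p hp
        obtain ⟨hp1, hp2⟩ := mem_filter.1 hp
        obtain ⟨hv, hw⟩ := mem_product.1 hp1
        refine mem_filter.2 ⟨mem_product.2 ⟨hw, hv⟩, fun i j => ?_⟩
        have : minorZ p.swap i j = - minorZ p i j := by simp only [minorZ, Prod.swap]; ring
        rw [this, Int.natAbs_neg]
        exact hp2 i j
    have hpt : ∀ g, ∑ p ∈ Nr, D p.1 g * D p.2 g
        ≤ ∑ p ∈ Nr, a p.1 g * a p.2 g + W * ∑ v ∈ S, (2 * a v g + b v g) := by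
      intro g
      calc _ ≤ ∑ p ∈ Nr, (a p.1 g + b p.1 g) * (a p.2 g + b p.2 g) := by
            refine sum_le_sum fun p _ => (le_abs_self _).trans ?_
            rw [abs_mul]
            exact mul_le_mul (hf.unit.abs_dev_le_add _ _) (hf.unit.abs_dev_le_add _ _)
              (abs_nonneg _) (add_nonneg (ha0 _ _) (hb0 _ _))
        _ = ∑ p ∈ Nr, a p.1 g * a p.2 g + (∑ p ∈ Nr, a p.1 g * b p.2 g
              + ∑ p ∈ Nr, b p.1 g * a p.2 g + ∑ p ∈ Nr, b p.1 g * b p.2 g) := by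
            simp only [← sum_add_distrib]
            exact sum_congr rfl fun p _ => by ring
        _ = ∑ p ∈ Nr, a p.1 g * a p.2 g + ∑ p ∈ Nr, (2 * a p.1 g + b p.1 g) * b p.2 g := by
            rw [hsymm (fun v => b v g) (fun v => a v g)]
            simp only [← sum_add_distrib]
            refine sum_congr rfl fun p _ => ?_
            ring
        _ ≤ _ := by
            refine add_le_add le_rfl ?_
            rw [hsum (fun v => 2 * a v g + b v g) (fun v => b v g), mul_sum]
            refine sum_le_sum fun v hv => ?_
            rw [mul_comm W]
            refine mul_le_mul_of_nonneg_left (hnear v hv g) ?_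
            linarith [ha0 v g, hb0 v g]
    have hint3 : ∀ v, Integrable (fun g => 2 * a v g + b v g) ν := fun v =>
      ((hai v).const_mul 2).add (hbi v)
    have hint2 : Integrable (fun g => ∑ v ∈ S, (2 * a v g + b v g)) ν :=
      integrable_finsetSum _ fun v _ => hint3 v
    have hint1 : Integrable (fun g => ∑ p ∈ Nr, a p.1 g * a p.2 g) ν :=
      integrable_finsetSum _ fun p _ => haa _ _
    rw [← integral_finsetSum _ fun p _ => hDD p.1 p.2]
    refine (integral_mono (integrable_finsetSum _ fun p _ => hDD p.1 p.2)
      (hint1.add (hint2.const_mul W)) hpt).trans ?_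
    have hsplit : ∫ g, ((fun g => ∑ p ∈ Nr, a p.1 g * a p.2 g)
        + fun g => W * ∑ v ∈ S, (2 * a v g + b v g)) g ∂ν
        = ∑ p ∈ Nr, ∫ g, a p.1 g * a p.2 g ∂ν + W * ∫ g, ∑ v ∈ S, (2 * a v g + b v g) ∂ν := by
      rw [integral_add' hint1 (hint2.const_mul W), integral_finsetSum _ fun p _ => haa _ _,
        integral_const_mul]
    refine hsplit.le.trans (add_le_add ?_ (mul_le_mul_of_nonneg_left ?_ hW0))
    · refine le_trans (le_of_eq ?_) (hf.sum_integral_mul_near_le (Q := 2 * Q) hs S hS)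
      exact sum_congr (by rw [hNr]; congr!) fun _ _ => rfl
    · rw [integral_finsetSum _ fun v _ => hint3 v]
      have hA0 : 0 ≤ C * L / (s : ℝ) ^ d := by positivity
      calc _ ≤ ∑ _v ∈ S, 3 * (C * L / (s : ℝ) ^ d) := by
            refine sum_le_sum fun v hv => ?_
            rw [integral_add ((hai v).const_mul 2) (hbi v), integral_const_mul]
            have h1 : ∫ g, a v g ∂ν ≤ C * L / (s : ℝ) ^ d :=
              hf.integral_le hs0 (by linarith [(hnorm v hv).1])
            have h2 : ∫ g, b v g ∂ν ≤ C * L / (s : ℝ) ^ d := by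
              refine hf.integral_avg_le _ fun ξ hξ => hf.integral_le hs0 ?_
              have := norm_sub_le (intVec v + ξ) ξ
              rw [add_sub_cancel_right] at this
              linarith [norm_le_one_of_mem_unitCube hξ, (hnorm v hv).1]
            linarith
        _ ≤ _ := by
            rw [sum_const, nsmul_eq_mul]
            calc _ ≤ (2 * (T : ℝ) + 1) ^ (m + 3) * (3 * (C * L / (s : ℝ) ^ d)) := by gcongr
              _ = _ := by ring

end CorrBound

end secondMoment

section meanBounds

open Finset

lemma pow_div_pow_le {x : ℝ} (hx : 1 ≤ x) {a b c e : ℕ} (h : a + e ≤ b + c) :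
    x ^ a / x ^ b ≤ x ^ c / x ^ e := by
  have hx0 : 0 < x := zero_lt_one.trans_le hx
  rw [div_le_div_iff₀ (by positivity) (by positivity), ← pow_add, ← pow_add]
  exact pow_le_pow_right₀ hx (by omega)

lemma harm_two_mul_pow_le {τ k B : ℕ} (hτ : 1 ≤ τ) (hk : k ≤ B) :
    harm (2 * τ ^ k) ≤ (2 + B) * τ := by
  have hτ1 : (1 : ℝ) ≤ τ := by exact_mod_cast hτ
  refine (harm_le _).trans ?_
  have h1 : Real.log ((2 * τ ^ k : ℕ) : ℝ) = Real.log 2 + k * Real.log τ := by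
    push_cast
    rw [Real.log_mul (by norm_num) (by positivity), Real.log_pow]
  have h2 := Real.log_two_lt_d9
  have h3 : Real.log τ ≤ τ := (Real.log_le_sub_one_of_pos (by linarith)).trans (by linarith)
  have h4 : (k : ℝ) * Real.log τ ≤ B * τ := by
    have : (k : ℝ) ≤ B := by exact_mod_cast hk
    have := Real.log_nonneg hτ1
    gcongr
  rw [h1]
  linarith

namespace CorrBound

/-- The second moment bound, with all scales powers of a parameter `τ`. -/
lemma exists_integral_sq_sum_dev_le {m e r M : ℕ} (hmr : m + 3 = e + 1 + r) (hM : e + 2 ≤ M)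
    (C : ℝ) (hC : 1 ≤ C) :
    ∃ K : ℝ, 0 < K ∧ ∀ {G : Type*} [MeasurableSpace G] {ν : Measure G} [IsFiniteMeasure ν]
      {f : (Fin (m + 3) → ℝ) → G → ℝ} {L : ℝ}, CorrBound m (e + 1) ν f L C →
      ∀ τ : ℕ, 4 ≤ τ → 2 * C ≤ τ → ∀ S : Finset (Fin (m + 3) → ℤ),
      (∀ w ∈ S, τ ^ (8 * M - 1) + 1 ≤ supN w ∧ supN w ≤ τ ^ (8 * M)) →
      ∫ g, (∑ v ∈ S, dev f (intVec v) g) ^ 2 ∂ν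
        ≤ K * ((L * ((τ : ℝ) ^ (8 * M)) ^ r / τ) ^ 2
          + L * ((τ : ℝ) ^ (8 * M)) ^ r * (τ ^ (m + 3)) ^ 2) := by
  have hC0 : 0 < C := zero_lt_one.trans_le hC
  set k₁ : ℝ := 4 * 5 ^ (2 * (m + 3)) * C with hk₁
  set k₂ : ℝ := 8 * (m + 3) * 3 ^ (m + 2) * 2 ^ (m + 3) * C with hk₂
  set k₃ : ℝ := (m + 3) ^ 2 * C * (5 ^ 2) ^ m * 600 * (12 * (2 + (14 * M : ℕ)) ^ 2) with hk₃
  set k₄ : ℝ := 7 * 8 ^ (m + 2) * C * 2 * 3 * 5 ^ (m + 3) * C with hk₄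
  refine ⟨k₁ + k₂ + k₃ + k₄, by positivity, ?_⟩
  intro G _ ν _ f L hf τ hτ4 hτC S hS
  have hL := hf.nonneg
  set N := 8 * M - 1 with hN
  have hN1 : N + 1 = 8 * M := by omega
  have hx4 : (4 : ℝ) ≤ τ := by exact_mod_cast hτ4
  set x := (τ : ℝ) with hx
  have hx1 : 1 ≤ x := by linarith
  have hx0 : 0 < x := by linarith
  have hpow : ∀ a b : ℕ, a + 1 ≤ b → 4 * τ ^ a ≤ τ ^ b := by
    intro a b hab
    calc 4 * τ ^ a ≤ τ * τ ^ a := Nat.mul_le_mul_right _ hτ4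
      _ = τ ^ (a + 1) := by ring
      _ ≤ τ ^ b := Nat.pow_le_pow_right (by omega) hab
  have hpos : 0 < τ ^ (8 * M) := by positivity
  have h2Q : 2 * (2 * τ ^ (8 * M)) ≤ τ ^ (14 * M) := by
    have := hpow (8 * M) (14 * M) (by omega)
    omega
  refine (hf.integral_sq_sum_dev_le (s := τ ^ N) (T := 2 * τ ^ (8 * M)) (Q := τ ^ (14 * M))
    (Nat.one_le_pow _ _ (by omega)) ?_ h2Q ?_ (by omega) S fun w hw => ?_).trans ?_
  · push_cast
    calc C * (2 * x ^ (8 * M)) = (2 * C) * x ^ (8 * M) := by ring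
      _ ≤ x * x ^ (8 * M) := by gcongr
      _ = x ^ (8 * M + 1) := by ring
      _ ≤ x ^ (14 * M) := pow_le_pow_right₀ hx1 (by omega)
  · have := hpow (14 * M) (N + 8 * M) (by omega)
    calc _ ≤ τ ^ (N + 8 * M) := this
      _ = τ ^ N * τ ^ (8 * M) := pow_add _ _ _
      _ ≤ _ := Nat.mul_le_mul_left _ (by omega)
  · have := hS w hw
    omega
  · have hxM : 1 ≤ x ^ (8 * M) := one_le_pow₀ hx1
    have hT5 : 2 * (2 * x ^ (8 * M)) + 1 ≤ 5 * x ^ (8 * M) := by linarith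
    set Y := L * (x ^ (8 * M)) ^ r with hY
    have hY0 : 0 ≤ Y := by positivity
    have hYL : ∀ a b : ℕ, a + 2 ≤ b + 2 * (8 * M * r) → L ^ 2 * (x ^ a / x ^ b) ≤ (Y / x) ^ 2 := by
      intro a b hab
      calc _ ≤ L ^ 2 * (x ^ (2 * (8 * M * r)) / x ^ 2) := by
            gcongr ?_ * ?_
            exact pow_div_pow_le hx1 hab
        _ = _ := by rw [hY]; ring
    have q1 : M * m + 3 * M = M * e + M + M * r := by
      calc _ = M * (m + 3) := by ring
        _ = _ := by rw [hmr]; ring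
    have q2 : e * N + e = 8 * (M * e) := by
      calc _ = e * (N + 1) := by ring
        _ = _ := by rw [hN1]; ring
    have q3 : m * N + m = 8 * (M * m) := by
      calc _ = m * (N + 1) := by ring
        _ = _ := by rw [hN1]; ring
    have t1 : (2 * (2 * x ^ (8 * M)) + 1) ^ (2 * (m + 3)) *
      (2 * (C * (2 * x ^ (8 * M) / x ^ (14 * M))
        * L ^ 2 / ((x ^ N) ^ (2 * e) * x ^ (14 * M)))) ≤ k₁ * (Y / x) ^ 2 := by
      calc _ ≤ (5 * x ^ (8 * M)) ^ (2 * (m + 3)) * (2 * (C * (2 * x ^ (8 * M) / x ^ (14 * M))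
            * L ^ 2 / ((x ^ N) ^ (2 * e) * x ^ (14 * M)))) := by gcongr
        _ = k₁ * (L ^ 2 * (x ^ (8 * M * (2 * (m + 3)) + 8 * M) / x ^ (28 * M + N * (2 * e)))) := by
            rw [hk₁]; ring
        _ ≤ _ := by
            refine mul_le_mul_of_nonneg_left (hYL _ _ ?_) (by positivity)
            linarith
    have t2 : 8 * (m + 3) * 3 ^ (m + 2) * (2 * x ^ (8 * M)) ^ (m + 3) * (C * L / (x ^ N) ^ (e + 1))
        ≤ k₂ * (Y * (x ^ (m + 3)) ^ 2) := by
      calc _ = k₂ * (L * (x ^ (8 * M * (m + 3)) / x ^ (N * (e + 1)))) := by rw [hk₂]; ring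
        _ ≤ k₂ * (L * (x ^ (8 * M * r + (m + 3) * 2) / x ^ 0)) := by
            gcongr ?_ * (?_ * ?_)
            refine pow_div_pow_le hx1 ?_
            linarith
        _ = _ := by rw [hY]; ring
    have hh1 : harm (2 * τ ^ (14 * M)) ≤ (2 + (14 * M : ℕ)) * x :=
      harm_two_mul_pow_le (by omega) le_rfl
    have hh2 : harm (2 * τ ^ (8 * M)) ≤ (2 + (14 * M : ℕ)) * x :=
      harm_two_mul_pow_le (by omega) (by omega)
    set H : ℝ := 2 + (14 * M : ℕ) with hH
    have hH1 : 1 ≤ H * x := by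
      have : 1 ≤ H := by rw [hH]; linarith [Nat.cast_nonneg (α := ℝ) (14 * M)]
      exact one_le_mul_of_one_le_of_one_le this hx1
    have hH0 : 0 ≤ H := by positivity
    have hn1 := harm_nonneg (2 * τ ^ (14 * M))
    have hn2 := harm_nonneg (2 * τ ^ (8 * M))
    have hTQ : x ^ (8 * M) ≤ x ^ (14 * M) := pow_le_pow_right₀ hx1 (by omega)
    have t3 : ((m : ℝ) + 3) ^ 2 * (C * L ^ 2 / (x ^ N) ^ (2 * e) *
        (((2 * (2 * x ^ (8 * M)) + 1) ^ 2) ^ m *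
          (600 * ((2 * x ^ (8 * M)) ^ 2 * (2 * x ^ (14 * M)) *
        (harm (2 * τ ^ (14 * M)) * harm (2 * τ ^ (8 * M))) + (2 * x ^ (8 * M)) ^ 3 *
        harm (2 * τ ^ (14 * M)))))) ≤ k₃ * (Y / x) ^ 2 := by
      calc _ ≤ ((m : ℝ) + 3) ^ 2 * (C * L ^ 2 / (x ^ N) ^ (2 * e) *
            (((5 * x ^ (8 * M)) ^ 2) ^ m * (600 * ((2 * x ^ (8 * M)) ^ 2 * (2 * x ^ (14 * M)) *
            ((H * x) * (H * x)) + (2 * x ^ (8 * M)) ^ 2 * (x ^ (14 * M)) *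
              ((H * x) * (H * x)))))) := by
            gcongr ?_ * (?_ * (?_ * (600 * (?_ + ?_))))
            · gcongr
            · gcongr
            · calc (2 * x ^ (8 * M)) ^ 3 * harm (2 * τ ^ (14 * M))
                  ≤ (2 * x ^ (8 * M)) ^ 3 * (H * x) := by gcongr
                _ = (2 * x ^ (8 * M)) ^ 2 * (2 * x ^ (8 * M)) * (1 * (H * x)) := by ring
                _ ≤ (2 * x ^ (8 * M)) ^ 2 * (x ^ (14 * M)) * ((H * x) * (H * x)) := by
                  gcongr
                  have : 2 * x ^ (8 * M) ≤ x * x ^ (8 * M) := by gcongr; linarith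
                  refine this.trans ?_
                  rw [← pow_succ']
                  exact pow_le_pow_right₀ hx1 (by omega)
        _ = k₃ * (L ^ 2 * (x ^ (16 * M * m + 16 * M + 14 * M + 2) / x ^ (N * (2 * e)))) := by
            rw [hk₃]; ring
        _ ≤ _ := by
            refine mul_le_mul_of_nonneg_left (hYL _ _ ?_) (by positivity)
            linarith
    have t4 : 7 * 8 ^ (m + 2) * C * (2 * x ^ (8 * M) * (x ^ (14 * M) / x ^ N) ^ (m + 1) * L
        / (x ^ N) ^ e) * (3 * ((2 * (2 * x ^ (8 * M)) + 1) ^ (m + 3) * (C * L / (x ^ N) ^ (e + 1))))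
        ≤ k₄ * (Y / x) ^ 2 := by
      calc _ ≤ 7 * 8 ^ (m + 2) * C * (2 * x ^ (8 * M) * (x ^ (14 * M) / x ^ N) ^ (m + 1) * L
            / (x ^ N) ^ e) * (3 * ((5 * x ^ (8 * M)) ^ (m + 3) * (C * L / (x ^ N) ^ (e + 1)))) := by
            gcongr
        _ = k₄ * (L ^ 2 * (x ^ (8 * M + 14 * M * (m + 1) + 8 * M * (m + 3))
            / x ^ (N * (m + 1) + N * e + N * (e + 1)))) := by rw [hk₄]; ring
        _ ≤ _ := by
            refine mul_le_mul_of_nonneg_left (hYL _ _ ?_) (by positivity)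
            have q4 : m ≤ M * m := Nat.le_mul_of_pos_left _ (by omega)
            linarith
    have n1 : 0 ≤ k₁ * (Y * (x ^ (m + 3)) ^ 2) := by positivity
    have n3 : 0 ≤ k₃ * (Y * (x ^ (m + 3)) ^ 2) := by positivity
    have n4 : 0 ≤ k₄ * (Y * (x ^ (m + 3)) ^ 2) := by positivity
    have n2 : 0 ≤ k₂ * (Y / x) ^ 2 := by positivity
    push_cast
    calc _ ≤ k₁ * (Y / x) ^ 2 + (k₂ * (Y * (x ^ (m + 3)) ^ 2) + k₃ * (Y / x) ^ 2)
          + k₄ * (Y / x) ^ 2 := add_le_add (add_le_add t1 (add_le_add t2 t3)) t4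
      _ ≤ _ := by linarith

end CorrBound

end meanBounds

section euclidean

variable {n : ℕ}

lemma eucNorm_eq_norm (v : Fin n → ℝ) : eucNorm v = ‖WithLp.toLp 2 v‖ := by
  rw [EuclideanSpace.norm_eq, eucNorm]
  simp

lemma eucNorm_nonneg (v : Fin n → ℝ) : 0 ≤ eucNorm v := Real.sqrt_nonneg _

lemma eucNorm_add_le (v w : Fin n → ℝ) : eucNorm (v + w) ≤ eucNorm v + eucNorm w := by
  simp only [eucNorm_eq_norm, WithLp.toLp_add]
  exact norm_add_le _ _

lemma eucNorm_smul (a : ℝ) (v : Fin n → ℝ) : eucNorm (a • v) = |a| * eucNorm v := by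
  simp only [eucNorm_eq_norm, WithLp.toLp_smul, norm_smul, Real.norm_eq_abs]

lemma norm_le_eucNorm (v : Fin n → ℝ) : ‖v‖ ≤ eucNorm v := by
  refine (pi_norm_le_iff_of_nonneg (eucNorm_nonneg v)).2 fun i => ?_
  rw [eucNorm_eq_norm]
  exact PiLp.norm_apply_le (WithLp.toLp 2 v) i

lemma eucNorm_le (v : Fin n → ℝ) : eucNorm v ≤ n * ‖v‖ := by
  have h0 := norm_nonneg v
  rcases Nat.eq_zero_or_pos n with rfl | hn
  · simp [eucNorm]
  have hn1 : (1 : ℝ) ≤ n := by exact_mod_cast hn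
  refine Real.sqrt_le_iff.2 ⟨by positivity, ?_⟩
  calc _ ≤ ∑ _i : Fin n, ‖v‖ ^ 2 := Finset.sum_le_sum fun i _ => by
        rw [← sq_abs, ← Real.norm_eq_abs]
        exact pow_le_pow_left₀ (norm_nonneg _) (norm_le_pi_norm v i) 2
    _ = n * ‖v‖ ^ 2 := by simp
    _ ≤ (n * n) * ‖v‖ ^ 2 := by gcongr; nlinarith
    _ = _ := by ring

lemma continuous_eucNorm : Continuous (eucNorm : (Fin n → ℝ) → ℝ) := by
  unfold eucNorm
  fun_prop

lemma measurable_eucNorm : Measurable (eucNorm : (Fin n → ℝ) → ℝ) := continuous_eucNorm.measurable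

lemma measurableSet_eucNorm_le (t : ℝ) : MeasurableSet {x : Fin n → ℝ | eucNorm x ≤ t} :=
  measurable_eucNorm measurableSet_Iic

lemma measurableSet_shell (a b : ℝ) :
    MeasurableSet {x : Fin n → ℝ | a < eucNorm x ∧ eucNorm x ≤ b} :=
  measurable_eucNorm measurableSet_Ioc

lemma volume_eucNorm_le_lt_top (t : ℝ) : volume {x : Fin n → ℝ | eucNorm x ≤ t} < ⊤ := by
  refine (measure_mono fun x hx => ?_).trans_lt (measure_closedBall_lt_top (x := 0) (r := t))
  rw [mem_closedBall_zero_iff]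
  exact (norm_le_eucNorm x).trans hx

/-- The volume of the Euclidean unit ball. -/
def unitBallVol (n : ℕ) : ℝ := (volume {x : Fin n → ℝ | eucNorm x ≤ 1}).toReal

lemma unitBallVol_nonneg (n : ℕ) : 0 ≤ unitBallVol n := ENNReal.toReal_nonneg

open scoped Pointwise in
lemma volume_eucNorm_le {t : ℝ} (ht : 0 < t) :
    volume {x : Fin n → ℝ | eucNorm x ≤ t} = ENNReal.ofReal (t ^ n * unitBallVol n) := by
  have h : {x : Fin n → ℝ | eucNorm x ≤ t} = t • {x : Fin n → ℝ | eucNorm x ≤ 1} := by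
    ext x
    rw [Set.mem_smul_set_iff_inv_smul_mem₀ ht.ne']
    change eucNorm x ≤ t ↔ eucNorm (t⁻¹ • x) ≤ 1
    rw [eucNorm_smul, abs_of_pos (by positivity), inv_mul_le_iff₀ ht, mul_one]
  rw [h, Measure.addHaar_smul_of_nonneg _ ht.le, Module.finrank_fin_fun,
    ENNReal.ofReal_mul (by positivity), unitBallVol,
    ENNReal.ofReal_toReal (volume_eucNorm_le_lt_top 1).ne]

lemma volume_shell_le {a b : ℝ} (ha : 0 < a) (hab : a ≤ b) :
    volume {x : Fin n → ℝ | a < eucNorm x ∧ eucNorm x ≤ b}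
      = ENNReal.ofReal ((b ^ n - a ^ n) * unitBallVol n) := by
  have h : {x : Fin n → ℝ | a < eucNorm x ∧ eucNorm x ≤ b}
      = {x | eucNorm x ≤ b} \ {x | eucNorm x ≤ a} := by
    ext x
    exact ⟨fun h => ⟨h.2, not_le.2 h.1⟩, fun h => ⟨not_le.1 h.2, h.1⟩⟩
  have hsub : {x : Fin n → ℝ | eucNorm x ≤ a} ⊆ {x | eucNorm x ≤ b} :=
    fun x (hx : eucNorm x ≤ a) => hx.trans hab
  rw [h, measure_sdiff hsub
    (measurableSet_eucNorm_le a).nullMeasurableSet (volume_eucNorm_le_lt_top a).ne,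
    volume_eucNorm_le ha, volume_eucNorm_le (ha.trans_le hab), ← ENNReal.ofReal_sub]
  · congr 1; ring
  · have := unitBallVol_nonneg n; positivity

end euclidean

section mass

variable {n : ℕ} {G : Type*} [MeasurableSpace G]

/-- The integral of `f · g` over `A`. -/
def massOn (f : (Fin n → ℝ) → G → ℝ) (A : Set (Fin n → ℝ)) (g : G) : ℝ := ∫ x in A, f x g

open Classical in
/-- The integer points in a Euclidean ball. -/
def ballPts (n : ℕ) (t : ℝ) : Finset (Fin n → ℤ) :=
  (intBox n ⌊t⌋₊).filter fun v => eucNorm (intVec v) ≤ t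

lemma supN_le_eucNorm (v : Fin n → ℤ) : (supN v : ℝ) ≤ eucNorm (intVec v) := by
  rw [← norm_intVec]; exact norm_le_eucNorm _

lemma mem_ballPts {t : ℝ} {v : Fin n → ℤ} : v ∈ ballPts n t ↔ eucNorm (intVec v) ≤ t := by
  rw [ballPts, Finset.mem_filter, mem_intBox]
  exact ⟨fun h => h.2, fun h => ⟨Nat.le_floor ((supN_le_eucNorm v).trans h), h⟩⟩

/-- The sum of `f · g` over the integer points in a Euclidean ball. -/
def ballCount (f : (Fin n → ℝ) → G → ℝ) (t : ℝ) (g : G) : ℝ :=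
  ∑ v ∈ ballPts n t, f (intVec v) g

namespace UnitFamily

variable {f : (Fin n → ℝ) → G → ℝ}

lemma integrableOn (hf : UnitFamily f) {A : Set (Fin n → ℝ)} (hA : volume A < ⊤) (g : G) :
    IntegrableOn (fun x => f x g) A := by
  have : IsFiniteMeasure (volume.restrict A) := ⟨by rwa [Measure.restrict_apply_univ]⟩
  exact Integrable.of_bound (hf.meas_left g).aestronglyMeasurable 1
    (Filter.Eventually.of_forall fun _ => hf.abs_le_one _ _)

lemma massOn_nonneg (hf : UnitFamily f) (A : Set (Fin n → ℝ)) (g : G) : 0 ≤ massOn f A g :=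
  integral_nonneg fun _ => hf.nonneg _ _

lemma massOn_mono (hf : UnitFamily f) {A B : Set (Fin n → ℝ)} (hB : volume B < ⊤) (h : A ⊆ B)
    (g : G) :
    massOn f A g ≤ massOn f B g :=
  setIntegral_mono_set (hf.integrableOn hB g) (Filter.Eventually.of_forall fun _ => hf.nonneg _ _)
    h.eventuallyLE

lemma massOn_le (hf : UnitFamily f) {A : Set (Fin n → ℝ)} (hA : volume A < ⊤) (g : G) :
    massOn f A g ≤ (volume A).toReal := by
  have : IsFiniteMeasure (volume.restrict A) := ⟨by rwa [Measure.restrict_apply_univ]⟩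
  have := integral_mono (hf.integrableOn hA g) (integrable_const (1 : ℝ))
    (fun x => hf.le_one x g)
  simpa [massOn, Measure.real] using this

lemma massOn_union_le (hf : UnitFamily f) {A B : Set (Fin n → ℝ)} (hA : volume A < ⊤)
    (hB : volume B < ⊤)
    (hBm : MeasurableSet B) (g : G) : massOn f (A ∪ B) g ≤ massOn f A g + massOn f B g := by
  rw [← Set.sdiff_union_self, massOn, setIntegral_union Set.disjoint_sdiff_left hBm
    (hf.integrableOn ((measure_mono Set.sdiff_subset).trans_lt hA) g) (hf.integrableOn hB g)]
  exact add_le_add (hf.massOn_mono hA Set.sdiff_subset g) le_rfl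

lemma abs_massOn_sub_le (hf : UnitFamily f) {A B S : Set (Fin n → ℝ)} (hA : volume A < ⊤)
    (hB : volume B < ⊤)
    (hS : volume S < ⊤) (hSm : MeasurableSet S) (hAB : A ⊆ B ∪ S) (hBA : B ⊆ A ∪ S) (g : G) :
    |massOn f A g - massOn f B g| ≤ massOn f S g := by
  have h1 := hf.massOn_mono ((measure_union_le _ _).trans_lt (ENNReal.add_lt_top.2 ⟨hB, hS⟩)) hAB g
  have h2 := hf.massOn_mono ((measure_union_le _ _).trans_lt (ENNReal.add_lt_top.2 ⟨hA, hS⟩)) hBA g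
  have h3 := hf.massOn_union_le hB hS hSm g
  have h4 := hf.massOn_union_le hA hS hSm g
  rw [abs_le]
  constructor <;> linarith

lemma measurable_massOn (hf : UnitFamily f) (A : Set (Fin n → ℝ)) : Measurable (massOn f A) := by
  have h : Measurable fun p : G × (Fin n → ℝ) => f p.2 p.1 := hf.meas.comp measurable_swap
  exact (h.stronglyMeasurable.integral_prod_right (ν := volume.restrict A)).measurable

variable {ν : Measure G} [IsFiniteMeasure ν]

lemma integrable_massOn (hf : UnitFamily f) {A : Set (Fin n → ℝ)} (hA : volume A < ⊤) :
    Integrable (massOn f A) ν :=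
  Integrable.of_bound (hf.measurable_massOn A).aestronglyMeasurable (volume A).toReal
    (Filter.Eventually.of_forall fun g => by
      rw [Real.norm_eq_abs, abs_of_nonneg (hf.massOn_nonneg A g)]
      exact hf.massOn_le hA g)

lemma integrable_ballCount (hf : UnitFamily f) (t : ℝ) : Integrable (ballCount f t) ν :=
  integrable_finsetSum _ fun _ _ => hf.integrable _

lemma integral_massOn_le (hf : UnitFamily f) {A : Set (Fin n → ℝ)} (hAm : MeasurableSet A)
    (hA : volume A < ⊤) {B : ℝ}
    (hB : ∀ x ∈ A, ∫ g, f x g ∂ν ≤ B) : ∫ g, massOn f A g ∂ν ≤ B * (volume A).toReal := by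
  have : IsFiniteMeasure (volume.restrict A) := ⟨by rwa [Measure.restrict_apply_univ]⟩
  have h : Measurable fun p : G × (Fin n → ℝ) => f p.2 p.1 := hf.meas.comp measurable_swap
  have hi : Integrable (Function.uncurry fun (g : G) (x : Fin n → ℝ) => f x g)
      (ν.prod (volume.restrict A)) :=
    Integrable.of_bound h.aestronglyMeasurable 1
      (Filter.Eventually.of_forall fun _ => hf.abs_le_one _ _)
  unfold massOn
  rw [integral_integral_swap hi]
  have := setIntegral_mono_on hi.integral_prod_right (integrable_const (μ := volume.restrict A) B)
    hAm hB
  refine this.trans (le_of_eq ?_)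
  simp [Measure.real, mul_comm]

end UnitFamily

end mass

namespace CorrBound

open Finset

variable {G : Type*} [MeasurableSpace G] {m d : ℕ} {ν : Measure G} [IsFiniteMeasure ν]
  {f : (Fin (m + 3) → ℝ) → G → ℝ} {L C : ℝ}

lemma sum_intBox_le (hf : CorrBound m d ν f L C) (hd : d ≤ m + 2) (B : ℕ) :
    ∑ w ∈ intBox (m + 3) B, (∫ g, f (intVec w) g ∂ν + ∫ g, avg f (intVec w) g ∂ν)
      ≤ 2 * C * 3 ^ (m + 3) + 2 * C * 2 ^ d * (2 * (m + 3) * 3 ^ (m + 2)) *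
        (L * (B : ℝ) ^ (m + 3 - d)) := by
  have hC := hf.pos
  have hL := hf.nonneg
  have hmass : ∀ h : G → ℝ, Integrable h ν → (∀ g, h g ≤ 1) → ∫ g, h g ∂ν ≤ C := by
    intro h hi h1
    refine (integral_mono hi (integrable_const 1) h1).trans (le_trans (le_of_eq ?_) hf.mass)
    simp
  have hpt : ∀ w ∈ intBox (m + 3) B, ∫ g, f (intVec w) g ∂ν + ∫ g, avg f (intVec w) g ∂ν
      ≤ (if w ∈ intBox (m + 3) 1 then 2 * C else 0) +
        if w ≠ 0 then 2 * C * 2 ^ d * L * (1 / (supN w : ℝ) ^ d) else 0 := by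
    intro w _
    by_cases h1 : supN w ≤ 1
    · rw [if_pos (mem_intBox.2 h1)]
      have a1 := hmass _ (hf.unit.integrable (intVec w)) (hf.unit.le_one _)
      have a2 := hmass _ (hf.unit.integrable_avg (intVec w)) (hf.unit.avg_le_one _)
      have a3 : 0 ≤ if w ≠ 0 then 2 * C * 2 ^ d * L * (1 / (supN w : ℝ) ^ d) else 0 := by
        split_ifs <;> positivity
      linarith
    · have hw0 : w ≠ 0 := by
        rintro rfl
        exact h1 (by rw [supN_eq_zero.2 rfl]; omega)
      have h2 : (2 : ℝ) ≤ supN w := by exact_mod_cast (by omega : 2 ≤ supN w)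
      have hs : (0 : ℝ) < supN w / 2 := by linarith
      rw [if_neg (fun h => h1 (mem_intBox.1 h)), if_pos hw0, zero_add]
      have a1 : ∫ g, f (intVec w) g ∂ν ≤ C * L / ((supN w : ℝ) / 2) ^ d :=
        hf.integral_le hs (by rw [norm_intVec]; linarith)
      have a2 : ∫ g, avg f (intVec w) g ∂ν ≤ C * L / ((supN w : ℝ) / 2) ^ d := by
        refine hf.integral_avg_le _ fun ξ hξ => hf.integral_le hs ?_
        have := norm_sub_le (intVec w + ξ) ξ
        rw [add_sub_cancel_right, norm_intVec] at this
        linarith [norm_le_one_of_mem_unitCube hξ]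
      calc _ ≤ 2 * (C * L / ((supN w : ℝ) / 2) ^ d) := by linarith
        _ = _ := by rw [div_pow]; field_simp
  refine (sum_le_sum hpt).trans ?_
  rw [sum_add_distrib]
  refine add_le_add ?_ ?_
  · rw [← sum_filter, sum_const, nsmul_eq_mul, mul_comm]
    refine mul_le_mul_of_nonneg_left ?_ (by positivity)
    have h : (intBox (m + 3) B).filter (· ∈ intBox (m + 3) 1) ⊆ intBox (m + 3) 1 :=
      fun w hw => (mem_filter.1 hw).2
    have := card_le_card h
    rw [card_intBox] at this
    exact_mod_cast this
  · rw [← sum_filter, ← mul_sum]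
    have := sum_inv_supN_pow_le (n := m + 2) hd B
    calc _ ≤ 2 * C * 2 ^ d * L * (2 * ((m + 2 : ℕ) + 1) * 3 ^ (m + 2) *
          (B : ℝ) ^ (m + 2 + 1 - d)) := mul_le_mul_of_nonneg_left this (by positivity)
      _ = _ := by push_cast; ring

lemma integral_shell_le (hf : CorrBound m d ν f L C) {a b : ℝ} (ha : 0 < a) (hab : a ≤ b) :
    ∫ g, massOn f {x | a < eucNorm x ∧ eucNorm x ≤ b} g ∂ν
      ≤ C * (m + 3) ^ d * unitBallVol (m + 3) * (L / a ^ d * (b ^ (m + 3) - a ^ (m + 3))) := by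
  have hC := hf.pos
  have hL := hf.nonneg
  have hvol := volume_shell_le (n := m + 3) ha hab
  refine (hf.unit.integral_massOn_le (B := C * L / (a / (m + 3)) ^ d) (measurableSet_shell a b)
    (by rw [hvol]; exact ENNReal.ofReal_lt_top) fun x hx => hf.integral_le (by positivity) ?_).trans
    (le_of_eq ?_)
  · rw [div_le_iff₀ (by positivity)]
    have := eucNorm_le x
    push_cast at this
    linarith [hx.1]
  · rw [hvol, ENNReal.toReal_ofReal]
    · rw [div_pow]; field_simp
    · exact mul_nonneg (sub_nonneg.2 (pow_le_pow_left₀ ha.le hab _)) (unitBallVol_nonneg _)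

end CorrBound

section firstMoment

open Finset

lemma UnitFamily.abs_ballCount_sub_massOn_le {n : ℕ} {G : Type*} [MeasurableSpace G]
    {f : (Fin n → ℝ) → G → ℝ} (hf : UnitFamily f) (t : ℝ) (B : ℕ) (g : G) :
    |ballCount f t g - massOn f {x | eucNorm x ≤ t} g|
      ≤ ∑ w ∈ intBox n B, (f (intVec w) g + avg f (intVec w) g)
        + |∑ w ∈ ballPts n t with B + 1 ≤ supN w, dev f (intVec w) g|
        + massOn f {x | t - n < eucNorm x ∧ eucNorm x ≤ t + n} g := by
  set P := {x : Fin n → ℝ | (fun i => ⌊x i⌋) ∈ ballPts n t} with hP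
  have hfract : ∀ x : Fin n → ℝ, eucNorm (intVec fun i => ⌊x i⌋) ≤ eucNorm x + n ∧
      eucNorm x ≤ eucNorm (intVec fun i => ⌊x i⌋) + n := by
    intro x
    have h1 : ∀ y : Fin n → ℝ, ‖y‖ ≤ 1 → eucNorm y ≤ n := fun y hy =>
      (eucNorm_le y).trans (mul_le_of_le_one_right (by positivity) hy)
    have h2 : ‖x - intVec fun i => ⌊x i⌋‖ ≤ 1 := by
      refine (pi_norm_le_iff_of_nonneg zero_le_one).2 fun i => ?_
      have : (x - intVec fun i => ⌊x i⌋) i = Int.fract (x i) := rfl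
      rw [this, Real.norm_eq_abs, abs_of_nonneg (Int.fract_nonneg _)]
      exact (Int.fract_lt_one _).le
    constructor
    · have := eucNorm_add_le x ((intVec fun i => ⌊x i⌋) - x)
      rw [add_sub_cancel] at this
      exact this.trans (by gcongr; exact h1 _ (by rwa [norm_sub_rev]))
    · have := eucNorm_add_le (intVec fun i => ⌊x i⌋) (x - intVec fun i => ⌊x i⌋)
      rw [add_sub_cancel] at this
      exact this.trans (by gcongr; exact h1 _ h2)
  have hPiff : ∀ x, x ∈ P ↔ eucNorm (intVec fun i => ⌊x i⌋) ≤ t := fun x => mem_ballPts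
  have hPv : volume P < ⊤ := (measure_mono fun x hx =>
    show eucNorm x ≤ t + n by linarith [(hfract x).2, (hPiff x).1 hx]).trans_lt
      (volume_eucNorm_le_lt_top _)
  have hSv : volume {x : Fin n → ℝ | t - n < eucNorm x ∧ eucNorm x ≤ t + n} < ⊤ :=
    (measure_mono fun x hx => hx.2).trans_lt (volume_eucNorm_le_lt_top (t + n))
  have hmass : |massOn f P g - massOn f {x | eucNorm x ≤ t} g|
      ≤ massOn f {x | t - n < eucNorm x ∧ eucNorm x ≤ t + n} g := by
    refine hf.abs_massOn_sub_le hPv (volume_eucNorm_le_lt_top t) hSv (measurableSet_shell _ _)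
      (fun x hx => ?_) (fun x hx => ?_) g
    · by_cases h : eucNorm x ≤ t
      · exact Or.inl h
      · have := (hPiff x).1 hx
        have := (hfract x).2
        push Not at h
        exact Or.inr ⟨by linarith [(Nat.cast_nonneg n : (0 : ℝ) ≤ n)], by linarith⟩
    · by_cases h : x ∈ P
      · exact Or.inl h
      · have h1 := (hPiff x).not.1 h
        push Not at h1
        have h2 := (hfract x).1
        have h3 : eucNorm x ≤ t := hx
        exact Or.inr ⟨by linarith, by linarith [(Nat.cast_nonneg n : (0 : ℝ) ≤ n)]⟩
  have hsplit : ballCount f t g - massOn f P g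
      = ∑ w ∈ ballPts n t with ¬ B + 1 ≤ supN w, dev f (intVec w) g
        + ∑ w ∈ ballPts n t with B + 1 ≤ supN w, dev f (intVec w) g := by
    rw [add_comm, sum_filter_add_sum_filter_not]
    have := hf.sum_avg_eq (ballPts n t) g
    rw [massOn, hP, ← this, ballCount, ← sum_sub_distrib]
    rfl
  have hsmall : |∑ w ∈ ballPts n t with ¬ B + 1 ≤ supN w, dev f (intVec w) g|
      ≤ ∑ w ∈ intBox n B, (f (intVec w) g + avg f (intVec w) g) := by
    refine (abs_sum_le_sum_abs _ _).trans ((sum_le_sum fun w _ =>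
      hf.abs_dev_le_add (intVec w) g).trans (sum_le_sum_of_subset_of_nonneg (fun w hw => ?_)
        fun w _ _ => add_nonneg (hf.nonneg _ _) (hf.avg_nonneg _ _)))
    rw [mem_intBox]
    have := (mem_filter.1 hw).2
    omega
  calc _ = |(ballCount f t g - massOn f P g) +
    (massOn f P g - massOn f {x | eucNorm x ≤ t} g)| := by
        ring_nf
    _ ≤ |ballCount f t g - massOn f P g| + |massOn f P g - massOn f {x | eucNorm x ≤ t} g| :=
        abs_add_le _ _
    _ ≤ _ := add_le_add ((congrArg abs hsplit).le.trans ((abs_add_le _ _).trans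
        (add_le_add hsmall le_rfl))) hmass

lemma shell_width_le {e r m : ℕ} (hmr : m + 3 = e + 1 + r) (hr : 1 ≤ r) {t τ L : ℝ} (hL : 0 ≤ L)
    (hτ : 0 < τ) (hτt : τ ≤ t) (ht : 2 * ((m : ℝ) + 3) ≤ t) :
    L / (t - (m + 3)) ^ (e + 1) * ((t + (m + 3)) ^ (m + 3) - (t - (m + 3)) ^ (m + 3))
      ≤ 2 * (m + 3) ^ 2 * 2 ^ (m + 2) * 2 ^ (e + 1) * (L * t ^ r / τ) := by
  have ht0 : 0 < t := by linarith [(Nat.cast_nonneg m : (0 : ℝ) ≤ m)]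
  have hm : (0 : ℝ) ≤ m := Nat.cast_nonneg m
  have h1 : (t + (m + 3)) ^ (m + 3) - (t - (m + 3)) ^ (m + 3)
      ≤ 2 * (m + 3) ^ 2 * (2 * t) ^ (m + 2) := by
    refine (le_abs_self _).trans ((abs_pow_sub_pow_le _ _ _).trans ?_)
    have e1 : |t + ((m : ℝ) + 3) - (t - (m + 3))| = 2 * (m + 3) := by
      rw [abs_of_nonneg] <;> linarith
    have e2 : max |t + ((m : ℝ) + 3)| |t - (m + 3)| ≤ 2 * t := by
      refine max_le ?_ ?_ <;> rw [abs_of_nonneg] <;> linarith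
    rw [e1]
    calc _ ≤ 2 * ((m : ℝ) + 3) * ((m + 3 : ℕ) : ℝ) * (2 * t) ^ (m + 3 - 1) := by gcongr
      _ = _ := by push_cast; ring
  have h2 : L / (t - (m + 3)) ^ (e + 1) ≤ L / (t / 2) ^ (e + 1) := by
    gcongr; linarith
  have h0 : 0 ≤ (t + ((m : ℝ) + 3)) ^ (m + 3) - (t - (m + 3)) ^ (m + 3) :=
    sub_nonneg.2 (pow_le_pow_left₀ (by linarith) (by linarith) _)
  have h3 : t ^ (m + 2) = t ^ (e + 1) * t ^ (r - 1) := by rw [← pow_add]; congr 1; omega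
  have h4 : L * t ^ (r - 1) ≤ L * t ^ r / τ := by
    rw [le_div_iff₀ hτ, mul_assoc]
    refine mul_le_mul_of_nonneg_left ?_ hL
    calc _ ≤ t ^ (r - 1) * t := by gcongr
      _ = t ^ r := by rw [← pow_succ]; congr 1; omega
  calc _ ≤ L / (t / 2) ^ (e + 1) * (2 * (m + 3) ^ 2 * (2 * t) ^ (m + 2)) := by gcongr
    _ = 2 * (m + 3) ^ 2 * 2 ^ (m + 2) * 2 ^ (e + 1) * (L * t ^ (r - 1)) := by
        rw [div_pow, mul_pow, h3]; field_simp
    _ ≤ _ := by gcongr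

/-- The discrepancy in a ball of radius `t = τ ^ (8 M)` saves a factor `τ` on average. -/
lemma CorrBound.exists_integral_abs_sub_le {m e r M : ℕ} (hmr : m + 3 = e + 1 + r) (hr : 1 ≤ r)
    (hM : e + 2 ≤ M) (C : ℝ) (hC : 1 ≤ C) :
    ∃ K : ℝ, 0 < K ∧ ∃ τ₀ : ℕ, ∀ {G : Type*} [MeasurableSpace G] {ν : Measure G}
      [IsFiniteMeasure ν] {f : (Fin (m + 3) → ℝ) → G → ℝ} {L : ℝ}, CorrBound m (e + 1) ν f L C →
      ∀ τ : ℕ, τ₀ ≤ τ →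
      ∫ g, |ballCount f ((τ : ℝ) ^ (8 * M)) g
          - massOn f {x | eucNorm x ≤ (τ : ℝ) ^ (8 * M)} g| ∂ν
        ≤ K * (1 + L * ((τ : ℝ) ^ (8 * M)) ^ r / τ
          + √(L * ((τ : ℝ) ^ (8 * M)) ^ r) * τ ^ (m + 3)) := by
  obtain ⟨K₀, hK₀, hsq⟩ := CorrBound.exists_integral_sq_sum_dev_le hmr hM C hC
  have hC0 : 0 < C := zero_lt_one.trans_le hC
  set k₁ : ℝ := 2 * C * 3 ^ (m + 3) with hk₁
  set k₂ : ℝ := 2 * C * 2 ^ (e + 1) * (2 * (m + 3) * 3 ^ (m + 2)) with hk₂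
  set k₃ : ℝ := C * (m + 3) ^ (e + 1) * unitBallVol (m + 3) *
    (2 * (m + 3) ^ 2 * 2 ^ (m + 2) * 2 ^ (e + 1)) with hk₃
  have hk₃0 : 0 ≤ k₃ := by have := unitBallVol_nonneg (m + 3); positivity
  refine ⟨k₁ + k₂ + (K₀ + C) / 2 + k₃, by positivity, max (max 4 ⌈2 * C⌉₊) (2 * (m + 3)), ?_⟩
  intro G _ ν _ f L hf τ hτ
  have hτ4 : 4 ≤ τ := (le_max_left _ _).trans ((le_max_left _ _).trans hτ)
  have hτC : 2 * C ≤ τ := (Nat.le_ceil _).trans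
    (by exact_mod_cast (le_max_right _ _).trans ((le_max_left _ _).trans hτ))
  have hτm : 2 * ((m : ℝ) + 3) ≤ τ := by
    exact_mod_cast (le_max_right _ _).trans hτ
  have hL := hf.nonneg
  have hτ0 : (0 : ℝ) < τ := by exact_mod_cast (show 0 < τ by omega)
  have hτ1 : (1 : ℝ) ≤ τ := by exact_mod_cast (show 1 ≤ τ by omega)
  set t : ℝ := (τ : ℝ) ^ (8 * M) with ht
  have hτt : (τ : ℝ) ≤ t := by
    rw [ht]; exact le_self_pow₀ hτ1 (by omega)
  set X : ℝ := L * t ^ r with hX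
  have hX0 : 0 ≤ X := by positivity
  set lam : ℝ := 1 + X / τ + √X * τ ^ (m + 3) with hlam
  have hlam1 : 1 ≤ lam := by
    have h1 : 0 ≤ X / τ := by positivity
    have h2 : 0 ≤ √X * (τ : ℝ) ^ (m + 3) := by positivity
    linarith
  have hXτ : X / τ ≤ lam := by
    have h2 : 0 ≤ √X * (τ : ℝ) ^ (m + 3) := by positivity
    linarith
  set B : ℕ := τ ^ (8 * M - 1) with hB
  set S := (ballPts (m + 3) t).filter fun w => B + 1 ≤ supN w with hS
  set h : G → ℝ := fun g => ∑ w ∈ S, dev f (intVec w) g with hh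
  have hhm : Measurable h := measurable_fun_sum _ fun w _ => hf.unit.measurable_dev _
  have hhb : ∀ g, |h g| ≤ (#S : ℝ) := fun g =>
    (abs_sum_le_sum_abs _ _).trans ((sum_le_sum fun w _ => hf.unit.abs_dev_le _ g).trans (by simp))
  have hhi : Integrable h ν := Integrable.of_bound hhm.aestronglyMeasurable _
    (Filter.Eventually.of_forall hhb)
  have hh2 : Integrable (fun g => h g ^ 2) ν :=
    Integrable.of_bound (hhm.pow_const 2).aestronglyMeasurable ((#S : ℝ) ^ 2)
      (Filter.Eventually.of_forall fun g => by
        rw [Real.norm_eq_abs, abs_pow]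
        exact pow_le_pow_left₀ (abs_nonneg _) (hhb g) 2)
  have hbig : ∫ g, |h g| ∂ν ≤ (K₀ + C) / 2 * lam := by
    have h1 : ∫ g, h g ^ 2 ∂ν ≤ K₀ * lam ^ 2 := by
      refine (hsq hf τ hτ4 hτC S fun w hw => ?_).trans ?_
      · have hw' := mem_filter.1 hw
        refine ⟨hw'.2, ?_⟩
        have := (supN_le_eucNorm w).trans (mem_ballPts.1 hw'.1)
        rw [ht] at this
        exact_mod_cast this
      · refine mul_le_mul_of_nonneg_left ?_ hK₀.le
        have h3 : 0 ≤ X / τ := by positivity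
        have h2 : 0 ≤ √X * (τ : ℝ) ^ (m + 3) := by positivity
        have h4 : X * ((τ : ℝ) ^ (m + 3)) ^ 2 = (√X * (τ : ℝ) ^ (m + 3)) ^ 2 := by
          rw [mul_pow, Real.sq_sqrt hX0]
        rw [h4, hlam]
        nlinarith [mul_nonneg h3 h2]
    have h2 : ∫ g, |h g| ∂ν ≤ ∫ g, (h g ^ 2 * (1 / (2 * lam)) + lam / 2) ∂ν := by
      refine integral_mono hhi.abs ((hh2.mul_const _).add (integrable_const _)) fun g => ?_
      have hl : 0 < lam := by linarith
      have : |h g| * (2 * lam) ≤ h g ^ 2 + lam ^ 2 := by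
        rw [← sq_abs (h g)]; nlinarith [sq_nonneg (|h g| - lam)]
      calc |h g| = |h g| * (2 * lam) * (1 / (2 * lam)) := by field_simp
        _ ≤ (h g ^ 2 + lam ^ 2) * (1 / (2 * lam)) := by gcongr
        _ = _ := by field_simp
    rw [integral_add (hh2.mul_const _) (integrable_const _), integral_mul_const,
      integral_const, smul_eq_mul] at h2
    have hl : 0 < lam := by linarith
    calc _ ≤ _ := h2
      _ ≤ K₀ * lam ^ 2 * (1 / (2 * lam)) + C * (lam / 2) := by
          gcongr
          exact hf.mass
      _ = _ := by field_simp
  have hsm := hf.sum_intBox_le (by omega : e + 1 ≤ m + 2) B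
  have hBX : L * (B : ℝ) ^ (m + 3 - (e + 1)) ≤ lam := by
    refine le_trans ?_ hXτ
    rw [show m + 3 - (e + 1) = r by omega, le_div_iff₀ hτ0, hX, mul_assoc]
    refine mul_le_mul_of_nonneg_left ?_ hL
    have : t = B * τ := by
      rw [ht, hB]; push_cast; rw [← pow_succ]; congr 1; omega
    rw [this, mul_pow]
    gcongr
    exact le_self_pow₀ hτ1 (by omega)
  have hsh := hf.integral_shell_le (a := t - (m + 3)) (b := t + (m + 3)) (by linarith)
    (by linarith)
  have hsw := shell_width_le hmr hr hL hτ0 hτt (by linarith)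
  have hi1 : Integrable (fun g => ∑ w ∈ intBox (m + 3) B,
      (f (intVec w) g + avg f (intVec w) g)) ν :=
    integrable_finsetSum _ fun w _ => (hf.unit.integrable _).add (hf.unit.integrable_avg _)
  have hi3 : Integrable (massOn f {x | t - (m + 3) < eucNorm x ∧ eucNorm x ≤ t + (m + 3)}) ν :=
    hf.unit.integrable_massOn ((measure_mono fun x hx => hx.2).trans_lt
      (volume_eucNorm_le_lt_top (t + (m + 3))))
  calc _ ≤ ∫ g, (∑ w ∈ intBox (m + 3) B, (f (intVec w) g + avg f (intVec w) g) + |h g|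
        + massOn f {x | t - (m + 3) < eucNorm x ∧ eucNorm x ≤ t + (m + 3)} g) ∂ν := by
        refine integral_mono ((hf.unit.integrable_ballCount t).sub
          (hf.unit.integrable_massOn (volume_eucNorm_le_lt_top t))).abs
          ((hi1.add hhi.abs).add hi3) fun g => ?_
        have := hf.unit.abs_ballCount_sub_massOn_le t B g
        push_cast at this
        exact this
    _ = ∑ w ∈ intBox (m + 3) B, (∫ g, f (intVec w) g ∂ν + ∫ g, avg f (intVec w) g ∂ν)
        + ∫ g, |h g| ∂ν
        + ∫ g, massOn f {x | t - (m + 3) < eucNorm x ∧ eucNorm x ≤ t + (m + 3)} g ∂ν := by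
        have hi12 : Integrable (fun g => ∑ w ∈ intBox (m + 3) B,
          (f (intVec w) g + avg f (intVec w) g) + |h g|) ν := hi1.add hhi.abs
        have hi4 : ∀ w ∈ intBox (m + 3) B,
            Integrable (fun g => f (intVec w) g + avg f (intVec w) g) ν := fun w _ =>
          (hf.unit.integrable _).add (hf.unit.integrable_avg _)
        rw [integral_add hi12 hi3, integral_add hi1 hhi.abs, integral_finsetSum _ hi4]
        congr 2
        exact sum_congr rfl fun w _ => integral_add (hf.unit.integrable _)
          (hf.unit.integrable_avg _)
    _ ≤ (k₁ * lam + k₂ * lam) + (K₀ + C) / 2 * lam + k₃ * lam := by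
        refine add_le_add (add_le_add (hsm.trans ?_) hbig) (hsh.trans ?_)
        · refine add_le_add ?_ ?_
          · exact le_mul_of_one_le_right (by positivity) hlam1
          · exact mul_le_mul_of_nonneg_left hBX (by positivity)
        · have hu := unitBallVol_nonneg (m + 3)
          calc _ ≤ C * (m + 3) ^ (e + 1) * unitBallVol (m + 3) *
                (2 * (m + 3) ^ 2 * 2 ^ (m + 2) * 2 ^ (e + 1) * (L * t ^ r / τ)) := by gcongr
            _ = k₃ * (X / τ) := by rw [hk₃]; ring
            _ ≤ _ := by gcongr
    _ = _ := by ring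

end firstMoment

section instantiation

variable {n : ℕ}

/-- The measure on `SL_n(ℝ)` with density `weight R`. -/
def weightMeasure (μ : Measure (SLR n)) (R : ℝ) : Measure (SLR n) :=
  μ.withDensity fun g => ENNReal.ofReal (weight R g)

/-- The indicator functions of the sets of `g` of bounded size with `x g ∈ F₀⁻¹(J)`. -/
def hitFam (σ : Fin n → ℝ) (d : ℕ) (J : Set ℝ) (R : ℝ) (x : Fin n → ℝ) (g : SLR n) : ℝ :=
  (slBall n R).indicator (hitVal σ d J x) g

lemma integral_weightMeasure (μ : Measure (SLR n)) (R : ℝ) (Φ : SLR n → ℝ) :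
    ∫ g, Φ g ∂(weightMeasure μ R) = ∫ g, weight R g * Φ g ∂μ := by
  rw [weightMeasure, integral_withDensity_eq_integral_toReal_smul
    (measurable_weight R).ennreal_ofReal (Filter.Eventually.of_forall fun _ =>
      ENNReal.ofReal_lt_top)]
  refine integral_congr_ae (Filter.Eventually.of_forall fun g => ?_)
  simp only [smul_eq_mul, ENNReal.toReal_ofReal (weight_nonneg R g)]

instance (μ : Measure (SLR n)) [μ.IsHaarMeasure] (R : ℝ) :
    IsFiniteMeasure (weightMeasure μ R) := by
  refine isFiniteMeasure_withDensity_ofReal ?_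
  rcases le_or_gt 0 R with hR | hR
  · have := integrable_weight_mul μ hR (Φ := fun _ => 1) measurable_const (K := 1) (by simp)
    simp only [mul_one] at this
    exact this.2
  · have h : (weight R : SLR n → ℝ) = fun _ => 0 := by
      funext g
      exact weight_eq_zero (hR.le.trans (slSize_nonneg g))
    rw [h]
    exact hasFiniteIntegral_zero _ _

lemma weight_mul_indicator (R : ℝ) (Φ : SLR n → ℝ) (g : SLR n) :
    weight R g * (slBall n R).indicator Φ g = weight R g * Φ g := by
  by_cases h : g ∈ slBall n R
  · rw [Set.indicator_of_mem h]
  · rw [weight_eq_zero (not_le.1 h).le, zero_mul, zero_mul]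

lemma unitFamily_hitFam (σ : Fin n → ℝ) (d : ℕ) {J : Set ℝ} (hJ : MeasurableSet J) (R : ℝ) :
    UnitFamily (hitFam σ d J R) where
  meas := by
    have : (fun p : (Fin n → ℝ) × SLR n => hitFam σ d J R p.1 p.2)
        = {p : (Fin n → ℝ) × SLR n | p.2 ∈ slBall n R}.indicator
          (fun p => hitVal σ d J p.1 p.2) := by
      ext p
      rfl
    rw [this]
    exact (measurable_hitVal hJ).indicator (measurable_snd (measurableSet_slBall R))
  nonneg x g := Set.indicator_nonneg (fun _ _ => hitVal_nonneg _ _) _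
  le_one x g := by
    by_cases h : g ∈ slBall n R
    · rw [hitFam, Set.indicator_of_mem h]; exact hitVal_le_one _ _
    · rw [hitFam, Set.indicator_of_notMem h]; exact zero_le_one

lemma integral_hitFam_mul (μ : Measure (SLR n)) (σ : Fin n → ℝ) (d : ℕ) (J : Set ℝ) (R : ℝ)
    (x y : Fin n → ℝ) :
    ∫ g, hitFam σ d J R x g * hitFam σ d J R y g ∂(weightMeasure μ R) = wcorr μ σ d J R x y := by
  rw [integral_weightMeasure, wcorr]
  congr 1
  funext g
  rw [← mul_assoc, hitFam, weight_mul_indicator, mul_right_comm, hitFam, weight_mul_indicator]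
  ring

lemma integral_hitFam (μ : Measure (SLR n)) (σ : Fin n → ℝ) (d : ℕ) (J : Set ℝ) (R : ℝ)
    (x : Fin n → ℝ) :
    ∫ g, hitFam σ d J R x g ∂(weightMeasure μ R) = wcorr μ σ d J R x x := by
  rw [← integral_hitFam_mul]
  congr 1
  funext g
  unfold hitFam hitVal
  by_cases h : g ∈ slBall n R <;> by_cases h' : g ∈ hit σ d J x <;> simp [h, h']

lemma toReal_le_of_le_ofReal_mul {a b : ENNReal} {k : ℝ} (hk : 0 ≤ k) (hb : b ≠ ⊤)
    (h : a ≤ ENNReal.ofReal k * b) : a.toReal ≤ k * b.toReal := by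
  have := ENNReal.toReal_mono (ENNReal.mul_ne_top ENNReal.ofReal_ne_top hb) h
  rwa [ENNReal.toReal_mul, ENNReal.toReal_ofReal hk] at this

lemma exists_corrBound_hitFam {m d : ℕ} (hd : 1 ≤ d) (hde : Even d) {σ : Fin (m + 3) → ℝ}
    (hσ : IsSign σ) (μ : Measure (SLR (m + 3))) [μ.IsHaarMeasure] {R : ℝ} (hR : 0 ≤ R) :
    ∃ C : ℝ, 1 ≤ C ∧ ∀ J : Set ℝ, MeasurableSet J → volume J ≠ ⊤ →
      CorrBound m d (weightMeasure μ R) (hitFam σ d J R) (volume J).toReal C := by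
  obtain ⟨C₁, hC₁, h1⟩ := single_bound hd hde hσ μ R hR
  obtain ⟨C₂, hC₂, h2⟩ := pair_bound hd hde hσ μ (2 * R) (by linarith)
  obtain ⟨C₃, hC₃, h3⟩ := abs_wcorr_sub_le (d := d) (σ := σ) μ hR
  obtain ⟨C₄, hC₄, h4⟩ := volume_affine_slice_le (m + 2) d R hR
  set C : ℝ := 4 + (weightMeasure μ R).real Set.univ + R * C₁ + R * C₂ + C₃ + 2 * C₃ * C₂ + C₄
    with hC
  have hw : 0 ≤ (weightMeasure μ R).real Set.univ := measureReal_nonneg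
  have a1 : 0 ≤ R * C₁ := by positivity
  have a2 : 0 ≤ R * C₂ := by positivity
  have a3 : 0 ≤ C₃ * C₂ := by positivity
  refine ⟨C, by linarith, fun J hJ hJt => ?_⟩
  set L := (volume J).toReal with hL
  have hL0 : 0 ≤ L := ENNReal.toReal_nonneg
  have hpair : ∀ x y s i j, 0 < s → s ≤ ‖x‖ → s ≤ ‖y‖ → 0 < absMinor x y i j →
      (corr μ σ d J (2 * R) x y).toReal ≤ C₂ / (s ^ (2 * (d - 1)) * absMinor x y i j) * L ^ 2 := by
    intro x y s i j hs hx hy hm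
    have := toReal_le_of_le_ofReal_mul (by positivity) (ENNReal.pow_ne_top hJt)
      (h2 J hJ x y s i j hs hx hy hm)
    rwa [ENNReal.toReal_pow] at this
  refine ⟨unitFamily_hitFam σ d hJ R, by linarith, hL0, by linarith, ?_, ?_, ?_, ?_⟩
  · intro x hx
    have hx0 := norm_pos_iff.2 hx
    rw [integral_hitFam]
    calc _ ≤ R * (corr μ σ d J R x x).toReal := (le_abs_self _).trans (wcorr_le μ hR hJ x x)
      _ ≤ R * (C₁ / ‖x‖ ^ d * L) := by
          gcongr
          exact toReal_le_of_le_ofReal_mul (by positivity) hJt (h1 J hJ x hx)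
      _ = R * C₁ * L / ‖x‖ ^ d := by ring
      _ ≤ _ := by gcongr; linarith
  · intro x y s i j hs hx hy hm
    rw [integral_hitFam_mul]
    calc _ ≤ R * (corr μ σ d J R x y).toReal := (le_abs_self _).trans (wcorr_le μ hR hJ x y)
      _ ≤ R * (corr μ σ d J (2 * R) x y).toReal := by
          gcongr
          · exact corr_ne_top μ _ x y
          · exact corr_mono μ σ d J (by linarith) x y
      _ ≤ R * (C₂ / (s ^ (2 * (d - 1)) * absMinor x y i j) * L ^ 2) := by
          gcongr
          exact hpair x y s i j hs hx hy hm
      _ = R * C₂ * L ^ 2 / (s ^ (2 * (d - 1)) * absMinor x y i j) := by ring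
      _ ≤ _ := by gcongr; linarith
  · intro x y y' s T Q i j hs hx hy' hT hyy hTQ hQ hm
    rw [integral_hitFam_mul, integral_hitFam_mul]
    have hT0 : 0 < T := (hs.trans_le hx).trans_le hT
    have hT3 : C₃ * T ≤ Q := (mul_le_mul_of_nonneg_right (by linarith) hT0.le).trans hTQ
    have hT4 : 4 * T ≤ Q := (mul_le_mul_of_nonneg_right (by linarith) hT0.le).trans hTQ
    have hm' : Q / 2 ≤ absMinor x y' i j := by
      have hcoord : ∀ k, |y' k - y k| ≤ 1 := fun k => by
        rw [← Real.norm_eq_abs]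
        exact (norm_le_pi_norm (y' - y) k).trans hyy
      have hxc : ∀ k, |x k| ≤ T := fun k => by
        rw [← Real.norm_eq_abs]
        exact (norm_le_pi_norm x k).trans hT
      have e : x i * y j - x j * y i
          = (x i * y' j - x j * y' i) - (x i * (y' j - y j) - x j * (y' i - y i)) := by ring
      have b1 : |x i * (y' j - y j)| ≤ T := by
        rw [abs_mul]
        exact (mul_le_mul (hxc i) (hcoord j) (abs_nonneg _) hT0.le).trans (by simp)
      have b2 : |x j * (y' i - y i)| ≤ T := by
        rw [abs_mul]
        exact (mul_le_mul (hxc j) (hcoord i) (abs_nonneg _) hT0.le).trans (by simp)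
      unfold absMinor at hm ⊢
      rw [e] at hm
      have b3 := abs_sub (x i * y' j - x j * y' i) (x i * (y' j - y j) - x j * (y' i - y i))
      have b4 := abs_sub (x i * (y' j - y j)) (x j * (y' i - y i))
      linarith
    have hm0 : 0 < absMinor x y' i j := by linarith
    calc _ ≤ C₃ * (T / Q) * (corr μ σ d J (2 * R) x y').toReal :=
          h3 J hJ x y y' Q T i j hQ hm hT hyy hT3
      _ ≤ C₃ * (T / Q) * (C₂ / (s ^ (2 * (d - 1)) * absMinor x y' i j) * L ^ 2) := by
          gcongr
          exact hpair x y' s i j hs hx hy' hm0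
      _ ≤ C₃ * (T / Q) * (C₂ / (s ^ (2 * (d - 1)) * (Q / 2)) * L ^ 2) := by gcongr
      _ = 2 * C₃ * C₂ * (T / Q) * L ^ 2 / (s ^ (2 * (d - 1)) * Q) := by field_simp
      _ ≤ _ := by gcongr; linarith
  · intro g P₀ ε s hε hs
    by_cases hg : slSize g ≤ R
    · have := h4 hσ hd hde hJ g hg 0 P₀ 1 ε s one_ne_zero hε.le hs
      refine (measure_mono fun y hy => ?_).trans (this.trans (le_of_eq_of_le ?_
        (ENNReal.ofReal_le_ofReal (q := C * ε ^ (m + 2) * L / s ^ (d - 1)) (p :=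
          C₄ * (ε ^ (m + 2) / s ^ (d - 1)) * L) ?_)))
      · refine ⟨hy.1, by simpa using hy.2.1, ?_⟩
        by_contra hn
        refine hy.2.2 ?_
        have : g ∉ hit σ d J y := fun h => hn (by
          change diagForm σ d (act (0 + (1 : ℝ) • y) g) ∈ J
          rw [zero_add, one_smul]
          exact h)
        rw [hitFam, Set.indicator_of_mem (show g ∈ slBall _ R from hg), hitVal,
          Set.indicator_of_notMem this]
      · rw [abs_one, one_mul, ENNReal.ofReal_mul (p := C₄ * _) (by positivity), hL,
          ENNReal.ofReal_toReal hJt]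
      · calc _ = C₄ * ε ^ (m + 2) * L / s ^ (d - 1) := by ring
          _ ≤ _ := by gcongr; linarith
    · refine le_of_eq_of_le ?_ (zero_le)
      convert measure_empty (μ := volume)
      refine Set.eq_empty_of_forall_notMem fun y hy => hy.2.2 ?_
      rw [hitFam, Set.indicator_of_notMem (show g ∉ slBall _ R from hg)]

end instantiation

section lowerBound

open Finset

lemma abs_pow_sub_pow_le_mul (d : ℕ) {x y b : ℝ} (hx : |x| ≤ b) (hy : |y| ≤ b) :
    |x ^ d - y ^ d| ≤ d * b ^ (d - 1) * |x - y| := by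
  refine (abs_pow_sub_pow_le x y d).trans ?_
  calc _ ≤ |x - y| * d * b ^ (d - 1) := by gcongr; exact max_le hx hy
    _ = _ := by ring

/-- Every value of `z ^ d + w` near `0` is attained for `z` of size comparable to `-w`. -/
lemma volume_le_volume_root {d : ℕ} (hd : 1 ≤ d) {a b w M₀ : ℝ} (ha : 0 < a) (hab : a ≤ b)
    {J : Set ℝ} (hJM : ∀ s ∈ J, |s| ≤ M₀) (hw1 : a ^ d + M₀ ≤ -w) (hw2 : -w + M₀ ≤ b ^ d) :
    volume J ≤ ENNReal.ofReal (d * b ^ (d - 1)) * volume {z : ℝ | |z| ≤ b ∧ z ^ d + w ∈ J} := by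
  have hb : 0 < b := ha.trans_le hab
  have hd0 : d ≠ 0 := by omega
  have hd' : (0 : ℝ) < d := by exact_mod_cast hd
  set φ : ℝ → ℝ := fun s => (s - w) ^ ((d : ℝ)⁻¹) with hφ
  have hsw : ∀ s ∈ J, 0 ≤ s - w ∧ s - w ≤ b ^ d := fun s hs => by
    have := abs_le.1 (hJM s hs)
    have := pow_pos ha d
    constructor <;> linarith
  have hpow : ∀ s ∈ J, φ s ^ d = s - w := fun s hs => Real.rpow_inv_natCast_pow (hsw s hs).1 hd0
  have hφb : ∀ s ∈ J, |φ s| ≤ b := fun s hs => by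
    have h0 : 0 ≤ φ s := Real.rpow_nonneg (hsw s hs).1 _
    rw [abs_of_nonneg h0]
    exact (pow_le_pow_iff_left₀ h0 hb.le hd0).1 ((hpow s hs).trans_le (hsw s hs).2)
  have h := volume_le_of_expanding (φ := φ) (A := J)
    (J := {z : ℝ | |z| ≤ b ∧ z ^ d + w ∈ J}) (K := (d * b ^ (d - 1))⁻¹) (by positivity) ?_ ?_
  · rwa [inv_inv] at h
  · intro s hs s' hs'
    rw [inv_mul_le_iff₀ (by positivity)]
    have := abs_pow_sub_pow_le_mul d (hφb s hs) (hφb s' hs')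
    rwa [hpow s hs, hpow s' hs', sub_sub_sub_cancel_right] at this
  · intro s hs
    refine ⟨hφb s hs, ?_⟩
    rw [hpow s hs, sub_add_cancel]
    exact hs

lemma volume_mul_le_volume_diagForm {N d : ℕ} (hd : 2 ≤ d) {σ : Fin (N + 1) → ℝ} (hσ : IsSign σ)
    {i : Fin (N + 1)} {j : Fin N} (hi : σ i = 1) (hj : σ (i.succAbove j) = -1) {a M₀ : ℝ}
    (ha : 0 < a) (hM : M₀ ≤ a ^ d) {J : Set ℝ} (hJ : MeasurableSet J) (hJM : ∀ s ∈ J, |s| ≤ M₀) :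
    volume J * ENNReal.ofReal ((a / (N + 1)) ^ N) ≤ ENNReal.ofReal (d * (4 * a) ^ (d - 1)) *
      volume {Y : Fin (N + 1) → ℝ | ‖Y‖ ≤ 4 * a ∧ diagForm σ d Y ∈ J} := by
  have hmeas : MeasurableSet {Y : Fin (N + 1) → ℝ | ‖Y‖ ≤ 4 * a ∧ diagForm σ d Y ∈ J} :=
    (measurableSet_le measurable_norm measurable_const).inter (measurable_diagForm σ d hJ)
  have hpr := (volume_preserving_piFinSuccAbove (fun _ : Fin (N + 1) => ℝ) i).symm
  rw [← hpr.measure_preimage hmeas.nullMeasurableSet]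
  set S := (MeasurableEquiv.piFinSuccAbove (fun _ : Fin (N + 1) => ℝ) i).symm ⁻¹'
    {Y : Fin (N + 1) → ℝ | ‖Y‖ ≤ 4 * a ∧ diagForm σ d Y ∈ J} with hS
  have hSm : MeasurableSet S := hpr.measurable hmeas
  rw [Measure.volume_eq_prod, Measure.prod_apply_symm hSm]
  set lo : Fin N → ℝ := fun k => if k = j then 2 * a else 0 with hlo
  set up : Fin N → ℝ := fun k => if k = j then 3 * a else a / (N + 1) with hup
  set D : Set (Fin N → ℝ) := Set.univ.pi fun k => Set.Icc (lo k) (up k) with hD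
  have hDm : MeasurableSet D := MeasurableSet.univ_pi fun k => measurableSet_Icc
  have haN : a / (N + 1) ≤ a := div_le_self ha.le (by linarith [(Nat.cast_nonneg N : (0 : ℝ) ≤ N)])
  have hDv : ENNReal.ofReal ((a / (N + 1)) ^ N) ≤ volume D := by
    rw [hD, volume_pi_pi]
    simp only [Real.volume_Icc]
    rw [ENNReal.ofReal_pow (by positivity)]
    calc _ = ∏ k : Fin N, ENNReal.ofReal (a / (N + 1)) := by simp
      _ ≤ _ := by
        refine prod_le_prod' fun k _ => ENNReal.ofReal_le_ofReal ?_
        rw [hup, hlo]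
        dsimp only
        split_ifs
        · linarith
        · linarith
  have hslice : ∀ y ∈ D, volume J
      ≤ ENNReal.ofReal (d * (4 * a) ^ (d - 1)) * volume ((fun x => (x, y)) ⁻¹' S) := by
    intro y hy
    have hy' : ∀ k, lo k ≤ y k ∧ y k ≤ up k := fun k => hy k (Set.mem_univ k)
    have hy0 : ∀ k, 0 ≤ y k := fun k => by
      refine le_trans ?_ (hy' k).1
      rw [hlo]; dsimp only; split_ifs <;> positivity
    have hyb : ∀ k, y k ≤ 3 * a := fun k => by
      refine (hy' k).2.trans ?_
      rw [hup]; dsimp only; split_ifs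
      · exact le_rfl
      · linarith
    have hyj : 2 * a ≤ y j := by
      have := (hy' j).1
      rwa [show lo j = 2 * a from if_pos rfl] at this
    have hrest : |∑ k ∈ univ.erase j, σ (i.succAbove k) * y k ^ d| ≤ a ^ d := by
      refine (abs_sum_le_sum_abs _ _).trans ?_
      have h1 : ∀ k ∈ univ.erase j, |σ (i.succAbove k) * y k ^ d| ≤ a ^ d / (N + 1) := by
        intro k hk
        rw [abs_mul, hσ, one_mul, abs_of_nonneg (pow_nonneg (hy0 k) _)]
        have h2 : y k ≤ a / (N + 1) := by
          have := (hy' k).2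
          rwa [show up k = a / (N + 1) from if_neg (ne_of_mem_erase hk)] at this
        calc y k ^ d ≤ (a / (N + 1)) ^ d := pow_le_pow_left₀ (hy0 k) h2 _
          _ = a ^ d / (N + 1) ^ d := div_pow _ _ _
          _ ≤ _ := by
            gcongr
            exact le_self_pow₀ (by linarith [(Nat.cast_nonneg N : (0 : ℝ) ≤ N)]) (by omega)
      refine (sum_le_card_nsmul _ _ _ h1).trans ?_
      rw [nsmul_eq_mul, mul_div_assoc', div_le_iff₀ (by positivity), mul_comm]
      refine mul_le_mul_of_nonneg_left ?_ (by positivity)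
      have : #(univ.erase j) ≤ N := (card_le_univ _).trans (by simp)
      have : (#(univ.erase j) : ℝ) ≤ N := by exact_mod_cast this
      linarith
    have hw : diagForm (fun k => σ (i.succAbove k)) d y
        = -y j ^ d + ∑ k ∈ univ.erase j, σ (i.succAbove k) * y k ^ d := by
      rw [diagForm, ← add_sum_erase _ _ (mem_univ j), hj]
      ring
    have hr := abs_le.1 hrest
    have hj1 : 4 * a ^ d ≤ y j ^ d := by
      calc 4 * a ^ d = 2 ^ 2 * a ^ d := by norm_num
        _ ≤ 2 ^ d * a ^ d := by gcongr; norm_num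
        _ = (2 * a) ^ d := (mul_pow _ _ _).symm
        _ ≤ _ := pow_le_pow_left₀ (by positivity) hyj _
    have hj2 : y j ^ d + 2 * a ^ d ≤ (4 * a) ^ d := by
      have h1 : y j ^ d ≤ (3 * a) ^ d := pow_le_pow_left₀ (hy0 j) (hyb j) _
      have h2 : (3 : ℝ) ^ d + 2 ≤ 4 ^ d := by
        obtain ⟨k, rfl⟩ := Nat.exists_eq_add_of_le hd
        have h3 : (3 : ℝ) ^ k ≤ 4 ^ k := pow_le_pow_left₀ (by norm_num) (by norm_num) _
        have h4 : (1 : ℝ) ≤ 4 ^ k := one_le_pow₀ (by norm_num)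
        rw [pow_add, pow_add]
        nlinarith
      rw [mul_pow] at h1 ⊢
      have := mul_le_mul_of_nonneg_right h2 (pow_pos ha d).le
      nlinarith
    have ha0 := pow_pos ha d
    have h := volume_le_volume_root (d := d) (a := a) (b := 4 * a)
      (w := diagForm (fun k => σ (i.succAbove k)) d y) (M₀ := M₀) (by omega) ha (by linarith) hJM
      (by rw [hw]; linarith) (by rw [hw]; linarith)
    refine h.trans ?_
    gcongr
    rintro z ⟨hz1, hz2⟩
    change ‖i.insertNth (α := fun _ => ℝ) z y‖ ≤ 4 * a ∧ diagForm σ d (i.insertNth z y) ∈ J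
    refine ⟨(pi_norm_le_iff_of_nonneg (by positivity)).2 fun k => ?_, ?_⟩
    · rcases Fin.eq_self_or_eq_succAbove i k with rfl | ⟨k', rfl⟩
      · rw [Fin.insertNth_apply_same]; exact hz1
      · rw [Fin.insertNth_apply_succAbove, Real.norm_eq_abs, abs_of_nonneg (hy0 k')]
        linarith [hyb k']
    · rw [diagForm_insertNth, hi, one_mul]; exact hz2
  calc volume J * ENNReal.ofReal ((a / (N + 1)) ^ N) ≤ volume J * volume D := by gcongr
    _ = ∫⁻ y in D, volume J := by rw [setLIntegral_const]
    _ ≤ ∫⁻ y in D, ENNReal.ofReal (d * (4 * a) ^ (d - 1)) * volume ((fun x => (x, y)) ⁻¹' S) :=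
        setLIntegral_mono' hDm hslice
    _ ≤ ∫⁻ y, ENNReal.ofReal (d * (4 * a) ^ (d - 1)) * volume ((fun x => (x, y)) ⁻¹' S) :=
        setLIntegral_le_lintegral _ _
    _ = _ := lintegral_const_mul' _ _ ENNReal.ofReal_ne_top

/-- The volume of the region of `x` in a ball with `x g ∈ F₀⁻¹(J)` is at least of the expected
order of magnitude. -/
lemma exists_le_volume_ball {N d : ℕ} (hd : 2 ≤ d) (hdN : d ≤ N) {σ : Fin (N + 1) → ℝ}
    (hσ : IsSign σ) {i : Fin (N + 1)} {j : Fin N} (hi : σ i = 1) (hj : σ (i.succAbove j) = -1)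
    (g : SLR (N + 1)) (M₀ : ℝ) : ∃ c > 0, ∃ t₀ > 0, ∀ t ≥ t₀, ∀ J : Set ℝ, MeasurableSet J →
      (∀ s ∈ J, |s| ≤ M₀) → c * (volume J).toReal * t ^ (N + 1 - d)
        ≤ (volume {x : Fin (N + 1) → ℝ | eucNorm x ≤ t ∧ diagForm σ d (act x g) ∈ J}).toReal := by
  set s := slSize g⁻¹ + 1 with hs
  have hs0 : 0 < s := by have := slSize_nonneg g⁻¹; positivity
  set ρ : ℝ := 1 / (4 * (N + 1) * s) with hρ
  have hρ0 : 0 < ρ := by positivity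
  refine ⟨(ρ / (N + 1)) ^ N / (d * (4 * ρ) ^ (d - 1)), by positivity, max 1 ((|M₀| + 1) / ρ),
    by positivity, fun t ht J hJ hJM => ?_⟩
  have ht1 : 1 ≤ t := (le_max_left _ _).trans ht
  have ht0 : 0 < t := by linarith
  have hMt : M₀ ≤ (ρ * t) ^ d := by
    have h1 : |M₀| + 1 ≤ ρ * t := by
      have := (le_max_right _ _).trans ht
      rwa [div_le_iff₀' hρ0] at this
    have h2 : ρ * t ≤ (ρ * t) ^ d := le_self_pow₀ (by linarith [abs_nonneg M₀]) (by omega)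
    linarith [le_abs_self M₀]
  have key := volume_mul_le_volume_diagForm hd hσ hi hj (a := ρ * t) (by positivity) hMt hJ hJM
  have hsub : {x : Fin (N + 1) → ℝ | ‖act x g‖ ≤ 4 * (ρ * t) ∧ diagForm σ d (act x g) ∈ J}
      ⊆ {x | eucNorm x ≤ t ∧ diagForm σ d (act x g) ∈ J} := by
    intro x hx
    refine ⟨?_, hx.2⟩
    have h1 := norm_act_le (act x g) g⁻¹
    rw [act_act_inv] at h1
    calc eucNorm x ≤ (N + 1 : ℕ) * ‖x‖ := eucNorm_le x
      _ ≤ (N + 1 : ℕ) * (‖act x g‖ * s) := by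
          gcongr
          exact h1.trans (by gcongr; linarith)
      _ ≤ (N + 1 : ℕ) * (4 * (ρ * t) * s) := by gcongr; exact hx.1
      _ = t := by rw [hρ]; push_cast; field_simp
  have hfin : volume {x : Fin (N + 1) → ℝ | eucNorm x ≤ t ∧ diagForm σ d (act x g) ∈ J} ≠ ⊤ :=
    ((measure_mono fun x hx => hx.1).trans_lt (volume_eucNorm_le_lt_top t)).ne
  have hle : volume {Y : Fin (N + 1) → ℝ | ‖Y‖ ≤ 4 * (ρ * t) ∧ diagForm σ d Y ∈ J}
      ≤ volume {x : Fin (N + 1) → ℝ | eucNorm x ≤ t ∧ diagForm σ d (act x g) ∈ J} := by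
    rw [← volume_preimage_act g]
    exact measure_mono hsub
  have h := ENNReal.toReal_mono (ENNReal.mul_ne_top ENNReal.ofReal_ne_top hfin)
    (key.trans (mul_le_mul_right hle _))
  have hd0 : (0 : ℝ) < d := by exact_mod_cast (show 0 < d by omega)
  rw [ENNReal.toReal_mul, ENNReal.toReal_mul, ENNReal.toReal_ofReal (by positivity),
    ENNReal.toReal_ofReal (by positivity), mul_comm _ (ENNReal.toReal _),
    ← div_le_iff₀ (by positivity)] at h
  refine le_of_eq_of_le ?_ h
  have hp : t ^ N = t ^ (N + 1 - d) * t ^ (d - 1) := by rw [← pow_add]; congr 1; omega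
  rw [mul_div_right_comm ρ t, mul_pow _ t, hp, show 4 * (ρ * t) = 4 * ρ * t by ring,
    mul_pow _ t (d - 1)]
  field_simp

end lowerBound

section deterministicShell

open scoped Pointwise in
lemma volume_shell_of_homogeneous {N : ℕ} {h : (Fin N → ℝ) → ℝ} (hm : Measurable h)
    (hh : ∀ (r : ℝ) (y : Fin N → ℝ), 0 < r → h (r • y) = r * h y)
    (hf : volume {y | h y ≤ 1} ≠ ⊤) {a b : ℝ} (ha : 0 < a) (hab : a ≤ b) :
    volume {y : Fin N → ℝ | a < h y ∧ h y ≤ b}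
      = ENNReal.ofReal ((b ^ N - a ^ N) * (volume {y | h y ≤ 1}).toReal) := by
  have hball : ∀ t : ℝ, 0 < t → volume {y : Fin N → ℝ | h y ≤ t}
      = ENNReal.ofReal (t ^ N * (volume {y | h y ≤ 1}).toReal) := by
    intro t ht
    have hset : {x : Fin N → ℝ | h x ≤ t} = t • {x : Fin N → ℝ | h x ≤ 1} := by
      ext x
      rw [Set.mem_smul_set_iff_inv_smul_mem₀ ht.ne']
      change h x ≤ t ↔ h (t⁻¹ • x) ≤ 1
      rw [hh _ _ (by positivity), inv_mul_le_iff₀ ht, mul_one]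
    rw [hset, Measure.addHaar_smul_of_nonneg _ ht.le, Module.finrank_fin_fun,
      ENNReal.ofReal_mul (by positivity), ENNReal.ofReal_toReal hf]
  have hset : {x : Fin N → ℝ | a < h x ∧ h x ≤ b} = {x | h x ≤ b} \ {x | h x ≤ a} := by
    ext x
    exact ⟨fun h => ⟨h.2, not_le.2 h.1⟩, fun h => ⟨not_le.1 h.2, h.1⟩⟩
  have hsub : {x : Fin N → ℝ | h x ≤ a} ⊆ {x | h x ≤ b} := fun x (hx : h x ≤ a) => hx.trans hab
  rw [hset, measure_sdiff hsub (measurableSet_le hm measurable_const).nullMeasurableSet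
    (by rw [hball a ha]; exact ENNReal.ofReal_ne_top), hball a ha, hball b (ha.trans_le hab),
    ← ENNReal.ofReal_sub _ (by positivity)]
  congr 1; ring

lemma abs_sub_le_abs_pow_sub_pow {d : ℕ} (hd : 1 ≤ d) {x y : ℝ} (hx : 1 ≤ x) (hy : 0 ≤ y) :
    |x - y| ≤ |x ^ d - y ^ d| := by
  obtain ⟨e, rfl⟩ : ∃ e, d = e + 1 := ⟨d - 1, by omega⟩
  have hx1 : 1 ≤ x ^ e := one_le_pow₀ hx
  rcases le_total y x with h | h
  · have h1 : y ^ e ≤ x ^ e := pow_le_pow_left₀ hy h e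
    have h2 : y ^ (e + 1) ≤ x ^ (e + 1) := pow_le_pow_left₀ hy h _
    rw [abs_of_nonneg (sub_nonneg.2 h), abs_of_nonneg (sub_nonneg.2 h2), pow_succ, pow_succ]
    nlinarith [mul_nonneg (sub_nonneg.2 h) (sub_nonneg.2 hx1), mul_nonneg hy (sub_nonneg.2 h1)]
  · have h1 : x ^ e ≤ y ^ e := pow_le_pow_left₀ (by linarith) h e
    have h2 : x ^ (e + 1) ≤ y ^ (e + 1) := pow_le_pow_left₀ (by linarith) h _
    rw [abs_sub_comm, abs_sub_comm (x ^ _), abs_of_nonneg (sub_nonneg.2 h),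
      abs_of_nonneg (sub_nonneg.2 h2), pow_succ, pow_succ]
    nlinarith [mul_nonneg (sub_nonneg.2 h) (sub_nonneg.2 (hx1.trans h1)),
      mul_nonneg (by linarith : (0 : ℝ) ≤ x) (sub_nonneg.2 h1)]

/-- A continuous positively homogeneous subadditive function comparable to the norm. -/
structure QuasiNorm {N : ℕ} (q : (Fin N → ℝ) → ℝ) (A : ℝ) : Prop where
  cont : Continuous q
  add_le : ∀ x y, q (x + y) ≤ q x + q y
  smul : ∀ (r : ℝ) x, 0 < r → q (r • x) = r * q x
  le_norm : ∀ x, q x ≤ A * ‖x‖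
  norm_le : ∀ x, ‖x‖ ≤ A * q x

lemma quasiNorm_eucNorm_act {n : ℕ} (g : SLR n) :
    ∃ A, 1 ≤ A ∧ QuasiNorm (fun x => eucNorm (act x g)) A := by
  have hs := slSize_nonneg g
  have hs' := slSize_nonneg g⁻¹
  refine ⟨1 + n * slSize g + slSize g⁻¹, by nlinarith [(Nat.cast_nonneg n : (0 : ℝ) ≤ n)],
    ⟨?_, fun x y => ?_, fun r x hr => ?_, fun x => ?_, fun x => ?_⟩⟩
  · refine continuous_eucNorm.comp ?_
    change Continuous fun x : Fin n → ℝ => x ᵥ* (g : Matrix (Fin n) (Fin n) ℝ)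
    exact Continuous.matrix_vecMul continuous_id continuous_const
  · simp only [act_add]; exact eucNorm_add_le _ _
  · simp only [act_smul]; rw [eucNorm_smul, abs_of_pos hr]
  · calc _ ≤ n * (‖x‖ * slSize g) :=
          (eucNorm_le _).trans (by gcongr; exact norm_act_le x g)
      _ ≤ _ := by nlinarith [norm_nonneg x, mul_nonneg hs' (norm_nonneg x)]
  · have h1 : ‖x‖ ≤ ‖act x g‖ * slSize g⁻¹ := by
      conv_lhs => rw [← act_act_inv x g]
      exact norm_act_le _ _
    have h2 := norm_le_eucNorm (act x g)
    have h3 := eucNorm_nonneg (act x g)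
    have h4 : 0 ≤ (n : ℝ) * slSize g := by positivity
    nlinarith [mul_le_mul_of_nonneg_right h2 hs', mul_nonneg h4 h3]

/-- The distance to the cone `{diagForm = 0}` in a coordinate direction. -/
def coneHeight {N : ℕ} (σ : Fin N → ℝ) (d : ℕ) (y : Fin N → ℝ) : ℝ :=
  |diagForm σ d y| ^ ((d : ℝ)⁻¹)

lemma continuous_diagForm {N : ℕ} (σ : Fin N → ℝ) (d : ℕ) : Continuous (diagForm σ d) := by
  unfold diagForm
  fun_prop

lemma continuous_coneHeight {N : ℕ} (σ : Fin N → ℝ) (d : ℕ) : Continuous (coneHeight σ d) :=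
  (continuous_diagForm σ d).abs.rpow_const fun _ => Or.inr (by positivity)

lemma coneHeight_nonneg {N : ℕ} (σ : Fin N → ℝ) (d : ℕ) (y : Fin N → ℝ) :
    0 ≤ coneHeight σ d y := Real.rpow_nonneg (abs_nonneg _) _

lemma coneHeight_pow {N : ℕ} (σ : Fin N → ℝ) {d : ℕ} (hd : 1 ≤ d) (y : Fin N → ℝ) :
    coneHeight σ d y ^ d = |diagForm σ d y| :=
  Real.rpow_inv_natCast_pow (abs_nonneg _) (by omega)

lemma diagForm_smul {N : ℕ} (σ : Fin N → ℝ) (d : ℕ) (r : ℝ) (y : Fin N → ℝ) :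
    diagForm σ d (r • y) = r ^ d * diagForm σ d y := by
  simp only [diagForm, Finset.mul_sum, Pi.smul_apply, smul_eq_mul, mul_pow]
  exact Finset.sum_congr rfl fun i _ => by ring

lemma coneHeight_smul {N : ℕ} (σ : Fin N → ℝ) {d : ℕ} (hd : 1 ≤ d) {r : ℝ} (hr : 0 < r)
    (y : Fin N → ℝ) : coneHeight σ d (r • y) = r * coneHeight σ d y := by
  have h0 := coneHeight_nonneg σ d y
  refine (pow_left_inj₀ (coneHeight_nonneg σ d _) (by positivity) (by omega : d ≠ 0)).1 ?_
  rw [mul_pow, coneHeight_pow σ hd, coneHeight_pow σ hd, diagForm_smul, abs_mul,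
    abs_of_pos (pow_pos hr d)]

lemma QuasiNorm.exists_volume_shell_coord_le {N d : ℕ} {q : (Fin (N + 1) → ℝ) → ℝ} {A M₀ : ℝ}
    (hq : QuasiNorm q A) (hA : 1 ≤ A) (hM₀ : 0 ≤ M₀) {σ : Fin (N + 1) → ℝ} (hσ : IsSign σ)
    (hd : 1 ≤ d) (hde : Even d) (i : Fin (N + 1)) {ε : ℝ} (hε : |ε| = 1) :
    ∃ V : ℝ, 0 ≤ V ∧ ∀ a b : ℝ, A ≤ a → A * M₀ < a → a ≤ b → ∀ J : Set ℝ, MeasurableSet J →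
      (∀ s ∈ J, |s| ≤ M₀) →
      volume {X : Fin (N + 1) → ℝ | (a < q X ∧ q X ≤ b) ∧ a / A ≤ ε * X i ∧ diagForm σ d X ∈ J}
        ≤ ENNReal.ofReal (((b + A * M₀) ^ N - (a - A * M₀) ^ N) * V) *
          (ENNReal.ofReal (2 / (a / A) ^ (d - 1)) * volume J) := by
  have hε2 : ε * ε = 1 := by
    have := abs_mul_abs_self ε
    rw [hε] at this; linarith
  set σ' : Fin N → ℝ := fun j => σ (i.succAbove j) with hσ'
  set h : (Fin N → ℝ) → ℝ := fun y => q (i.insertNth (α := fun _ => ℝ) (ε * coneHeight σ' d y) y)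
    with hh
  have hcont : Continuous h := by
    refine hq.cont.comp ?_
    refine continuous_pi fun k => ?_
    rcases Fin.eq_self_or_eq_succAbove i k with rfl | ⟨k', rfl⟩
    · simp only [Fin.insertNth_apply_same]
      exact continuous_const.mul (continuous_coneHeight σ' d)
    · simp only [Fin.insertNth_apply_succAbove]
      exact continuous_apply k'
  have hhom : ∀ (r : ℝ) (y : Fin N → ℝ), 0 < r → h (r • y) = r * h y := by
    intro r y hr
    rw [hh]
    dsimp only
    rw [← hq.smul r _ hr, coneHeight_smul σ' hd hr]
    congr 1
    ext k
    rcases Fin.eq_self_or_eq_succAbove i k with rfl | ⟨k', rfl⟩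
    · simp only [Fin.insertNth_apply_same, Pi.smul_apply, smul_eq_mul]; ring
    · simp only [Fin.insertNth_apply_succAbove, Pi.smul_apply]
  have hfin : volume {y | h y ≤ 1} ≠ ⊤ := by
    refine ne_top_of_le_ne_top ?_ (measure_mono (?_ : _ ⊆ Metric.closedBall (0 : Fin N → ℝ) A))
    · exact measure_closedBall_lt_top.ne
    intro y (hy : h y ≤ 1)
    rw [mem_closedBall_zero_iff, pi_norm_le_iff_of_nonneg (by linarith)]
    intro k
    have h1 := norm_le_pi_norm (i.insertNth (α := fun _ => ℝ) (ε * coneHeight σ' d y) y)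
      (i.succAbove k)
    rw [Fin.insertNth_apply_succAbove] at h1
    refine h1.trans ((hq.norm_le _).trans ?_)
    exact mul_le_of_le_one_right (by linarith) hy
  refine ⟨(volume {y | h y ≤ 1}).toReal, ENNReal.toReal_nonneg, fun a b ha ha' hab J hJ hJM => ?_⟩
  have hC0 : 0 ≤ A * M₀ := by positivity
  have hm1 : 1 ≤ a / A := by rw [le_div_iff₀ (by linarith)]; linarith
  have hmeas : MeasurableSet {X : Fin (N + 1) → ℝ |
      (a < q X ∧ q X ≤ b) ∧ a / A ≤ ε * X i ∧ diagForm σ d X ∈ J} := by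
    have h2 : Measurable fun Y : Fin (N + 1) → ℝ => ε * Y i := by fun_prop
    exact ((measurableSet_lt measurable_const hq.cont.measurable).inter
      (measurableSet_le hq.cont.measurable measurable_const)).inter
      ((measurableSet_le measurable_const h2).inter (measurable_diagForm σ d hJ))
  have hpr := (volume_preserving_piFinSuccAbove (fun _ : Fin (N + 1) => ℝ) i).symm
  rw [← hpr.measure_preimage hmeas.nullMeasurableSet]
  set S := (MeasurableEquiv.piFinSuccAbove (fun _ : Fin (N + 1) => ℝ) i).symm ⁻¹'
    {X : Fin (N + 1) → ℝ | (a < q X ∧ q X ≤ b) ∧ a / A ≤ ε * X i ∧ diagForm σ d X ∈ J} with hS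
  have hSm : MeasurableSet S := hpr.measurable hmeas
  rw [Measure.volume_eq_prod, Measure.prod_apply_symm hSm]
  set T : Set (Fin N → ℝ) := {y | a - A * M₀ < h y ∧ h y ≤ b + A * M₀} with hT
  have hTm : MeasurableSet T := (measurableSet_lt measurable_const hcont.measurable).inter
    (measurableSet_le hcont.measurable measurable_const)
  calc ∫⁻ y, volume ((fun x => (x, y)) ⁻¹' S)
      ≤ ∫⁻ y, T.indicator (fun _ => ENNReal.ofReal (2 / (a / A) ^ (d - 1)) * volume J) y := by
        refine lintegral_mono fun y => ?_
        by_cases hy : y ∈ T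
        · rw [Set.indicator_of_mem hy]
          refine le_trans (measure_mono ?_)
            (volume_pow_preimage_le hd hde (hσ i) (by linarith : 0 < a / A) J
              (b := diagForm σ' d y))
          rintro z ⟨-, hz1, hz2⟩
          change a / A ≤ ε * i.insertNth (α := fun _ => ℝ) z y i at hz1
          change diagForm σ d (i.insertNth z y) ∈ J at hz2
          rw [diagForm_insertNth] at hz2
          rw [Fin.insertNth_apply_same] at hz1
          refine ⟨hz1.trans ?_, hz2⟩
          calc ε * z ≤ |ε * z| := le_abs_self _
            _ = |z| := by rw [abs_mul, hε, one_mul]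
        · rw [Set.indicator_of_notMem hy]
          rw [nonpos_iff_eq_zero]
          convert measure_empty (μ := (volume : Measure ℝ))
          refine Set.eq_empty_of_forall_notMem ?_
          rintro z ⟨hz0, hz1, hz2⟩
          refine hy ?_
          change a < q (i.insertNth (α := fun _ => ℝ) z y)
            ∧ q (i.insertNth (α := fun _ => ℝ) z y) ≤ b at hz0
          change a / A ≤ ε * i.insertNth (α := fun _ => ℝ) z y i at hz1
          change diagForm σ d (i.insertNth z y) ∈ J at hz2
          rw [diagForm_insertNth] at hz2
          rw [Fin.insertNth_apply_same] at hz1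
          set ζ := coneHeight σ' d y with hζ
          have hdist : |ε * z - ζ| ≤ M₀ := by
            refine (abs_sub_le_abs_pow_sub_pow hd (hm1.trans hz1)
              (coneHeight_nonneg σ' d y)).trans ?_
            rw [coneHeight_pow σ' hd]
            have e1 : (ε * z) ^ d = |σ i * z ^ d| := by
              rw [abs_mul, hσ i, one_mul, abs_pow, ← hde.pow_abs, abs_mul, hε, one_mul]
            rw [e1, ← abs_neg (diagForm σ' d y)]
            refine (abs_abs_sub_abs_le_abs_sub _ _).trans ?_
            rw [sub_neg_eq_add]
            exact hJM _ hz2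
          have hdist' : |z - ε * ζ| ≤ M₀ := by
            have : z - ε * ζ = ε * (ε * z - ζ) := by linear_combination -z * hε2
            rw [this, abs_mul, hε, one_mul]
            exact hdist
          have hnear : ∀ u v : ℝ, |u - v| ≤ M₀ →
              q (i.insertNth (α := fun _ => ℝ) u y)
                ≤ q (i.insertNth (α := fun _ => ℝ) v y) + A * M₀ := by
            intro u v huv
            have e1 : i.insertNth (α := fun _ => ℝ) u y
                = i.insertNth (α := fun _ => ℝ) v y + Pi.single i (u - v) := by
              ext k
              rcases Fin.eq_self_or_eq_succAbove i k with rfl | ⟨k', rfl⟩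
              · simp
              · simp [Fin.succAbove_ne]
            rw [e1]
            refine (hq.add_le _ _).trans ?_
            gcongr
            refine (hq.le_norm _).trans ?_
            gcongr
            rw [Pi.norm_single, Real.norm_eq_abs]
            exact huv
          have n1 := hnear _ _ hdist'
          have n2 := hnear _ _ (by rw [abs_sub_comm]; exact hdist')
          constructor
          · change a - A * M₀ < q _
            linarith [hz0.1]
          · change q _ ≤ b + A * M₀
            linarith [hz0.2]
    _ = _ := by
      rw [lintegral_indicator hTm, lintegral_const, Measure.restrict_apply_univ, hT,
        volume_shell_of_homogeneous hcont.measurable hhom hfin (by linarith) (by linarith)]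
      ring

lemma QuasiNorm.exists_volume_shell_le {N d : ℕ} {q : (Fin (N + 1) → ℝ) → ℝ} {A M₀ : ℝ}
    (hq : QuasiNorm q A) (hA : 1 ≤ A) (hM₀ : 1 ≤ M₀) {σ : Fin (N + 1) → ℝ} (hσ : IsSign σ)
    (hd : 1 ≤ d) (hde : Even d) :
    ∃ K : ℝ, 0 < K ∧ ∃ a₀ : ℝ, 0 < a₀ ∧ ∀ a b : ℝ, a₀ ≤ a → a ≤ b → ∀ J : Set ℝ,
      MeasurableSet J → (∀ s ∈ J, |s| ≤ M₀) →
      volume {X : Fin (N + 1) → ℝ | (a < q X ∧ q X ≤ b) ∧ diagForm σ d X ∈ J}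
        ≤ ENNReal.ofReal (K * ((b - a + 1) * b ^ (N - 1) / a ^ (d - 1))) * volume J := by
  have hM₀' : 0 ≤ M₀ := by linarith
  have hsg : ∀ e : Bool, |(if e then 1 else -1 : ℝ)| = 1 := by rintro (_ | _) <;> norm_num
  choose V hV0 hV using fun ie : Fin (N + 1) × Bool =>
    hq.exists_volume_shell_coord_le hA hM₀' hσ hd hde ie.1 (hsg ie.2)
  set V₀ := ∑ ie, V ie with hV₀
  have hV₀0 : 0 ≤ V₀ := Finset.sum_nonneg fun ie _ => hV0 ie
  set C₀ := A * M₀ with hC₀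
  have hC₀1 : 1 ≤ C₀ := one_le_mul_of_one_le_of_one_le hA hM₀
  have hAC : A ≤ C₀ := le_mul_of_one_le_right (by linarith) hM₀
  refine ⟨2 * A ^ (d - 1) * (N * 2 ^ (N - 1) * (2 * C₀)) * V₀ + 1, by positivity, 2 * C₀,
    by positivity, fun a b ha hab J hJ hJM => ?_⟩
  have ha0 : 0 < a := by linarith
  have hA0 : 0 < A := by linarith
  have hb0 : 0 < b := ha0.trans_le hab
  have hdiff : (b + C₀) ^ N - (a - C₀) ^ N
      ≤ N * 2 ^ (N - 1) * (2 * C₀) * ((b - a + 1) * b ^ (N - 1)) := by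
    have h1 := abs_pow_sub_pow_le_mul N (x := b + C₀) (y := a - C₀) (b := 2 * b)
      (by rw [abs_of_nonneg (by linarith)]; linarith)
      (by rw [abs_of_nonneg (by linarith)]; linarith)
    refine (le_abs_self _).trans (h1.trans ?_)
    rw [abs_of_nonneg (by linarith), mul_pow]
    have h2 : b + C₀ - (a - C₀) ≤ 2 * C₀ * (b - a + 1) := by nlinarith
    calc _ ≤ N * (2 ^ (N - 1) * b ^ (N - 1)) * (2 * C₀ * (b - a + 1)) := by gcongr
      _ = _ := by ring
  set B : ℝ := N * 2 ^ (N - 1) * (2 * C₀) * ((b - a + 1) * b ^ (N - 1)) with hB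
  have hB0 : 0 ≤ B := by
    have : 0 ≤ b - a + 1 := by linarith
    positivity
  calc _ ≤ volume (⋃ ie : Fin (N + 1) × Bool, {X : Fin (N + 1) → ℝ | (a < q X ∧ q X ≤ b) ∧
          a / A ≤ (if ie.2 then 1 else -1 : ℝ) * X ie.1 ∧ diagForm σ d X ∈ J}) := by
        refine measure_mono ?_
        rintro X ⟨h1, h2⟩
        obtain ⟨i, hi⟩ := exists_abs_eq_norm X
        have h3 : a / A ≤ |X i| := by
          rw [hi, div_le_iff₀ hA0, mul_comm]
          exact h1.1.le.trans (hq.le_norm X)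
        rcases le_abs.1 h3 with h | h
        · exact Set.mem_iUnion.2 ⟨(i, true), h1, by simpa using h, h2⟩
        · exact Set.mem_iUnion.2 ⟨(i, false), h1, by simpa using h, h2⟩
    _ ≤ ∑ ie : Fin (N + 1) × Bool, ENNReal.ofReal (B * V ie) *
          (ENNReal.ofReal (2 / (a / A) ^ (d - 1)) * volume J) := by
        refine (measure_iUnion_fintype_le _ _).trans (Finset.sum_le_sum fun ie _ => ?_)
        refine (hV ie a b (by linarith) (by linarith) hab J hJ hJM).trans ?_
        gcongr
        exact hV0 ie
    _ = ENNReal.ofReal (B * V₀) * (ENNReal.ofReal (2 / (a / A) ^ (d - 1)) * volume J) := by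
        rw [← Finset.sum_mul, ← ENNReal.ofReal_sum_of_nonneg fun ie _ => mul_nonneg hB0 (hV0 ie),
          ← Finset.mul_sum]
    _ ≤ _ := by
      rw [← mul_assoc, ← ENNReal.ofReal_mul (by positivity)]
      refine mul_le_mul_left (ENNReal.ofReal_le_ofReal ?_) _
      rw [hB, div_pow]
      have h1 : 0 ≤ (b - a + 1) * b ^ (N - 1) / a ^ (d - 1) := by
        have : 0 ≤ b - a + 1 := by linarith
        positivity
      refine le_trans (le_of_eq ?_)
        (mul_le_mul_of_nonneg_right (le_add_of_nonneg_right zero_le_one) h1)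
      field_simp

/-- For a fixed lattice, the mass of a thin Euclidean shell on which the form takes values
in `J`. -/
lemma exists_volume_shell_act_le {N d : ℕ} (hd : 1 ≤ d) (hde : Even d) {σ : Fin (N + 1) → ℝ}
    (hσ : IsSign σ) {M₀ : ℝ} (hM₀ : 1 ≤ M₀) (g : SLR (N + 1)) :
    ∃ K : ℝ, 0 < K ∧ ∃ a₀ : ℝ, 0 < a₀ ∧ ∀ a b : ℝ, a₀ ≤ a → a ≤ b → ∀ J : Set ℝ,
      MeasurableSet J → (∀ s ∈ J, |s| ≤ M₀) →
      volume {x : Fin (N + 1) → ℝ | (a < eucNorm x ∧ eucNorm x ≤ b) ∧ diagForm σ d (act x g) ∈ J}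
        ≤ ENNReal.ofReal (K * ((b - a + 1) * b ^ (N - 1) / a ^ (d - 1))) * volume J := by
  obtain ⟨A, hA, hq⟩ := quasiNorm_eucNorm_act g⁻¹
  obtain ⟨K, hK, a₀, ha₀, h⟩ := hq.exists_volume_shell_le hA hM₀ hσ hd hde
  refine ⟨K, hK, a₀, ha₀, fun a b ha hab J hJ hJM => ?_⟩
  refine le_trans (le_of_eq ?_) (h a b ha hab J hJ hJM)
  rw [← volume_preimage_act g {X | (a < eucNorm (act X g⁻¹) ∧ eucNorm (act X g⁻¹) ≤ b) ∧
    diagForm σ d X ∈ J}]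
  simp only [Set.preimage_ofPred_eq, act_act_inv]

end deterministicShell

section deterministicBall

variable {e r : ℕ} {σ : Fin (e + r + 1) → ℝ}

lemma exists_volume_ball_act_le (hde : Even (e + 1)) (hσ : IsSign σ) (hr : 1 ≤ r) {M₀ : ℝ}
    (hM₀ : 1 ≤ M₀) (g : SLR (e + r + 1)) :
    ∃ K : ℝ, 0 < K ∧ ∃ a₀ : ℝ, 0 < a₀ ∧ ∀ t : ℝ, a₀ ≤ t → ∀ J : Set ℝ,
      MeasurableSet J → (∀ s ∈ J, |s| ≤ M₀) →
      volume {x : Fin (e + r + 1) → ℝ | eucNorm x ≤ t ∧ diagForm σ (e + 1) (act x g) ∈ J}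
        ≤ ENNReal.ofReal K + ENNReal.ofReal (K * t ^ r) * volume J := by
  obtain ⟨K, hK, a₀, ha₀, h⟩ := exists_volume_shell_act_le (by omega) hde hσ hM₀ g
  set v₀ := (volume {x : Fin (e + r + 1) → ℝ | eucNorm x ≤ a₀}).toReal with hv₀
  have hv₀0 : 0 ≤ v₀ := ENNReal.toReal_nonneg
  set K₂ := K * (1 + 1 / a₀) * 2 ^ (e + r - 1) with hK₂
  have hind : ∀ j : ℕ, ∀ J : Set ℝ, MeasurableSet J → (∀ s ∈ J, |s| ≤ M₀) →
      volume {x : Fin (e + r + 1) → ℝ |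
        eucNorm x ≤ a₀ * 2 ^ j ∧ diagForm σ (e + 1) (act x g) ∈ J}
        ≤ ENNReal.ofReal v₀ + ENNReal.ofReal (K₂ * (a₀ * 2 ^ j) ^ r) * volume J := by
    intro j J hJ hJM
    induction j with
    | zero =>
      refine le_trans (measure_mono fun x hx => ?_) (le_add_of_le_of_nonneg
        (ENNReal.ofReal_toReal (volume_eucNorm_le_lt_top a₀).ne).ge zero_le)
      simpa using hx.1
    | succ j ih =>
      set a := a₀ * 2 ^ j with ha
      have ha0 : a₀ ≤ a := le_mul_of_one_le_right ha₀.le (one_le_pow₀ (by norm_num))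
      have ha1 : 0 < a := by linarith
      have hb : a₀ * 2 ^ (j + 1) = 2 * a := by rw [ha]; ring
      rw [hb]
      have hstep := h a (2 * a) ha0 (by linarith) J hJ hJM
      have hcoef : K * ((2 * a - a + 1) * (2 * a) ^ (e + r - 1) / a ^ (e + 1 - 1))
          ≤ K₂ * a ^ r := by
        have h1 : (2 * a - a + 1) ≤ (1 + 1 / a₀) * a := by
          have : 1 ≤ 1 / a₀ * a := by rw [one_div, ← div_eq_inv_mul, le_div_iff₀ ha₀]; linarith
          linarith
        have h2 : a * a ^ (e + r - 1) = a ^ r * a ^ e := by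
          rw [← pow_succ', ← pow_add]; congr 1; omega
        rw [Nat.add_sub_cancel, mul_pow, hK₂, ← mul_div_assoc, div_le_iff₀ (by positivity)]
        calc _ ≤ K * ((1 + 1 / a₀) * a * (2 ^ (e + r - 1) * a ^ (e + r - 1))) := by gcongr
          _ = K * (1 + 1 / a₀) * 2 ^ (e + r - 1) * (a * a ^ (e + r - 1)) := by ring
          _ = _ := by rw [h2]; ring
      have hK₂0 : 0 ≤ K₂ := by positivity
      calc _ ≤ volume ({x : Fin (e + r + 1) → ℝ |
                eucNorm x ≤ a ∧ diagForm σ (e + 1) (act x g) ∈ J} ∪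
              {x | (a < eucNorm x ∧ eucNorm x ≤ 2 * a) ∧ diagForm σ (e + 1) (act x g) ∈ J}) := by
            refine measure_mono ?_
            rintro x ⟨h1, h2⟩
            rcases le_or_gt (eucNorm x) a with h3 | h3
            · exact Or.inl ⟨h3, h2⟩
            · exact Or.inr ⟨⟨h3, h1⟩, h2⟩
        _ ≤ (ENNReal.ofReal v₀ + ENNReal.ofReal (K₂ * a ^ r) * volume J)
              + ENNReal.ofReal (K₂ * a ^ r) * volume J := by
            refine (measure_union_le _ _).trans (add_le_add ih (hstep.trans ?_))
            exact mul_le_mul_left (ENNReal.ofReal_le_ofReal hcoef) _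
        _ ≤ _ := by
          rw [add_assoc, ← add_mul, ← ENNReal.ofReal_add (by positivity) (by positivity)]
          refine add_le_add le_rfl (mul_le_mul_left (ENNReal.ofReal_le_ofReal ?_) _)
          have h2 : (2 : ℝ) ≤ 2 ^ r := by
            calc (2 : ℝ) = 2 ^ 1 := by norm_num
              _ ≤ _ := pow_le_pow_right₀ (by norm_num) hr
          rw [mul_pow 2 a]
          nlinarith [mul_nonneg hK₂0 (pow_nonneg ha1.le r)]
  refine ⟨v₀ + K₂ * 2 ^ r, by positivity, a₀, ha₀, fun t ht J hJ hJM => ?_⟩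
  obtain ⟨j, hj1, hj2⟩ := exists_nat_pow_near (x := t / a₀) (y := 2)
    (by rw [le_div_iff₀ ha₀]; linarith) (by norm_num)
  rw [le_div_iff₀ ha₀] at hj1
  rw [div_lt_iff₀ ha₀] at hj2
  refine (measure_mono ?_).trans ((hind (j + 1) J hJ hJM).trans ?_)
  · rintro x ⟨h1, h2⟩
    exact ⟨by linarith, h2⟩
  · refine add_le_add (ENNReal.ofReal_le_ofReal (le_add_of_nonneg_right (by positivity)))
      (mul_le_mul_left (ENNReal.ofReal_le_ofReal ?_) _)
    have ht0 : 0 < t := by linarith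
    calc K₂ * (a₀ * 2 ^ (j + 1)) ^ r ≤ K₂ * (2 * t) ^ r := by
          refine mul_le_mul_of_nonneg_left (pow_le_pow_left₀ (by positivity) ?_ _) (by positivity)
          rw [pow_succ]; linarith
      _ = K₂ * 2 ^ r * t ^ r := by rw [mul_pow]; ring
      _ ≤ _ := by
        gcongr
        linarith

/-- For a fixed lattice, the change of the mass of a ball when both the radius and the set of values
change slightly. -/
lemma exists_volume_ball_act_sub_le (hde : Even (e + 1)) (hσ : IsSign σ) (hr : 1 ≤ r) {M₀ : ℝ}
    (hM₀ : 1 ≤ M₀) (g : SLR (e + r + 1)) :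
    ∃ K : ℝ, 0 < K ∧ ∃ a₀ : ℝ, 0 < a₀ ∧ ∀ a b : ℝ, a₀ ≤ a → a ≤ b → ∀ J J' : Set ℝ,
      MeasurableSet J → MeasurableSet J' → J' ⊆ J → (∀ s ∈ J, |s| ≤ M₀) →
      (volume {x : Fin (e + r + 1) → ℝ |
          eucNorm x ≤ b ∧ diagForm σ (e + 1) (act x g) ∈ J}).toReal
        ≤ (volume {x : Fin (e + r + 1) → ℝ |
            eucNorm x ≤ a ∧ diagForm σ (e + 1) (act x g) ∈ J'}).toReal
          + K * ((b - a + 1) * b ^ (e + r - 1) / a ^ e * (volume J).toReal + 1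
            + a ^ r * ((volume J).toReal - (volume J').toReal)) := by
  obtain ⟨K, hK, a₀, ha₀, h⟩ := exists_volume_shell_act_le (by omega) hde hσ hM₀ g
  obtain ⟨K', hK', a₁, ha₁, h'⟩ := exists_volume_ball_act_le hde hσ hr hM₀ g
  refine ⟨K + K', by positivity, max a₀ a₁, by positivity,
    fun a b ha hab J J' hJ hJ' hsub hJM => ?_⟩
  have ha0 : a₀ ≤ a := (le_max_left _ _).trans ha
  have ha1 : a₁ ≤ a := (le_max_right _ _).trans ha
  have hapos : 0 < a := by linarith
  have hbpos : 0 < b := by linarith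
  have hfin : volume J ≠ ⊤ := by
    refine ne_top_of_le_ne_top ?_ (measure_mono (?_ : J ⊆ Set.Icc (-M₀) M₀))
    · rw [Real.volume_Icc]; exact ENNReal.ofReal_ne_top
    · exact fun s hs => abs_le.1 (hJM s hs)
  have hfin' : volume J' ≠ ⊤ := ne_top_of_le_ne_top hfin (measure_mono hsub)
  have hdiff : volume (J \ J') = ENNReal.ofReal ((volume J).toReal - (volume J').toReal) := by
    rw [measure_sdiff hsub hJ'.nullMeasurableSet hfin', ENNReal.ofReal_sub _ ENNReal.toReal_nonneg,
      ENNReal.ofReal_toReal hfin, ENNReal.ofReal_toReal hfin']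
  have hL : 0 ≤ (volume J).toReal - (volume J').toReal :=
    sub_nonneg.2 (ENNReal.toReal_mono hfin (measure_mono hsub))
  have hL' : 0 ≤ (volume J).toReal := ENNReal.toReal_nonneg
  have hfinV : volume {x : Fin (e + r + 1) → ℝ |
      eucNorm x ≤ a ∧ diagForm σ (e + 1) (act x g) ∈ J'} ≠ ⊤ :=
    ne_top_of_le_ne_top (volume_eucNorm_le_lt_top a).ne (measure_mono fun x hx => hx.1)
  have hba : 0 ≤ b - a + 1 := by linarith
  set s := (b - a + 1) * b ^ (e + r - 1) / a ^ e with hs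
  have hs0 : 0 ≤ s := by positivity
  have hX : 0 ≤ K * s * (volume J).toReal := by positivity
  have hY : 0 ≤ K' * a ^ r * ((volume J).toReal - (volume J').toReal) :=
    mul_nonneg (by positivity) hL
  refine ENNReal.toReal_le_of_le_ofReal
    (add_nonneg ENNReal.toReal_nonneg (mul_nonneg (by positivity)
      (add_nonneg (by positivity) (mul_nonneg (by positivity) hL)))) ?_
  calc _ ≤ volume ({x : Fin (e + r + 1) → ℝ |
              eucNorm x ≤ a ∧ diagForm σ (e + 1) (act x g) ∈ J'} ∪
            ({x | (a < eucNorm x ∧ eucNorm x ≤ b) ∧ diagForm σ (e + 1) (act x g) ∈ J} ∪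
            {x | eucNorm x ≤ a ∧ diagForm σ (e + 1) (act x g) ∈ J \ J'})) := by
        refine measure_mono ?_
        rintro x ⟨h1, h2⟩
        rcases le_or_gt (eucNorm x) a with h3 | h3
        · by_cases h4 : diagForm σ (e + 1) (act x g) ∈ J'
          · exact Or.inl ⟨h3, h4⟩
          · exact Or.inr (Or.inr ⟨h3, h2, h4⟩)
        · exact Or.inr (Or.inl ⟨⟨h3, h1⟩, h2⟩)
    _ ≤ ENNReal.ofReal (volume {x : Fin (e + r + 1) → ℝ |
              eucNorm x ≤ a ∧ diagForm σ (e + 1) (act x g) ∈ J'}).toReal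
          + (ENNReal.ofReal (K * s * (volume J).toReal)
            + (ENNReal.ofReal K'
              + ENNReal.ofReal (K' * a ^ r * ((volume J).toReal - (volume J').toReal)))) := by
        refine (measure_union_le _ _).trans (add_le_add (ENNReal.ofReal_toReal hfinV).ge
          ((measure_union_le _ _).trans (add_le_add ?_ ?_)))
        · refine (h a b ha0 hab J hJ hJM).trans (le_of_eq ?_)
          rw [ENNReal.ofReal_mul (p := K * s) (by positivity), ENNReal.ofReal_toReal hfin,
            Nat.add_sub_cancel]
        · refine (h' a ha1 (J \ J') (hJ.diff hJ') fun s hs => hJM s hs.1).trans (le_of_eq ?_)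
          rw [ENNReal.ofReal_mul (p := K' * a ^ r) (by positivity), hdiff]
    _ ≤ _ := by
      rw [← ENNReal.ofReal_add hK'.le hY, ← ENNReal.ofReal_add hX (by positivity),
        ← ENNReal.ofReal_add ENNReal.toReal_nonneg (by positivity)]
      refine ENNReal.ofReal_le_ofReal (add_le_add le_rfl ?_)
      have h1 : 0 ≤ K' * (s * (volume J).toReal) := by positivity
      have h2 : 0 ≤ K * (a ^ r * ((volume J).toReal - (volume J').toReal)) :=
        mul_nonneg hK.le (mul_nonneg (by positivity) hL)
      linarith

end deterministicBall

section almostEverywhere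

/-- A Borel–Cantelli lemma. -/
lemma ae_eventually_lt_of_summable {G : Type*} [MeasurableSpace G] {ν : Measure G}
    {E : ℕ → G → ℝ} (hE0 : ∀ k g, 0 ≤ E k g) (hE : ∀ k, Integrable (E k) ν) {w b : ℕ → ℝ}
    (hw : ∀ k, 0 < w k) (hb : Summable fun k => b k / w k)
    (h : ∀ᶠ k in Filter.atTop, ∫ g, E k g ∂ν ≤ b k) :
    ∀ᵐ g ∂ν, ∀ᶠ k in Filter.atTop, E k g < w k := by
  obtain ⟨k₀, hk₀⟩ := Filter.eventually_atTop.1 h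
  have hb' : Summable fun k => b (k + k₀) / w (k + k₀) := (summable_nat_add_iff k₀).2 hb
  have hms : ∀ k, ν {g | w (k + k₀) ≤ E (k + k₀) g}
      ≤ ENNReal.ofReal (b (k + k₀) / w (k + k₀)) := by
    intro k
    have h1 := meas_ge_le_lintegral_div (μ := ν) (f := fun g => ENNReal.ofReal (E (k + k₀) g))
      (hE _).aemeasurable.ennreal_ofReal (ε := ENNReal.ofReal (w (k + k₀)))
      (by simpa using hw (k + k₀)) ENNReal.ofReal_ne_top
    have h2 : {g | ENNReal.ofReal (w (k + k₀)) ≤ ENNReal.ofReal (E (k + k₀) g)}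
        = {g | w (k + k₀) ≤ E (k + k₀) g} := by
      ext g
      exact ENNReal.ofReal_le_ofReal_iff (hE0 _ _)
    rw [h2, ← ofReal_integral_eq_lintegral_ofReal (hE _)
      (Filter.Eventually.of_forall fun g => hE0 _ g), ← ENNReal.ofReal_div_of_pos (hw _)] at h1
    refine h1.trans (ENNReal.ofReal_le_ofReal ?_)
    have := hw (k + k₀)
    gcongr
    exact hk₀ _ (by omega)
  have hsum : (∑' k, ν {g | w (k + k₀) ≤ E (k + k₀) g}) ≠ ⊤ :=
    ne_top_of_le_ne_top hb'.tsum_ofReal_ne_top (ENNReal.tsum_le_tsum hms)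
  filter_upwards [ae_eventually_notMem hsum] with g hg
  obtain ⟨k₁, hk₁⟩ := Filter.eventually_atTop.1 hg
  refine Filter.eventually_atTop.2 ⟨k₁ + k₀, fun k hk => ?_⟩
  have := hk₁ (k - k₀) (by omega)
  rw [Nat.sub_add_cancel (by omega)] at this
  exact not_le.1 this

variable {n : ℕ}

/-- The volume of the region of `x` in a ball with `x g ∈ F₀⁻¹(J)`. -/
def ballVol (σ : Fin n → ℝ) (d : ℕ) (J : Set ℝ) (t : ℝ) (g : SLR n) : ℝ :=
  (volume {x : Fin n → ℝ | eucNorm x ≤ t ∧ diagForm σ d (act x g) ∈ J}).toReal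

lemma measurable_diagForm_act (σ : Fin n → ℝ) (d : ℕ) (g : SLR n) :
    Measurable fun x : Fin n → ℝ => diagForm σ d (act x g) :=
  (measurable_diagForm σ d).comp (measurable_act.comp (measurable_id.prodMk measurable_const))

lemma massOn_hitVal {σ : Fin n → ℝ} {d : ℕ} {J : Set ℝ} (hJ : MeasurableSet J) (t : ℝ)
    (g : SLR n) : massOn (hitVal σ d J) {x | eucNorm x ≤ t} g = ballVol σ d J t g := by
  have hm : MeasurableSet {x : Fin n → ℝ | diagForm σ d (act x g) ∈ J} :=
    measurable_diagForm_act σ d g hJ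
  have h : (fun x => hitVal σ d J x g)
      = {x : Fin n → ℝ | diagForm σ d (act x g) ∈ J}.indicator fun _ => (1 : ℝ) := by
    funext x
    rfl
  rw [massOn, h, setIntegral_indicator hm, setIntegral_const, smul_eq_mul, mul_one]
  rfl

lemma hitFam_eq_hitVal (σ : Fin n → ℝ) (d : ℕ) (J : Set ℝ) {R : ℝ} {g : SLR n}
    (hg : slSize g ≤ R) (x : Fin n → ℝ) : hitFam σ d J R x g = hitVal σ d J x g :=
  Set.indicator_of_mem (show g ∈ slBall n R from hg) _

lemma ae_of_forall_ae_weightMeasure {μ : Measure (SLR n)} {Q : SLR n → Prop}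
    (h : ∀ R : ℕ, ∀ᵐ g ∂(weightMeasure μ R), slSize g ≤ R → Q g) : ∀ᵐ g ∂μ, Q g := by
  have h' : ∀ᵐ g ∂μ, ∀ R : ℕ, ENNReal.ofReal (weight R g) ≠ 0 → slSize g ≤ R → Q g :=
    ae_all_iff.2 fun R => (ae_withDensity_iff (measurable_weight R).ennreal_ofReal).1 (h R)
  filter_upwards [h'] with g hg
  obtain ⟨R, hR⟩ := exists_nat_gt (slSize g)
  refine hg R ?_ hR.le
  have : 0 < weight R g := lt_max_of_lt_right (by linarith)
  simpa using this

lemma ae_eventually_abs_ballCount_sub_ballVol_lt {e r M : ℕ} (hn : n = e + 1 + r) (he : 1 ≤ e)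
    (hr : 1 ≤ r) (hM : e + 2 ≤ M) (hde : Even (e + 1)) {σ : Fin n → ℝ} (hσ : IsSign σ)
    (μ : Measure (SLR n)) [μ.IsHaarMeasure] {J : ℕ → Set ℝ} (hJ : ∀ k, MeasurableSet (J k))
    (hJfin : ∀ k, volume (J k) ≠ ⊤) {τ : ℕ → ℕ} (hτ : Filter.Tendsto τ Filter.atTop Filter.atTop)
    {w : ℕ → ℝ} (hw : ∀ k, 0 < w k)
    (hsum : Summable fun k => (1 + (volume (J k)).toReal * ((τ k : ℝ) ^ (8 * M)) ^ r / τ k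
      + √((volume (J k)).toReal * ((τ k : ℝ) ^ (8 * M)) ^ r) * (τ k : ℝ) ^ n) / w k) :
    ∀ᵐ g ∂μ, ∀ᶠ k in Filter.atTop,
      |ballCount (hitVal σ (e + 1) (J k)) ((τ k : ℝ) ^ (8 * M)) g
        - ballVol σ (e + 1) (J k) ((τ k : ℝ) ^ (8 * M)) g| < w k := by
  obtain ⟨m, rfl⟩ : ∃ m, n = m + 3 := ⟨n - 3, by omega⟩
  refine ae_of_forall_ae_weightMeasure fun R => ?_
  obtain ⟨C, hC, hcorr⟩ := exists_corrBound_hitFam (by omega) hde hσ μ (Nat.cast_nonneg R)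
  obtain ⟨K, hK, τ₀, hmean⟩ := CorrBound.exists_integral_abs_sub_le hn hr hM C hC
  have hunit : ∀ k, UnitFamily (hitFam σ (e + 1) (J k) R) := fun k =>
    (hcorr _ (hJ k) (hJfin k)).unit
  have hbc := ae_eventually_lt_of_summable (ν := weightMeasure μ R)
    (E := fun k g => |ballCount (hitFam σ (e + 1) (J k) R) ((τ k : ℝ) ^ (8 * M)) g
      - massOn (hitFam σ (e + 1) (J k) R) {x | eucNorm x ≤ (τ k : ℝ) ^ (8 * M)} g|)
    (fun k g => abs_nonneg _)
    (fun k => (((hunit k).integrable_ballCount _).sub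
      ((hunit k).integrable_massOn (volume_eucNorm_le_lt_top _))).abs) hw
    (b := fun k => K * (1 + (volume (J k)).toReal * ((τ k : ℝ) ^ (8 * M)) ^ r / τ k
      + √((volume (J k)).toReal * ((τ k : ℝ) ^ (8 * M)) ^ r) * (τ k : ℝ) ^ (m + 3)))
    (by simpa only [mul_div_assoc] using hsum.mul_left K)
    (by
      filter_upwards [hτ.eventually_ge_atTop τ₀] with k hk
      exact hmean (hcorr _ (hJ k) (hJfin k)) _ hk)
  filter_upwards [hbc] with g hg hgR
  filter_upwards [hg] with k hk
  have h1 : massOn (hitFam σ (e + 1) (J k) R) {x | eucNorm x ≤ (τ k : ℝ) ^ (8 * M)} g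
      = ballVol σ (e + 1) (J k) ((τ k : ℝ) ^ (8 * M)) g := by
    rw [← massOn_hitVal (hJ k)]
    simp only [massOn, hitFam_eq_hitVal _ _ _ hgR]
  have h2 : ballCount (hitFam σ (e + 1) (J k) R) ((τ k : ℝ) ^ (8 * M)) g
      = ballCount (hitVal σ (e + 1) (J k)) ((τ k : ℝ) ^ (8 * M)) g := by
    simp only [ballCount, hitFam_eq_hitVal _ _ _ hgR]
  rw [← h1, ← h2]
  exact hk

end almostEverywhere

section growth

lemma summand_le {n : ℕ} {u β D x τ : ℝ} (hu : 1 ≤ u) (hβ : 6 * n + 6 ≤ β) (hD : 0 ≤ D)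
    (hx : x ≤ D * u ^ β) (hτ : u ^ 3 ≤ τ) (hτ' : τ ≤ 8 * u ^ 3) :
    (1 + x / τ + √x * τ ^ n) / u ^ (β - 1) ≤ (1 + D + √D * 8 ^ n) / u ^ 2 := by
  have hu0 : 0 < u := by linarith
  have hτ0 : 0 < τ := (pow_pos hu0 3).trans_le hτ
  set y := √(u ^ β) with hy
  have hyy : u ^ β = y ^ 2 := (Real.sq_sqrt (Real.rpow_nonneg hu0.le _)).symm
  have hy1 : u ^ (3 * n + 3) ≤ y := by
    refine Real.le_sqrt_of_sq_le ?_
    rw [← pow_mul, ← Real.rpow_natCast]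
    refine Real.rpow_le_rpow_of_exponent_le hu ?_
    push_cast
    linarith
  have hy0 : 0 < y := (pow_pos hu0 _).trans_le hy1
  have hw : u ^ (β - 1) = y ^ 2 / u := by rw [Real.rpow_sub hu0, Real.rpow_one, hyy]
  have h3y : u ^ 3 ≤ y := (pow_le_pow_right₀ hu (by omega)).trans hy1
  have hone : 1 * u ^ 3 ≤ y ^ 2 := by
    have : 1 ≤ u ^ 3 := one_le_pow₀ hu
    nlinarith
  have hxτ : x / τ * u ^ 3 ≤ D * y ^ 2 := by
    rw [hyy] at hx
    calc x / τ * u ^ 3 ≤ D * y ^ 2 / τ * u ^ 3 := by gcongr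
      _ = D * y ^ 2 * (u ^ 3 / τ) := by ring
      _ ≤ D * y ^ 2 * 1 := by gcongr; exact (div_le_one hτ0).2 hτ
      _ = _ := mul_one _
  have hsq : √x * τ ^ n * u ^ 3 ≤ √D * 8 ^ n * y ^ 2 := by
    have h1 : √x ≤ √D * y := by
      rw [← Real.sqrt_mul hD]
      exact Real.sqrt_le_sqrt hx
    have h2 : τ ^ n ≤ 8 ^ n * u ^ (3 * n) := by
      rw [pow_mul, ← mul_pow]
      exact pow_le_pow_left₀ hτ0.le hτ' n
    calc √x * τ ^ n * u ^ 3 ≤ √D * y * (8 ^ n * u ^ (3 * n)) * u ^ 3 := by gcongr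
      _ = √D * 8 ^ n * y * u ^ (3 * n + 3) := by ring
      _ ≤ √D * 8 ^ n * y * y := by gcongr
      _ = _ := by ring
  rw [hw, div_div_eq_mul_div, div_le_div_iff₀ (by positivity) (by positivity)]
  nlinarith

lemma summable_summand {n : ℕ} {β D : ℝ} (hβ : 6 * n + 6 ≤ β) (hD : 0 ≤ D) {x : ℕ → ℝ}
    {τ : ℕ → ℕ} (hx0 : ∀ k, 0 ≤ x k) (hx : ∀ k, x k ≤ D * ((k : ℝ) + 1) ^ β)
    (hτ : ∀ k, (k + 1) ^ 3 ≤ τ k) (hτ' : ∀ k, τ k ≤ 8 * (k + 1) ^ 3) :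
    Summable fun k => (1 + x k / τ k + √(x k) * (τ k : ℝ) ^ n) / ((k : ℝ) + 1) ^ (β - 1) := by
  have h : Summable fun k : ℕ => (1 + D + √D * 8 ^ n) / ((k : ℝ) + 1) ^ 2 := by
    have h2 := (summable_nat_add_iff 1).2 (Real.summable_one_div_nat_pow.2 one_lt_two)
    simpa [div_eq_mul_inv] using h2.mul_left (1 + D + √D * 8 ^ n)
  refine Summable.of_nonneg_of_le (fun k => ?_) (fun k => ?_) h
  · have := hx0 k
    positivity
  · exact summand_le (by linarith [(Nat.cast_nonneg k : (0 : ℝ) ≤ k)]) hβ hD (hx k)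
      (by exact_mod_cast hτ k) (by exact_mod_cast hτ' k)

lemma one_sub_div_le_rpow {u p : ℝ} (hu : 0 < u) (hp : 0 ≤ p) :
    1 - (p + 1) / u ≤ (u / (u + 1)) ^ p := by
  have hx0 : 0 < u / (u + 1) := by positivity
  have hx1 : u / (u + 1) ≤ 1 := (div_le_one (by positivity)).2 (by linarith)
  have hx : u / (u + 1) = 1 + -(1 / (u + 1)) := by field_simp; ring
  have h1 : 1 / (u + 1) ≤ 1 / u := by gcongr; linarith
  have h2 : 1 / (u + 1) ≤ 1 := (div_le_one (by positivity)).2 (by linarith)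
  calc 1 - (p + 1) / u = 1 - (p + 1) * (1 / u) := by ring
    _ ≤ 1 + (p + 1) * -(1 / (u + 1)) := by nlinarith
    _ ≤ (1 + -(1 / (u + 1))) ^ (p + 1) :=
      one_add_mul_self_le_rpow_one_add (by linarith) (by linarith)
    _ = (u / (u + 1)) ^ (p + 1) := by rw [hx]
    _ ≤ _ := Real.rpow_le_rpow_of_exponent_ge hx0 hx1 (by linarith)

lemma volume_increment_le {e r P : ℕ} {c κ u : ℝ} (hr : 1 ≤ r) (hP : 1 ≤ P)
    (hc : 0 < c) (hκ : 0 < κ) (hu : 1 ≤ u) (hβ : 1 ≤ P * (r - κ)) :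
    ((u + 1) ^ P - u ^ P + 1) * ((u + 1) ^ P) ^ (e + r - 1) / (u ^ P) ^ e
        * (c * (u ^ P) ^ (-κ)) + 1
        + (u ^ P) ^ r * (c * (u ^ P) ^ (-κ) - c * ((u + 1) ^ P) ^ (-κ))
      ≤ ((P * 2 ^ (P - 1) + 1) * (2 ^ P) ^ (e + r - 1) * c + 1 + c * (P * κ + 1))
        * u ^ (P * (r - κ) - 1) := by
  have hu0 : 0 < u := by linarith
  set a := u ^ P with ha
  set b := (u + 1) ^ P with hb
  have ha0 : 0 < a := pow_pos hu0 P
  have hb0 : 0 < b := by positivity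
  have hba : b ≤ 2 ^ P * a := by
    rw [ha, hb, ← mul_pow]; exact pow_le_pow_left₀ (by linarith) (by linarith) P
  have hw : u ^ (P * (r - κ) - 1) = a ^ r * a ^ (-κ) / u := by
    rw [Real.rpow_sub hu0, Real.rpow_one, mul_sub, Real.rpow_sub hu0, ha, ← pow_mul,
      ← Real.rpow_natCast u P, ← Real.rpow_mul hu0.le, mul_neg, Real.rpow_neg hu0.le,
      ← Real.rpow_natCast, div_eq_mul_inv (u ^ _) (u ^ _)]
    push_cast
    rfl
  set A := a ^ (-κ) with hA
  have hA0 : 0 < A := Real.rpow_pos_of_pos ha0 _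
  have hone : 1 ≤ u ^ (P * (r - κ) - 1) := Real.one_le_rpow hu (by linarith)
  have hgap : b - a + 1 ≤ (P * 2 ^ (P - 1) + 1) * (a / u) := by
    have h1 := abs_pow_sub_pow_le_mul P (x := u + 1) (y := u) (b := 2 * u)
      (by rw [abs_of_nonneg (by linarith)]; linarith)
        (by rw [abs_of_nonneg (by linarith)]; linarith)
    rw [add_sub_cancel_left, abs_one, mul_one, mul_pow] at h1
    have h2 : a / u = u ^ (P - 1) := by
      rw [ha, div_eq_iff hu0.ne', ← pow_succ]; congr 1; omega
    have h3 : 1 ≤ u ^ (P - 1) := one_le_pow₀ hu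
    rw [h2]
    have := le_abs_self (b - a)
    nlinarith
  have hbpow : b ^ (e + r - 1) ≤ (2 ^ P) ^ (e + r - 1) * a ^ (e + r - 1) := by
    rw [← mul_pow]; exact pow_le_pow_left₀ hb0.le hba _
  have hbA : A - b ^ (-κ) ≤ A * ((P * κ + 1) / u) := by
    have h1 : b ^ (-κ) = A * (u / (u + 1)) ^ (P * κ) := by
      rw [Real.rpow_mul (by positivity), Real.rpow_natCast, div_pow, ← ha, ← hb,
        Real.div_rpow ha0.le hb0.le, hA, Real.rpow_neg ha0.le, Real.rpow_neg hb0.le]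
      have := (Real.rpow_pos_of_pos ha0 κ).ne'
      field_simp
    rw [h1]
    have := one_sub_div_le_rpow hu0 (by positivity : 0 ≤ P * κ)
    nlinarith
  have h1 : (b - a + 1) * b ^ (e + r - 1) / a ^ e * (c * A)
      ≤ (P * 2 ^ (P - 1) + 1) * (2 ^ P) ^ (e + r - 1) * c * (a ^ r * A / u) := by
    calc _ ≤ (P * 2 ^ (P - 1) + 1) * (a / u) * ((2 ^ P) ^ (e + r - 1) * a ^ (e + r - 1)) / a ^ e
          * (c * A) := by gcongr
      _ = (P * 2 ^ (P - 1) + 1) * (2 ^ P) ^ (e + r - 1) * c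
          * (a * a ^ (e + r - 1) / a ^ e * A / u) := by ring
      _ = _ := by
        have : a * a ^ (e + r - 1) = a ^ r * a ^ e := by
          rw [← pow_succ', ← pow_add]; congr 1; omega
        rw [this, mul_div_cancel_right₀ _ (pow_pos ha0 e).ne']
  have h2 : a ^ r * (c * A - c * b ^ (-κ)) ≤ c * (P * κ + 1) * (a ^ r * A / u) := by
    calc _ = a ^ r * c * (A - b ^ (-κ)) := by ring
      _ ≤ a ^ r * c * (A * ((P * κ + 1) / u)) := by gcongr
      _ = _ := by ring
  rw [← hw] at h1 h2
  linarith

lemma eventually_mul_rpow_lt {β B c' : ℝ} (hβ : 0 < β) (hc' : 0 < c') :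
    ∀ᶠ u : ℝ in Filter.atTop,
      B * u ^ (β - 1) < (c' * u ^ β) ^ (1 - 1 / (2 * β)) := by
  have h := (tendsto_rpow_atTop (by norm_num : (0 : ℝ) < 1 / 2)).eventually_gt_atTop
    (B / c' ^ (1 - 1 / (2 * β)))
  filter_upwards [h, Filter.eventually_gt_atTop 0] with u hu hu0
  have hcp : 0 < c' ^ (1 - 1 / (2 * β)) := Real.rpow_pos_of_pos hc' _
  rw [div_lt_iff₀ hcp] at hu
  rw [Real.mul_rpow hc'.le (Real.rpow_nonneg hu0.le _), ← Real.rpow_mul hu0.le,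
    show β * (1 - 1 / (2 * β)) = 1 / 2 + (β - 1) by field_simp; ring, Real.rpow_add hu0]
  have := mul_lt_mul_of_pos_right hu (Real.rpow_pos_of_pos hu0 (β - 1))
  linarith

end growth

section conclusion

variable {n : ℕ}

lemma ballCount_hitVal_mono (σ : Fin n → ℝ) (d : ℕ) {J J' : Set ℝ} {t t' : ℝ} (hJ : J ⊆ J')
    (ht : t ≤ t') (g : SLR n) :
    ballCount (hitVal σ d J) t g ≤ ballCount (hitVal σ d J') t' g := by
  calc _ ≤ ∑ v ∈ ballPts n t, hitVal σ d J' (intVec v) g := by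
        refine Finset.sum_le_sum fun v _ => ?_
        have hsub : hit σ d J (intVec v) ⊆ hit σ d J' (intVec v) := fun g hg => hJ hg
        exact Set.indicator_le_indicator_of_subset hsub (fun _ => zero_le_one) g
    _ ≤ _ := Finset.sum_le_sum_of_subset_of_nonneg
        (fun v hv => mem_ballPts.2 ((mem_ballPts.1 hv).trans ht)) fun v _ _ => hitVal_nonneg _ _

lemma ballVol_mono (σ : Fin n → ℝ) (d : ℕ) {J J' : Set ℝ} {t t' : ℝ} (hJ : J ⊆ J')
    (ht : t ≤ t') (g : SLR n) : ballVol σ d J t g ≤ ballVol σ d J' t' g :=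
  ENNReal.toReal_mono (ne_top_of_le_ne_top (volume_eucNorm_le_lt_top t').ne
    (measure_mono fun _ hx => hx.1)) (measure_mono fun _ hx => ⟨hx.1.trans ht, hJ hx.2⟩)

lemma exists_le_ballVol {e r : ℕ} (hn : n = e + 1 + r) (he : 1 ≤ e) (hr : 1 ≤ r) {σ : Fin n → ℝ}
    (hσ : IsSign σ) {i j : Fin n} (hi : σ i = 1) (hj : σ j = -1) (g : SLR n) (M₀ : ℝ) :
    ∃ c > 0, ∃ t₀ > 0, ∀ t ≥ t₀, ∀ J : Set ℝ, MeasurableSet J → (∀ s ∈ J, |s| ≤ M₀) →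
      c * (volume J).toReal * t ^ r ≤ ballVol σ (e + 1) J t g := by
  obtain ⟨N, rfl⟩ : ∃ N, n = N + 1 := ⟨n - 1, by omega⟩
  have hij : j ≠ i := by
    rintro rfl
    rw [hi] at hj
    norm_num at hj
  obtain ⟨j', rfl⟩ := Fin.exists_succAbove_eq hij
  have h := exists_le_volume_ball (d := e + 1) (by omega) (by omega) hσ hi hj g M₀
  rwa [show N + 1 - (e + 1) = r by omega] at h

lemma exists_ballVol_sub_le {e r : ℕ} (hn : n = e + 1 + r) (hr : 1 ≤ r) (hde : Even (e + 1))
    {σ : Fin n → ℝ} (hσ : IsSign σ) {M₀ : ℝ} (hM₀ : 1 ≤ M₀) (g : SLR n) :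
    ∃ K : ℝ, 0 < K ∧ ∃ a₀ : ℝ, 0 < a₀ ∧ ∀ a b : ℝ, a₀ ≤ a → a ≤ b → ∀ J J' : Set ℝ,
      MeasurableSet J → MeasurableSet J' → J' ⊆ J → (∀ s ∈ J, |s| ≤ M₀) →
      ballVol σ (e + 1) J b g ≤ ballVol σ (e + 1) J' a g
          + K * ((b - a + 1) * b ^ (e + r - 1) / a ^ e * (volume J).toReal + 1
            + a ^ r * ((volume J).toReal - (volume J').toReal)) := by
  obtain rfl : n = e + r + 1 := by omega
  exact exists_volume_ball_act_sub_le hde hσ hr hM₀ g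

lemma exists_nat_pow_mem_Ico {P : ℕ} (hP : P ≠ 0) {k₀ : ℕ} {t : ℝ} (ht : ((k₀ : ℝ) + 1) ^ P ≤ t) :
    ∃ k : ℕ, k₀ ≤ k ∧ ((k : ℝ) + 1) ^ P ≤ t ∧ t ≤ ((k : ℝ) + 1 + 1) ^ P := by
  have ht0 : 0 ≤ t := le_trans (by positivity) ht
  set s := t ^ ((P : ℝ)⁻¹) with hs
  have hs0 : 0 ≤ s := Real.rpow_nonneg ht0 _
  have hsP : s ^ P = t := Real.rpow_inv_natCast_pow ht0 hP
  have h1 : (k₀ : ℝ) + 1 ≤ s := by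
    rw [← hsP] at ht
    exact (pow_le_pow_iff_left₀ (by positivity) hs0 hP).1 ht
  have h2 : k₀ + 1 ≤ ⌊s⌋₊ := Nat.le_floor (by exact_mod_cast h1)
  have h3 : ((⌊s⌋₊ - 1 : ℕ) : ℝ) + 1 = ⌊s⌋₊ := by
    have : ⌊s⌋₊ - 1 + 1 = ⌊s⌋₊ := by omega
    exact_mod_cast this
  refine ⟨⌊s⌋₊ - 1, by omega, ?_, ?_⟩
  · rw [h3, ← hsP]
    exact pow_le_pow_left₀ (by positivity) (Nat.floor_le hs0) _
  · rw [h3, ← hsP]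
    exact pow_le_pow_left₀ hs0 (Nat.lt_floor_add_one s).le _

theorem exists_ae_abs_ballCount_sub_ballVol_lt {e r : ℕ} (hn : n = e + 1 + r) (he : 1 ≤ e)
    (hr : 1 ≤ r) (hde : Even (e + 1)) {σ : Fin n → ℝ} (hσ : IsSign σ) {i j : Fin n}
    (hi : σ i = 1) (hj : σ j = -1) {κ c : ℝ} (hκ0 : 0 < κ) (hκ : κ < r) (hc : 0 < c)
    {I : ℝ → Set ℝ} (hImeas : ∀ t > (0 : ℝ), MeasurableSet (I t))
    (hIbdd : ∀ t > (0 : ℝ), Bornology.IsBounded (I t))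
    (hIdec : ∀ s t : ℝ, 0 < s → s ≤ t → I t ⊆ I s)
    (hIvol : ∀ t > (0 : ℝ), volume (I t) = ENNReal.ofReal (c * t ^ (-κ)))
    (μ : Measure (SLR n)) [μ.IsHaarMeasure] :
    ∃ δ : ℝ, 0 < δ ∧ δ < 1 ∧ ∀ᵐ g ∂μ, ∃ tg > (0 : ℝ), ∀ t ≥ tg,
      |ballCount (hitVal σ (e + 1) (I t)) t g - ballVol σ (e + 1) (I t) t g|
        < ballVol σ (e + 1) (I t) t g ^ δ := by
  have hα : 0 < r - κ := by linarith
  obtain ⟨M, hM1, hM2⟩ : ∃ M : ℕ, e + 2 ≤ M ∧ (n + 1) / (r - κ) ≤ M := by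
    obtain ⟨M, hM⟩ := exists_nat_ge ((n + 1) / (r - κ))
    exact ⟨M + (e + 2), by omega, hM.trans (by push_cast; linarith)⟩
  rw [div_le_iff₀ hα] at hM2
  set P := 24 * M with hP
  set β : ℝ := P * (r - κ) with hβ
  have hn0 : (0 : ℝ) ≤ n := Nat.cast_nonneg n
  have hβn : 6 * n + 6 ≤ β := by rw [hβ, hP]; push_cast; linarith
  have hβ1 : 1 ≤ β := by linarith
  have hβ0 : 0 < β := by linarith
  have hT0 : ∀ x : ℝ, 0 ≤ x → 0 < (x + 1) ^ P := fun x hx => by positivity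
  have hvol : ∀ t : ℝ, 0 < t → (volume (I t)).toReal = c * t ^ (-κ) := fun t ht => by
    rw [hIvol t ht, ENNReal.toReal_ofReal (by positivity)]
  have hTτ : ∀ k : ℕ, (((k ^ 3 : ℕ) : ℝ)) ^ (8 * M) = (k : ℝ) ^ P := fun k => by
    rw [hP]; push_cast; rw [← pow_mul]; congr 1; ring
  obtain ⟨M₀, hM₀1, hM₀⟩ : ∃ M₀ : ℝ, 1 ≤ M₀ ∧ ∀ t : ℝ, 1 ≤ t → ∀ s ∈ I t, |s| ≤ M₀ := by
    obtain ⟨B, hB⟩ := (hIbdd 1 one_pos).exists_norm_le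
    exact ⟨max 1 B, le_max_left _ _, fun t ht s hs =>
      (hB s (hIdec 1 t one_pos ht hs)).trans (le_max_right _ _)⟩
  have hpow : ∀ x : ℝ, 0 < x → (x ^ P) ^ (-κ) * (x ^ P) ^ r = x ^ β := by
    intro x hx
    rw [← Real.rpow_natCast x P, ← Real.rpow_mul hx.le, ← Real.rpow_natCast, ← Real.rpow_mul hx.le,
      ← Real.rpow_add hx, hβ]
    congr 1; ring
  have hTmono : ∀ k : ℕ, ((k : ℝ) + 1) ^ P ≤ ((k : ℝ) + 1 + 1) ^ P := fun k =>
    pow_le_pow_left₀ (by positivity) (by linarith) P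
  have hsmall := ae_eventually_abs_ballCount_sub_ballVol_lt hn he hr hM1 hde hσ μ
    (J := fun k : ℕ => I (((k : ℝ) + 1 + 1) ^ P)) (τ := fun k => (k + 1) ^ 3)
    (w := fun k => ((k : ℝ) + 1) ^ (β - 1))
    (fun k => hImeas _ (hT0 _ (by positivity)))
    (fun k => by rw [hIvol _ (hT0 _ (by positivity))]; exact ENNReal.ofReal_ne_top)
    ((Filter.tendsto_pow_atTop (by norm_num)).comp (Filter.tendsto_add_atTop_nat 1))
    (fun k => by positivity) (by
      refine summable_summand hβn hc.le (fun k => by positivity) (fun k => ?_) (fun k => le_rfl)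
        fun k => by omega
      rw [hvol _ (hT0 _ (by positivity)), hTτ, mul_assoc, ← hpow _ (by positivity)]
      push_cast
      exact mul_le_mul_of_nonneg_left (mul_le_mul_of_nonneg_right (Real.rpow_le_rpow_of_nonpos
        (hT0 _ (Nat.cast_nonneg k)) (hTmono k) (by linarith)) (by positivity)) hc.le)
  have hlarge := ae_eventually_abs_ballCount_sub_ballVol_lt hn he hr hM1 hde hσ μ
    (J := fun k : ℕ => I (((k : ℝ) + 1) ^ P)) (τ := fun k => (k + 1 + 1) ^ 3)
    (w := fun k => ((k : ℝ) + 1) ^ (β - 1))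
    (fun k => hImeas _ (hT0 _ (by positivity)))
    (fun k => by rw [hIvol _ (hT0 _ (by positivity))]; exact ENNReal.ofReal_ne_top)
    ((Filter.tendsto_pow_atTop (by norm_num)).comp (Filter.tendsto_add_atTop_nat 2))
    (fun k => by positivity) (by
      refine summable_summand (D := c * (2 ^ P) ^ r) hβn (by positivity) (fun k => by positivity)
        (fun k => ?_) (fun k => Nat.pow_le_pow_left (by omega) 3) fun k => ?_
      · rw [hvol _ (hT0 _ (by positivity)), hTτ, ← hpow _ (by positivity)]
        push_cast
        calc _ ≤ c * (((k : ℝ) + 1) ^ P) ^ (-κ) * ((2 * ((k : ℝ) + 1)) ^ P) ^ r := by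
              gcongr
              linarith [(Nat.cast_nonneg k : (0 : ℝ) ≤ k)]
          _ = _ := by rw [mul_pow, mul_pow]; ring
      · calc (k + 1 + 1) ^ 3 ≤ (2 * (k + 1)) ^ 3 := Nat.pow_le_pow_left (by omega) 3
          _ = _ := by ring)
  refine ⟨1 - 1 / (2 * β), ?_, ?_, ?_⟩
  · have : 1 / (2 * β) < 1 := by rw [div_lt_one (by positivity)]; linarith
    linarith
  · have : 0 < 1 / (2 * β) := by positivity
    linarith
  filter_upwards [hsmall, hlarge] with g hgs hgl
  obtain ⟨K, hK, a₀, ha₀, hdiff⟩ := exists_ballVol_sub_le hn hr hde hσ hM₀1 g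
  obtain ⟨c', hc', t₀, ht₀, hlow⟩ := exists_le_ballVol hn he hr hσ hi hj g M₀
  set B := (P * 2 ^ (P - 1) + 1) * (2 ^ P) ^ (e + r - 1) * c + 1 + c * (P * κ + 1) with hB
  have hu : Filter.Tendsto (fun k : ℕ => (k : ℝ) + 1) Filter.atTop Filter.atTop :=
    Filter.tendsto_atTop_add_const_right _ _ tendsto_natCast_atTop_atTop
  have hfin := hu.eventually (eventually_mul_rpow_lt (B := 1 + K * B) hβ0 (mul_pos hc' hc))
  have hTtop : Filter.Tendsto (fun k : ℕ => ((k : ℝ) + 1) ^ P) Filter.atTop Filter.atTop :=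
    (Filter.tendsto_pow_atTop (by omega)).comp hu
  obtain ⟨k₀, hk₀⟩ := Filter.eventually_atTop.1
    ((((hgs.and hgl).and hfin).and (hTtop.eventually_ge_atTop a₀)).and
      (hTtop.eventually_ge_atTop t₀))
  refine ⟨((k₀ : ℝ) + 1) ^ P, by positivity, fun t ht => ?_⟩
  obtain ⟨k, hk, hkt, htk⟩ := exists_nat_pow_mem_Ico (by omega) ht
  obtain ⟨⟨⟨⟨h1, h2⟩, h3⟩, h4⟩, h5⟩ := hk₀ k hk
  have hu1 : 1 ≤ (k : ℝ) + 1 := by linarith [(Nat.cast_nonneg k : (0 : ℝ) ≤ k)]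
  rw [hTτ] at h1 h2
  push_cast at h1 h2
  set u : ℝ := (k : ℝ) + 1 with hu_def
  have hu0 : 0 < u := by linarith
  have ha1 : 1 ≤ u ^ P := one_le_pow₀ hu1
  have ha0 : 0 < u ^ P := by linarith
  have hab : u ^ P ≤ (u + 1) ^ P := hTmono k
  have ht1 : 1 ≤ t := ha1.trans hkt
  have ht0 : 0 < t := by linarith
  have hI1 : I t ⊆ I (u ^ P) := hIdec _ _ ha0 hkt
  have hI2 : I ((u + 1) ^ P) ⊆ I t := hIdec _ _ ht0 htk
  have hinc := hdiff (u ^ P) ((u + 1) ^ P) h4 hab (I (u ^ P)) (I ((u + 1) ^ P)) (hImeas _ ha0)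
    (hImeas _ (by positivity)) (hI2.trans hI1) (hM₀ _ ha1)
  rw [hvol _ ha0, hvol _ (by positivity)] at hinc
  have hincr := mul_le_mul_of_nonneg_left
    (volume_increment_le (e := e) hr (by omega) hc hκ0 hu1 hβ1 : _ ≤ B * u ^ (β - 1)) hK.le
  have hlower : c' * c * u ^ β ≤ ballVol σ (e + 1) (I t) t g := by
    refine le_trans ?_ (hlow t (h5.trans hkt) (I t) (hImeas t ht0) (hM₀ t ht1))
    rw [hvol t ht0, mul_assoc, mul_assoc, mul_assoc]
    have h6 : u ^ β ≤ t ^ (-κ) * t ^ r := by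
      rw [← hpow u hu0, ← Real.rpow_natCast (u ^ P) r, ← Real.rpow_natCast t r,
        ← Real.rpow_add ha0, ← Real.rpow_add ht0]
      exact Real.rpow_le_rpow ha0.le hkt (by linarith)
    gcongr
  have hδ : 0 ≤ 1 - 1 / (2 * β) := by
    have : 1 / (2 * β) ≤ 1 := by rw [div_le_one (by positivity)]; linarith
    linarith
  refine lt_of_lt_of_le ?_ (Real.rpow_le_rpow (by positivity) hlower hδ)
  refine lt_of_le_of_lt ?_ h3
  have n1 := ballCount_hitVal_mono σ (e + 1) hI2 hkt g
  have n2 := ballCount_hitVal_mono σ (e + 1) hI1 htk g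
  have v1 := ballVol_mono σ (e + 1) hI2 hkt g
  have v2 := ballVol_mono σ (e + 1) hI1 htk g
  have h1' := abs_lt.1 h1
  have h2' := abs_lt.1 h2
  rw [abs_le]
  constructor <;> linarith [h1'.1, h1'.2, h2'.1, h2'.2]

lemma ballCount_hitVal_eq_card (σ : Fin n → ℝ) (d : ℕ) (J : Set ℝ) (t : ℝ) (g : SLR n) :
    ballCount (hitVal σ d J) t g
      = Nat.card {v : Fin n → ℤ | eucNorm (intVec v) ≤ t ∧ diagForm σ d
        (act (intVec v) g) ∈ J} := by
  classical
  have h : {v : Fin n → ℤ | eucNorm (intVec v) ≤ t ∧ diagForm σ d (act (intVec v) g) ∈ J}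
      = ((ballPts n t).filter fun v => diagForm σ d (act (intVec v) g) ∈ J : Finset _) := by
    ext v
    rw [Finset.coe_filter]
    exact and_congr mem_ballPts.symm Iff.rfl
  rw [h, Nat.card_eq_card_toFinset, Finset.toFinset_coe, Finset.card_filter, ballCount]
  push_cast
  rfl

/-- Pulling back by `g` turns `A_{g,I,t}` into a subset of the Euclidean ball. -/
lemma act_mem_Aset_iff {p q d : ℕ} {g : SLR (p + q)} {J : Set ℝ} {t : ℝ} {x : Fin (p + q) → ℝ} :
    act x g ∈ Aset p q d g J t ↔ eucNorm x ≤ t ∧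
      diagForm (fun i : Fin (p + q) => if (i : ℕ) < p then (1 : ℝ) else -1) d (act x g) ∈ J := by
  constructor
  · rintro ⟨h1, y, h2, h3⟩
    have h4 : y = x := by
      rw [← act_act_inv x g, ← act_act_inv y g]
      exact congrArg (fun z => act z g⁻¹) h3
    exact ⟨h4 ▸ h2, h1⟩
  · rintro ⟨h1, h2⟩
    exact ⟨h2, x, h1, rfl⟩

end conclusion

/-- Theorem 4.1 of the paper: power saving discrepancy bound
`D(ℤⁿg, A_{g,I_t,t}) < vol(A_{g,I_t,t})^δ` for almost every `g` and all large `t`. -/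
theorem discrepancy_power_saving
    (p q d : ℕ) (hp : 1 ≤ p) (hq : 1 ≤ q) (hd2 : 2 ≤ d) (hdeven : Even d)
    (hnd : d < p + q)
    (κ : ℝ) (hκ0 : 0 < κ) (hκ : κ < (p + q : ℝ) - d)
    (I : ℝ → Set ℝ) (c : ℝ) (hc : 0 < c)
    (hImeas : ∀ t > (0 : ℝ), MeasurableSet (I t))
    (hIbdd : ∀ t > (0 : ℝ), Bornology.IsBounded (I t))
    (hIdec : ∀ s t : ℝ, 0 < s → s ≤ t → I t ⊆ I s)
    (hIvol : ∀ t > (0 : ℝ), volume (I t) = ENNReal.ofReal (c * t ^ (-κ)))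
    (μ : Measure (SLR (p + q))) [μ.IsHaarMeasure] :
    ∃ δ : ℝ, 0 < δ ∧ δ < 1 ∧ ∀ᵐ g ∂μ, ∃ tg > (0 : ℝ), ∀ t ≥ tg,
      disc g (Aset p q d g (I t) t)
        < (volume (Aset p q d g (I t) t)).toReal ^ δ := by
  obtain ⟨e, rfl⟩ : ∃ e, d = e + 1 := ⟨d - 1, by omega⟩
  obtain ⟨r, hn⟩ : ∃ r, p + q = e + 1 + r := ⟨p + q - (e + 1), by omega⟩
  have hr : (r : ℝ) = p + q - (e + 1 : ℕ) := by
    rw [eq_sub_iff_add_eq, add_comm]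
    exact_mod_cast hn.symm
  set σ : Fin (p + q) → ℝ := fun i => if (i : ℕ) < p then 1 else -1 with hσ
  have hsign : IsSign σ := fun i => by
    simp only [hσ]
    split_ifs <;> simp
  obtain ⟨δ, hδ0, hδ1, h⟩ := exists_ae_abs_ballCount_sub_ballVol_lt hn (by omega) (by omega) hdeven
    hsign (i := ⟨0, by omega⟩) (j := ⟨p, by omega⟩) (if_pos hp) (if_neg (lt_irrefl p)) hκ0
    (hr ▸ hκ) hc hImeas hIbdd hIdec hIvol μ
  refine ⟨δ, hδ0, hδ1, h.mono fun g ⟨tg, htg, hg⟩ => ⟨tg, htg, fun t ht => ?_⟩⟩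
  have hcount : (latCount g (Aset p q (e + 1) g (I t) t) : ℝ)
      = ballCount (hitVal σ (e + 1) (I t)) t g := by
    rw [ballCount_hitVal_eq_card, latCount]
    congr 3
    ext v
    exact act_mem_Aset_iff
  have hvol : (volume (Aset p q (e + 1) g (I t) t)).toReal = ballVol σ (e + 1) (I t) t g := by
    rw [← volume_preimage_act g, ballVol]
    congr 2
    ext x
    exact act_mem_Aset_iff
  rw [disc, hcount, hvol]
  exact hg t ht

end
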